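/- arXiv:1702.02326 — 4 statements merged into one kernel-verified Lean document; each statement's English description precedes it below -/
import Mathlib

section
/- Let φ : ℝⁿ → S be a polynomial map that is homogeneous of degree j and monogenic for the ℝⁿ-Dirac operator, and let i ≥ j ≥ 0 be integers. Then there is a polynomial map F : ℝ^{n+1} → S, homogeneous of degree i, such that F(x) = I_{j→i}φ(x) for all x ∈ ℝ^{n+1}∖{0}, and F is monogenic for the ℝ^{n+1}-Dirac operator, i.e. Σ_{a=1}^{n+1} E_a ∂F/∂x_a = 0. -/
/- An `S`-valued polynomial map on `ℝⁿ` is identified with its (finitely supported) family of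
coefficients `c : (Fin n →₀ ℕ) → S`, where `c α` is the coefficient of the monomial `x^α`. -/

variable {S : Type*}

/-- The Gegenbauer polynomial `C_k^λ(z)`, defined by its explicit finite-sum formula. -/
noncomputable def gegenbauer (k : ℕ) (lam z : ℂ) : ℂ :=
  ∑ m ∈ Finset.range (k / 2 + 1),
    ((-1 : ℂ) ^ m * (ascPochhammer ℂ (k - m)).eval lam /
        ((Nat.factorial m : ℂ) * (Nat.factorial (k - 2 * m) : ℂ))) * (2 * z) ^ (k - 2 * m)

/-- The Gegenbauer polynomial with integer index, with the convention `C_k^λ = 0` for `k < 0`. -/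
noncomputable def gegenbauerZ (k : ℤ) (lam z : ℂ) : ℂ :=
  if 0 ≤ k then gegenbauer k.toNat lam z else 0

/-- The partial derivative `∂/∂x_k` of a polynomial map. -/
noncomputable def pderivc {n : ℕ} [AddCommGroup S] [Module ℂ S] (k : Fin n)
    (c : (Fin n →₀ ℕ) → S) : (Fin n →₀ ℕ) → S :=
  fun α => (α k + 1) • c (α + Finsupp.single k 1)

/-- The Dirac operator `D = Σ_a E_a ∂/∂x_a` on polynomial maps. -/
noncomputable def diracc {n : ℕ} [AddCommGroup S] [Module ℂ S] (E : Fin n → S →ₗ[ℂ] S)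
    (c : (Fin n →₀ ℕ) → S) : (Fin n →₀ ℕ) → S :=
  fun α => ∑ a, E a (pderivc a c α)

/-- A polynomial map is homogeneous of degree `i` if all its monomials have total degree `i`. -/
def IsHomogC {n : ℕ} [AddCommGroup S] [Module ℂ S] (i : ℕ) (c : (Fin n →₀ ℕ) → S) : Prop :=
  ∀ α, c α ≠ 0 → (∑ a, α a) = i

/-- Evaluation of the polynomial map with coefficients `c` at the point `x ∈ ℝⁿ`. -/
noncomputable def evalc {n : ℕ} [AddCommGroup S] [Module ℂ S] (c : (Fin n →₀ ℕ) → S)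
    (x : Fin n → ℝ) : S :=
  ∑ᶠ α : Fin n →₀ ℕ, ((∏ a, x a ^ α a : ℝ) : ℂ) • c α

open MvPolynomial TensorProduct

noncomputable section
set_option linter.unusedSectionVars false
variable {P : Type*} [CommRing P] [Algebra ℂ P]

def gaA (t r : P) (μ : ℂ) (m l : ℕ) : P :=
  algebraMap ℂ P ((-1 : ℂ) ^ m * (ascPochhammer ℂ (m + l)).eval μ / (m.factorial * l.factorial)) *
    ((2 * t) ^ l * r ^ m)

def gaSh1 (a : ℕ → ℕ → P) (m l : ℕ) : P := match l with | 0 => 0 | l + 1 => a m l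
def gaSh2 (a : ℕ → ℕ → P) (m l : ℕ) : P := match m with | 0 => 0 | m + 1 => a m l

def gaSum (k : ℕ) (a : ℕ → ℕ → P) : P := ∑ m ∈ Finset.range (k / 2 + 1), a m (k - 2 * m)

lemma gaSum_sh2 (k : ℕ) (a : ℕ → ℕ → P) : gaSum (k + 2) (gaSh2 a) = gaSum k a := by
  unfold gaSum
  rw [show (k + 2) / 2 + 1 = (k / 2 + 1) + 1 by omega, Finset.sum_range_succ']
  simp only [gaSh2, add_zero]
  apply Finset.sum_congr rfl
  intro m _
  congr 1
  omega

lemma gaSum_sh2_zero (a : ℕ → ℕ → P) : gaSum 0 (gaSh2 a) = 0 := by simp [gaSum, gaSh2]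
lemma gaSum_sh2_one (a : ℕ → ℕ → P) : gaSum 1 (gaSh2 a) = 0 := by simp [gaSum, gaSh2]
lemma gaSum_sh1_zero (a : ℕ → ℕ → P) : gaSum 0 (gaSh1 a) = 0 := by simp [gaSum, gaSh1]
lemma gaSum_sh1 (k : ℕ) (a : ℕ → ℕ → P) : gaSum (k + 1) (gaSh1 a) = gaSum k a := by
  unfold gaSum
  have h : ∀ m ∈ Finset.range (k / 2 + 1), gaSh1 a m (k + 1 - 2 * m) = a m (k - 2 * m) := by
    intro m hm
    rw [Finset.mem_range] at hm
    rw [show k + 1 - 2 * m = (k - 2 * m) + 1 by omega]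
    rfl
  rcases Nat.even_or_odd' k with ⟨q, hq | hq⟩
  · rw [show (k + 1) / 2 = k / 2 by omega]
    exact Finset.sum_congr rfl h
  · rw [show (k + 1) / 2 + 1 = (k / 2 + 1) + 1 by omega, Finset.sum_range_succ,
      Finset.sum_congr rfl h, show k + 1 - 2 * (k / 2 + 1) = 0 by omega]
    simp [gaSh1]

lemma asc_left (μ : ℂ) (N : ℕ) : (ascPochhammer ℂ (N + 1)).eval μ =
    μ * (ascPochhammer ℂ N).eval (μ + 1) := by
  simp [ascPochhammer_succ_left, Polynomial.eval_comp]

lemma asc_mul (μ : ℂ) (N : ℕ) : μ * (ascPochhammer ℂ N).eval (μ + 1) =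
    (ascPochhammer ℂ N).eval μ * (μ + N) := by
  rw [← asc_left, ascPochhammer_succ_eval]


lemma gaS_m (μ : ℂ) (m l : ℕ) : ((m : ℂ) + 1) * ((-1 : ℂ) ^ (m+1) * (ascPochhammer ℂ (m + 1 + l)).eval μ / ((m+1).factorial * l.factorial)) = -μ * ((-1 : ℂ) ^ m * (ascPochhammer ℂ (m + l)).eval (μ + 1) / (m.factorial * l.factorial)) := by
  rw [show m + 1 + l = m + l + 1 by ring, asc_left, Nat.factorial_succ]
  have := Nat.factorial_ne_zero m
  have := Nat.factorial_ne_zero l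
  have : (m : ℂ) + 1 ≠ 0 := by exact_mod_cast Nat.succ_ne_zero m
  push_cast
  field_simp
  ring

lemma gaS_l (μ : ℂ) (m l : ℕ) : ((l : ℂ) + 1) * ((-1 : ℂ) ^ m * (ascPochhammer ℂ (m + (l + 1))).eval μ / (m.factorial * (l+1).factorial)) = μ * ((-1 : ℂ) ^ m * (ascPochhammer ℂ (m + l)).eval (μ + 1) / (m.factorial * l.factorial)) := by
  rw [show m + (l + 1) = m + l + 1 by ring, asc_left, Nat.factorial_succ]
  have := Nat.factorial_ne_zero m
  have := Nat.factorial_ne_zero l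
  have : (l : ℂ) + 1 ≠ 0 := by exact_mod_cast Nat.succ_ne_zero l
  push_cast
  field_simp

lemma gaA_I4 (t r : P) (μ : ℂ) (m l : ℕ) : gaA t r μ m l =
    gaA t r (μ + 1) m l - 2 * t * gaSh1 (gaA t r (μ + 1)) m l
      + r * gaSh2 (gaA t r (μ + 1)) m l := by
  have key : ∀ N : ℕ, (ascPochhammer ℂ (N + 1)).eval (μ + 1) = (ascPochhammer ℂ N).eval (μ + 1) * (μ + 1 + N) :=
    fun N => ascPochhammer_succ_eval N (μ + 1)
  have hm := Nat.factorial_ne_zero 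
  have h1 : ∀ l : ℕ, (l : ℂ) + 1 ≠ 0 := fun l => by exact_mod_cast Nat.succ_ne_zero l
  rcases m with _ | m <;> rcases l with _ | l <;> simp only [gaSh1, gaSh2]
  · simp [gaA]
  · unfold gaA
    have h : ((-1 : ℂ) ^ 0 * (ascPochhammer ℂ (0 + (l + 1))).eval μ / ((Nat.factorial 0) * (l+1).factorial)) = ((-1 : ℂ) ^ 0 * (ascPochhammer ℂ (0 + (l + 1))).eval (μ + 1) / ((Nat.factorial 0) * (l+1).factorial)) - ((-1 : ℂ) ^ 0 * (ascPochhammer ℂ (0 + l)).eval (μ + 1) / ((Nat.factorial 0) * l.factorial)) := by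
      rw [show 0 + (l + 1) = l + 1 by ring, zero_add, asc_left, key, Nat.factorial_succ]
      have := hm l
      have := h1 l
      push_cast
      field_simp
      try simp only [pow_zero, Nat.factorial_zero, Nat.cast_one]
      ring
    have h := congrArg (algebraMap ℂ P) h
    rw [map_sub] at h
    linear_combination ((2 * t) ^ (l+1)) * h
  · unfold gaA
    have h : ((-1 : ℂ) ^ (m+1) * (ascPochhammer ℂ (m+1 + 0)).eval μ / ((m+1).factorial * (Nat.factorial 0))) = ((-1 : ℂ) ^ (m+1) * (ascPochhammer ℂ (m+1 + 0)).eval (μ + 1) / ((m+1).factorial * (Nat.factorial 0))) + ((-1 : ℂ) ^ m * (ascPochhammer ℂ (m + 0)).eval (μ + 1) / (m.factorial * (Nat.factorial 0))) := by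
      rw [add_zero, add_zero, asc_left, key, Nat.factorial_succ]
      have := hm m
      have := h1 m
      push_cast
      field_simp
      try simp only [Nat.factorial_zero, Nat.cast_one]
      ring
    have h := congrArg (algebraMap ℂ P) h
    rw [map_add] at h
    linear_combination (r ^ (m+1)) * h
  · unfold gaA
    have h : ((-1 : ℂ) ^ (m+1) * (ascPochhammer ℂ (m+1 + (l+1))).eval μ / ((m+1).factorial * (l+1).factorial)) = ((-1 : ℂ) ^ (m+1) * (ascPochhammer ℂ (m+1 + (l+1))).eval (μ + 1) / ((m+1).factorial * (l+1).factorial)) - ((-1 : ℂ) ^ (m+1) * (ascPochhammer ℂ (m + 1 + l)).eval (μ + 1) / ((m+1).factorial * l.factorial)) + ((-1 : ℂ) ^ m * (ascPochhammer ℂ (m + (l+1))).eval (μ + 1) / (m.factorial * (l+1).factorial)) := by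
      rw [show m + 1 + (l + 1) = m + l + 1 + 1 by ring, show m + 1 + l = m + l + 1 by ring, show m + (l + 1) = m + l + 1 by ring, asc_left, key (m + l + 1), Nat.factorial_succ, Nat.factorial_succ]
      have := hm m
      have := h1 m
      have := hm l
      have := h1 l
      push_cast
      field_simp
      ring
    have h := congrArg (algebraMap ℂ P) h
    rw [map_add, map_sub] at h
    linear_combination ((2 * t) ^ (l+1) * r ^ (m+1)) * h

lemma gaA_I3 (t r : P) (μ : ℂ) (m l : ℕ) : (2 * m + l : P) * gaA t r μ m l =
    2 * algebraMap ℂ P μ * (t * gaSh1 (gaA t r (μ + 1)) m l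
      - r * gaSh2 (gaA t r (μ + 1)) m l) := by
  have h1 : ∀ m l : ℕ, ((m : P) + 1) * gaA t r μ (m + 1) l = - algebraMap ℂ P μ * r * gaA t r (μ + 1) m l := by
    intro m l
    unfold gaA
    have h := congrArg (algebraMap ℂ P) (gaS_m μ m l)
    rw [map_mul, map_mul, map_neg, map_add, map_one, map_natCast] at h
    linear_combination ((2 * t) ^ l * r ^ (m+1)) * h
  have h2 : ∀ m l : ℕ, ((l : P) + 1) * gaA t r μ m (l + 1) = 2 * algebraMap ℂ P μ * t * gaA t r (μ + 1) m l := by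
    intro m l
    unfold gaA
    have h := congrArg (algebraMap ℂ P) (gaS_l μ m l)
    rw [map_mul, map_mul, map_add, map_one, map_natCast] at h
    linear_combination ((2 * t) ^ (l+1) * r ^ m) * h
  rcases m with _ | m <;> rcases l with _ | l <;> simp only [gaSh1, gaSh2] <;> push_cast
  · simp
  · linear_combination h2 0 l
  · linear_combination 2 * h1 m 0
  · linear_combination 2 * h1 m (l + 1) + h2 (m+1) l

lemma gaA_D (d : Derivation ℂ P P) (t r : P) (μ : ℂ) (m l : ℕ) : d (gaA t r μ m l) =
    algebraMap ℂ P μ * (2 * d t * gaSh1 (gaA t r (μ + 1)) m l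
      - d r * gaSh2 (gaA t r (μ + 1)) m l) := by
  have d2 : d (2 * t) = 2 * d t := by
    rw [two_mul, map_add, two_mul]
  have hd : d (gaA t r μ m l) = algebraMap ℂ P ((-1 : ℂ) ^ m * (ascPochhammer ℂ (m + l)).eval μ / (m.factorial * l.factorial)) *
    (l * (2 * t) ^ (l - 1) * (2 * d t) * r ^ m + (2 * t) ^ l * (m * r ^ (m - 1) * d r)) := by
    unfold gaA
    rw [Derivation.leibniz, Derivation.map_algebraMap, Derivation.leibniz, Derivation.leibniz_pow,
      Derivation.leibniz_pow, d2]
    simp only [smul_eq_mul, nsmul_eq_mul]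
    ring
  rw [hd]
  rcases m with _ | m <;> rcases l with _ | l <;> simp only [gaSh1, gaSh2, gaA, Nat.add_sub_cancel] <;> push_cast
  · simp
  · have h := congrArg (algebraMap ℂ P) (gaS_l μ 0 l)
    rw [map_mul, map_mul, map_add, map_one, map_natCast] at h
    linear_combination ((2 * t) ^ l * (2 * d t)) * h
  · have h := congrArg (algebraMap ℂ P) (gaS_m μ m 0)
    rw [map_mul, map_mul, map_neg, map_add, map_one, map_natCast] at h
    linear_combination (r ^ m * d r) * h
  · have h := congrArg (algebraMap ℂ P) (gaS_l μ (m+1) l)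
    rw [map_mul, map_mul, map_add, map_one, map_natCast] at h
    have h' := congrArg (algebraMap ℂ P) (gaS_m μ m (l+1))
    rw [map_mul, map_mul, map_neg, map_add, map_one, map_natCast] at h'
    linear_combination ((2 * t) ^ l * (2 * d t) * r ^ (m+1)) * h + ((2 * t) ^ (l+1) * r ^ m * d r) * h'

def gaG (t r : P) (μ : ℂ) (k : ℤ) : P := if 0 ≤ k then gaSum k.toNat (gaA t r μ) else 0

lemma gaG_nat (t r : P) (μ : ℂ) (k : ℕ) : gaG t r μ k = gaSum k (gaA t r μ) := by
  simp [gaG]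

lemma gaG_sh1 (t r : P) (μ : ℂ) (k : ℕ) : gaG t r μ ((k : ℤ) - 1) = gaSum k (gaSh1 (gaA t r μ)) := by
  rcases k with _ | k
  · simp [gaG, gaSum_sh1_zero]
  · rw [gaSum_sh1, ← gaG_nat]; congr 1; push_cast; ring

lemma gaG_sh2 (t r : P) (μ : ℂ) (k : ℕ) : gaG t r μ ((k : ℤ) - 2) = gaSum k (gaSh2 (gaA t r μ)) := by
  rcases k with _ | _ | k
  · simp [gaG, gaSum_sh2_zero]
  · simp [gaG, gaSum_sh2_one]
  · rw [gaSum_sh2, ← gaG_nat]; congr 1; push_cast; ring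

lemma gaG_neg (t r : P) (μ : ℂ) (k : ℤ) (hk : k < 0) : gaG t r μ k = 0 := by
  simp [gaG, hk]

lemma gaG_I4 (t r : P) (μ : ℂ) (k : ℤ) : gaG t r μ k =
    gaG t r (μ + 1) k - 2 * t * gaG t r (μ + 1) (k - 1) + r * gaG t r (μ + 1) (k - 2) := by
  rcases lt_or_ge k 0 with hk | hk
  · rw [gaG_neg, gaG_neg, gaG_neg, gaG_neg] <;> first | omega | simp
  · lift k to ℕ using hk
    rw [gaG_sh1, gaG_sh2, gaG_nat, gaG_nat]
    simp only [gaSum, Finset.mul_sum, ← Finset.sum_sub_distrib, ← Finset.sum_add_distrib]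
    exact Finset.sum_congr rfl fun m _ => gaA_I4 _ _ _ _ _

lemma gaG_I3 (t r : P) (μ : ℂ) (k : ℤ) : (k : P) * gaG t r μ k =
    2 * algebraMap ℂ P μ * (t * gaG t r (μ + 1) (k - 1) - r * gaG t r (μ + 1) (k - 2)) := by
  rcases lt_or_ge k 0 with hk | hk
  · rw [gaG_neg, gaG_neg, gaG_neg] <;> first | omega | simp
  · lift k to ℕ using hk
    rw [gaG_sh1, gaG_sh2, gaG_nat]
    simp only [gaSum, Finset.mul_sum, ← Finset.sum_sub_distrib, ← Finset.sum_add_distrib]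
    refine Finset.sum_congr rfl fun m hm => ?_
    rw [← gaA_I3]
    rw [Finset.mem_range] at hm
    congr 1
    have : k = 2 * m + (k - 2 * m) := by omega
    conv_lhs => rw [this]
    push_cast
    rfl

lemma gaG_D (d : Derivation ℂ P P) (t r : P) (μ : ℂ) (k : ℤ) : d (gaG t r μ k) =
    algebraMap ℂ P μ * (2 * d t * gaG t r (μ + 1) (k - 1) - d r * gaG t r (μ + 1) (k - 2)) := by
  rcases lt_or_ge k 0 with hk | hk
  · rw [gaG_neg, gaG_neg, gaG_neg] <;> first | omega | simp
  · lift k to ℕ using hk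
    rw [gaG_sh1, gaG_sh2, gaG_nat]
    simp only [gaSum, Finset.mul_sum, ← Finset.sum_sub_distrib, ← Finset.sum_add_distrib, map_sum]
    exact Finset.sum_congr rfl fun m hm => gaA_D _ _ _ _ _ _

lemma gaG_I1 (t r : P) (μ : ℂ) (k : ℤ) : ((k : P) + 2 * algebraMap ℂ P μ) * gaG t r μ k =
    2 * algebraMap ℂ P μ * (gaG t r (μ + 1) k - t * gaG t r (μ + 1) (k - 1)) := by
  linear_combination gaG_I3 t r μ k + 2 * algebraMap ℂ P μ * gaG_I4 t r μ k

lemma gaG_I2 (t r : P) (μ : ℂ) (k : ℤ) : (k + 1 : P) * gaG t r μ (k + 1)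
    - ((k : P) + 2 * algebraMap ℂ P μ) * t * gaG t r μ k
    + 2 * (r - t ^ 2) * algebraMap ℂ P μ * gaG t r (μ + 1) (k - 1) = 0 := by
  have h := gaG_I3 t r μ (k + 1)
  rw [show k + 1 - 1 = k by ring, show k + 1 - 2 = k - 1 by ring] at h
  push_cast at h
  linear_combination h - t * gaG_I1 t r μ k

/-- evaluation -/
lemma gaG_eval (s z : ℝ) (hs : s ≠ 0) (μ : ℂ) (k : ℤ) :
    gaG (P := ℂ) ((z : ℝ) : ℂ) (((s : ℝ) : ℂ) ^ 2) μ k = ((s ^ k : ℝ) : ℂ) * gegenbauerZ k μ ((z / s : ℝ) : ℂ) := by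
  rcases lt_or_ge k 0 with hk | hk
  · rw [gaG_neg _ _ _ _ hk]; simp [gegenbauerZ, hk]
  · lift k to ℕ using hk
    rw [gaG_nat]
    simp only [gegenbauerZ, gegenbauer, gaSum, gaA, Int.natCast_nonneg, if_true, Int.toNat_natCast, Finset.mul_sum]
    refine Finset.sum_congr rfl fun m hm => ?_
    rw [Finset.mem_range] at hm
    obtain ⟨l, rfl⟩ : ∃ l, k = 2 * m + l := ⟨k - 2 * m, by omega⟩
    rw [show 2 * m + l - 2 * m = l by omega, show 2 * m + l - m = m + l by omega]
    have hs' : (s : ℂ) ≠ 0 := by exact_mod_cast hs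
    simp only [Algebra.algebraMap_self, RingHom.id_apply, zpow_natCast]
    push_cast
    rw [show (2 * ((z : ℂ) / s)) = (2 * z) / s by ring, div_pow]
    field_simp
    rw [pow_add, pow_mul]
    ring

lemma gaG_map {Q : Type*} [CommRing Q] [Algebra ℂ Q] (f : P →ₐ[ℂ] Q) (t r : P) (μ : ℂ) (k : ℤ) :
    f (gaG t r μ k) = gaG (f t) (f r) μ k := by
  unfold gaG gaSum gaA
  split_ifs
  · simp only [map_sum, map_mul, map_pow, AlgHom.commutes, map_ofNat]
  · simp

end

noncomputable section

abbrev spM (N : ℕ) (S : Type*) [AddCommGroup S] [Module ℂ S] := MvPolynomial (Fin N) ℂ ⊗[ℂ] S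

section mach
variable {N : ℕ} [AddCommGroup S] [Module ℂ S]

def spCo (N : ℕ) (S : Type*) [AddCommGroup S] [Module ℂ S] : spM N S ≃ₗ[ℂ] ((Fin N →₀ ℕ) →₀ S) :=
  TensorProduct.equivFinsuppOfBasisLeft (MvPolynomial.basisMonomials (Fin N) ℂ)

lemma spCo_tmul (p : MvPolynomial (Fin N) ℂ) (s : S) (α) : spCo N S (p ⊗ₜ s) α = coeff α p • s := by
  rw [spCo, TensorProduct.equivFinsuppOfBasisLeft_apply_tmul_apply]
  rfl

/-- partial derivative -/
def spD (a : Fin N) : spM N S →ₗ[ℂ] spM N S := LinearMap.rTensor S (pderiv a).toLinearMap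

lemma spD_tmul (a : Fin N) (p : MvPolynomial (Fin N) ℂ) (s : S) :
    spD a (p ⊗ₜ[ℂ] s) = (pderiv a p) ⊗ₜ[ℂ] s := by
  simp [spD]

lemma spD_smul (a : Fin N) (p : MvPolynomial (Fin N) ℂ) (m : spM N S) :
    spD a (p • m) = pderiv a p • m + p • spD a m := by
  induction m using TensorProduct.induction_on with
  | zero => simp
  | tmul q s =>
    simp only [TensorProduct.smul_tmul', spD_tmul, smul_eq_mul, Derivation.leibniz]
    rw [← TensorProduct.add_tmul, add_comm, mul_comm q]
  | add x y hx hy =>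
    simp only [smul_add, map_add, hx, hy]
    abel

/-- action of endomorphisms of `S` -/
def spE (f : S →ₗ[ℂ] S) : spM N S →ₗ[MvPolynomial (Fin N) ℂ] spM N S :=
  LinearMap.baseChange _ f

lemma spE_tmul (f : S →ₗ[ℂ] S) (p : MvPolynomial (Fin N) ℂ) (s : S) :
    spE f (p ⊗ₜ[ℂ] s) = p ⊗ₜ[ℂ] f s := by
  simp [spE]

lemma spD_spE (a : Fin N) (f : S →ₗ[ℂ] S) (m : spM N S) : spD a (spE f m) = spE f (spD a m) := by
  induction m using TensorProduct.induction_on with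
  | zero => simp
  | tmul q s => simp only [spE_tmul, spD_tmul]
  | add x y hx hy => simp only [map_add, hx, hy]

lemma spCo_D (a : Fin N) (m : spM N S) : ⇑(spCo N S (spD a m)) = pderivc a (spCo N S m) := by
  ext α
  induction m using TensorProduct.induction_on with
  | zero => simp [pderivc]
  | tmul q s =>
    simp only [spD_tmul, pderivc, spCo_tmul, coeff_pderiv]
    rw [← Nat.cast_smul_eq_nsmul ℂ, smul_smul]
    congr 1
    push_cast
    ring
  | add x y hx hy =>
    simp only [pderivc, map_add, Finsupp.add_apply, hx, hy, smul_add] at *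

lemma spCo_E (f : S →ₗ[ℂ] S) (m : spM N S) (α) : spCo N S (spE f m) α = f (spCo N S m α) := by
  induction m using TensorProduct.induction_on with
  | zero => simp
  | tmul q s => simp [spE_tmul, spCo_tmul]
  | add x y hx hy => simp only [map_add, Finsupp.add_apply, hx, hy]

lemma spCo_dirac (E : Fin N → S →ₗ[ℂ] S) (m : spM N S) :
    ⇑(spCo N S (∑ a, spE (E a) (spD a m))) = diracc E (spCo N S m) := by
  ext α
  simp only [map_sum, diracc, Finsupp.finsetSum_apply, spCo_E, spCo_D]

lemma spCo_X_D (a : Fin N) (m : spM N S) (α) :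
    spCo N S ((X a : MvPolynomial (Fin N) ℂ) • spD a m) α = α a • spCo N S m α := by
  induction m using TensorProduct.induction_on with
  | zero => simp
  | tmul q s =>
    rw [spD_tmul, TensorProduct.smul_tmul', spCo_tmul, spCo_tmul, smul_eq_mul,
      ← Nat.cast_smul_eq_nsmul ℂ, smul_smul]
    congr 1
    rw [coeff_X_mul']
    split_ifs with h
    · rw [coeff_pderiv]
      have h1 : Finsupp.single a 1 ≤ α := by
        rw [Finsupp.single_le_iff]
        rw [Finsupp.mem_support_iff] at h
        omega
      rw [tsub_add_cancel_of_le h1, mul_comm]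
      congr 1
      rw [Finsupp.mem_support_iff] at h
      rw [Finsupp.tsub_apply, Finsupp.single_eq_same, Nat.cast_sub (by omega)]
      simp
    · rw [Finsupp.notMem_support_iff] at h
      simp [h]
  | add x y hx hy => simp only [map_add, smul_add, Finsupp.add_apply, hx, hy]

lemma spCo_homog (i : ℕ) (m : spM N S) : IsHomogC i (spCo N S m) ↔
    ∑ a, (X a : MvPolynomial (Fin N) ℂ) • spD a m = (i : MvPolynomial (Fin N) ℂ) • m := by
  rw [← (spCo N S).injective.eq_iff, Finsupp.ext_iff]
  refine forall_congr' fun α => ?_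
  rw [map_sum, Finsupp.finsetSum_apply]
  simp only [spCo_X_D]
  rw [← Finset.sum_smul, Nat.cast_smul_eq_nsmul, map_nsmul, Finsupp.smul_apply,
    ← Nat.cast_smul_eq_nsmul ℂ, ← Nat.cast_smul_eq_nsmul ℂ i, ← sub_eq_zero (a := (_ : S)), ← sub_smul, smul_eq_zero,
    sub_eq_zero, Nat.cast_inj]
  tauto

/-- evaluation -/
def spEv (x : Fin N → ℝ) : spM N S →ₗ[ℂ] S :=
  TensorProduct.lid ℂ S ∘ₗ LinearMap.rTensor S (aeval (fun a => (x a : ℂ))).toLinearMap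

lemma spEv_tmul (x : Fin N → ℝ) (p : MvPolynomial (Fin N) ℂ) (s : S) :
    spEv x (p ⊗ₜ[ℂ] s) = aeval (fun a => (x a : ℂ)) p • s := by
  simp [spEv]

lemma spEv_smul (x : Fin N → ℝ) (p : MvPolynomial (Fin N) ℂ) (m : spM N S) :
    spEv x (p • m) = aeval (fun a => (x a : ℂ)) p • spEv x m := by
  induction m using TensorProduct.induction_on with
  | zero => simp
  | tmul q s => rw [TensorProduct.smul_tmul', spEv_tmul, spEv_tmul, smul_eq_mul, map_mul, mul_smul]
  | add x y hx hy => simp only [map_add, smul_add, hx, hy]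

lemma spEv_E (x : Fin N → ℝ) (f : S →ₗ[ℂ] S) (m : spM N S) : spEv x (spE f m) = f (spEv x m) := by
  induction m using TensorProduct.induction_on with
  | zero => simp
  | tmul q s => simp [spE_tmul, spEv_tmul]
  | add x y hx hy => simp only [map_add, hx, hy]

lemma evalc_spCo (x : Fin N → ℝ) (m : spM N S) : evalc (spCo N S m) x = spEv x m := by
  obtain ⟨c, rfl⟩ := (spCo N S).symm.surjective m
  rw [LinearEquiv.apply_symm_apply]
  unfold evalc
  rw [finsum_eq_sum_of_support_subset (s := c.support)]
  · rw [spCo, TensorProduct.equivFinsuppOfBasisLeft_symm_apply, Finsupp.sum, map_sum]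
    refine Finset.sum_congr rfl fun α _ => ?_
    rw [spEv_tmul, coe_basisMonomials, aeval_monomial, Finsupp.prod_fintype _ _ (by simp)]
    simp
  · intro α h
    simp only [Finset.mem_coe, Finsupp.mem_support_iff]
    intro h0
    simp [h0] at h

end mach

section ren
variable {n : ℕ} [AddCommGroup S] [Module ℂ S]

def spR (m : spM n S) : spM (n + 1) S :=
  LinearMap.rTensor S (rename (R := ℂ) (Fin.castSucc (n := n))).toLinearMap m

lemma spR_tmul (p : MvPolynomial (Fin n) ℂ) (s : S) :
    spR (p ⊗ₜ[ℂ] s) = (rename Fin.castSucc p) ⊗ₜ[ℂ] s := by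
  simp [spR]

lemma spR_add (x y : spM n S) : spR (x + y) = spR x + spR y := by simp [spR]
lemma spR_zero : spR (0 : spM n S) = 0 := by simp [spR]
lemma spR_sum {ι : Type*} (s : Finset ι) (f : ι → spM n S) : spR (∑ a ∈ s, f a) = ∑ a ∈ s, spR (f a) := by
  simp [spR]

lemma spR_smul (p : MvPolynomial (Fin n) ℂ) (m : spM n S) :
    spR (p • m) = rename Fin.castSucc p • spR m := by
  induction m using TensorProduct.induction_on with
  | zero => simp [spR_zero]
  | tmul q s => rw [TensorProduct.smul_tmul', spR_tmul, spR_tmul, smul_eq_mul, map_mul, TensorProduct.smul_tmul', smul_eq_mul]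
  | add x y hx hy => simp only [spR_add, smul_add, hx, hy]

lemma spR_E (f : S →ₗ[ℂ] S) (m : spM n S) : spR (spE f m) = spE f (spR m) := by
  induction m using TensorProduct.induction_on with
  | zero => simp [spR_zero]
  | tmul q s => simp [spE_tmul, spR_tmul]
  | add x y hx hy => simp only [map_add, spR_add, hx, hy]

lemma spR_D (a : Fin n) (m : spM n S) : spD a.castSucc (spR m) = spR (spD a m) := by
  induction m using TensorProduct.induction_on with
  | zero => simp [spR_zero]
  | tmul q s => rw [spR_tmul, spD_tmul, spD_tmul, spR_tmul, pderiv_rename (Fin.castSucc_injective n)]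
  | add x y hx hy => simp only [map_add, spR_add, hx, hy]

lemma spR_D_last (m : spM n S) : spD (Fin.last n) (spR m) = 0 := by
  induction m using TensorProduct.induction_on with
  | zero => simp [spR_zero]
  | tmul q s =>
    rw [spR_tmul, spD_tmul, pderiv_eq_zero_of_notMem_vars, TensorProduct.zero_tmul]
    intro h
    have := vars_rename (Fin.castSucc (n := n)) q h
    simp only [Finset.mem_image] at this
    obtain ⟨a, _, ha⟩ := this
    exact (Fin.castSucc_lt_last a).ne ha
  | add x y hx hy => simp only [map_add, spR_add, hx, hy, add_zero]

lemma spR_Ev (x : Fin (n + 1) → ℝ) (m : spM n S) :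
    spEv x (spR m) = spEv (fun a => x a.castSucc) m := by
  induction m using TensorProduct.induction_on with
  | zero => simp [spR_zero]
  | tmul q s =>
    rw [spR_tmul, spEv_tmul, spEv_tmul, aeval_rename]
    rfl
  | add x y hx hy => simp only [map_add, spR_add, hx, hy]

end ren


section core

lemma dirac_core {P M : Type*} [CommRing P] [AddCommGroup M] [Module P M] {n : ℕ}
    (half : P) (hhalf : half * 2 = 1)
    (e : Fin n → M →ₗ[P] M) (e' : M →ₗ[P] M)
    (D : Fin n → M → M) (D' : M → M)
    (hDadd : ∀ a x y, D a (x + y) = D a x + D a y) (hDadd' : ∀ x y, D' (x + y) = D' x + D' y)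
    (hD0 : ∀ a, D a 0 = 0) (hD0' : D' 0 = 0)
    (d : Fin n → P → P) (d' : P → P)
    (hDs : ∀ a p m, D a (p • m) = d a p • m + p • D a m)
    (hDs' : ∀ p m, D' (p • m) = d' p • m + p • D' m)
    (hDe : ∀ a b m, D a (e b m) = e b (D a m)) (hDe' : ∀ a m, D a (e' m) = e' (D a m))
    (hD'e : ∀ b m, D' (e b m) = e b (D' m)) (hD'e' : ∀ m, D' (e' m) = e' (D' m))
    (Y : Fin n → P) (hY : ∀ a b, d a (Y b) = if a = b then 1 else 0) (hY' : ∀ b, d' (Y b) = 0)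
    (cl0 : ∀ a b m, e a (e b m) + e b (e a m) + (if a = b then (2 : P) • m else 0) = 0)
    (clL : ∀ a m, e a (e' m) + e' (e a m) = 0)
    (clLL0 : ∀ m, e' (e' m) + e' (e' m) + (2 : P) • m = 0)
    (φ : M) (j : ℕ)
    (hD : ∑ a : Fin n, e a (D a φ) = 0)
    (hL : D' φ = 0)
    (hEu : ∑ a : Fin n, Y a • D a φ = (j : P) • φ)
    (A B A' B' At Bt : P)
    (hA : ∀ a : Fin n, d a A = Y a * A')
    (hB : ∀ a : Fin n, d a B = Y a * B')
    (hAt : d' A = At) (hBt : d' B = Bt)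
    (h1 : A' + Bt = 0)
    (h2 : At - (∑ a : Fin n, Y a ^ 2) * B' - ((n : P) + 2 * (j : P)) * B = 0) :
    ∑ a : Fin n, e a (D a (A • φ + B • ∑ b : Fin n, Y b • e b (e' φ)))
      + e' (D' (A • φ + B • ∑ b : Fin n, Y b • e b (e' φ))) = 0 := by
  have cancel : ∀ {x y : M}, (2 : P) • x = (2 : P) • y → x = y := by
    intro x y h
    have := congrArg (fun z => half • z) h
    simpa only [smul_smul, hhalf, one_smul] using this
  have hsum : ∀ a (f : Fin n → M), D a (∑ b, f b) = ∑ b, D a (f b) := fun a f =>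
    map_sum (AddMonoidHom.mk' (D a) (hDadd a)) f Finset.univ
  have hsum' : ∀ (f : Fin n → M), D' (∑ b, f b) = ∑ b, D' (f b) := fun f =>
    map_sum (AddMonoidHom.mk' D' hDadd') f Finset.univ
  have cl : ∀ a b m, e a (e b m) + e b (e a m) = if a = b then (-2 : P) • m else 0 := by
    intro a b m
    rw [eq_neg_of_add_eq_zero_left (cl0 a b m)]
    split_ifs <;> simp
  have clLL : ∀ m, e' (e' m) = - m := by
    intro m
    apply cancel
    have := clLL0 m
    rw [two_smul, eq_neg_of_add_eq_zero_left this, smul_neg]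
  have claa : ∀ a m, e a (e a m) = - m := by
    intro a m
    have := cl a a m
    rw [if_pos rfl, ← two_smul P, neg_smul, ← smul_neg] at this
    exact cancel this
  set v := ∑ b : Fin n, Y b • e b (e' φ) with hv
  have hxx : ∑ a, Y a • e a v = - (∑ a, Y a ^ 2) • e' φ := by
    apply cancel
    have e1 : ∑ a, Y a • e a v = ∑ a, ∑ b, (Y a * Y b) • e a (e b (e' φ)) := by
      refine Finset.sum_congr rfl fun a _ => ?_
      rw [hv, map_sum, Finset.smul_sum]
      refine Finset.sum_congr rfl fun b _ => ?_
      rw [map_smul, smul_smul]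
    have e2 : ∑ a, Y a • e a v = ∑ a, ∑ b, (Y a * Y b) • e b (e a (e' φ)) := by
      rw [e1, Finset.sum_comm]
      refine Finset.sum_congr rfl fun a _ => Finset.sum_congr rfl fun b _ => ?_
      rw [mul_comm]
    rw [two_smul]
    nth_rewrite 1 [e1]
    rw [e2]
    simp only [← Finset.sum_add_distrib, ← smul_add, cl, smul_ite, smul_zero, Finset.sum_ite_eq,
      Finset.mem_univ, if_true, smul_smul]
    rw [← Finset.sum_smul]
    congr 1
    rw [← Finset.sum_mul]
    simp only [pow_two]
    ring
  have hDv : ∀ a, D a v = e a (e' φ) + ∑ b, Y b • e b (e' (D a φ)) := by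
    intro a
    rw [hv, hsum]
    simp only [hDs, hY, hDe, hDe', Finset.sum_add_distrib, ite_smul, one_smul, zero_smul,
      Finset.sum_ite_eq, Finset.mem_univ, if_true]
  have hLv : D' v = 0 := by
    rw [hv, hsum']
    refine Finset.sum_eq_zero fun b _ => ?_
    simp only [hDs', hY', hD'e, hD'e', hL, map_zero, smul_zero, add_zero, zero_smul]
  have hS : ∑ a, e a (D a v) = - ((n : P) + 2 * (j : P)) • e' φ := by
    have e1 : ∀ a, e a (D a v) = - e' φ + ∑ b, Y b • e b (e' (e a (D a φ)))
        - (2 : P) • Y a • e' (D a φ) := by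
      intro a
      rw [hDv, map_add, claa, map_sum, add_sub_assoc]
      congr 1
      rw [eq_sub_iff_add_eq]
      have : (2 : P) • Y a • e' (D a φ) =
        ∑ b, if a = b then (2 * Y a) • e' (D a φ) else 0 := by
        simp [smul_smul]
      rw [this, ← Finset.sum_add_distrib]
      refine Finset.sum_congr rfl fun b _ => ?_
      have c1 := cl a b (e' (D a φ))
      have c2 := clL a (D a φ)
      rw [map_smul, eq_neg_of_add_eq_zero_right c2, map_neg, eq_sub_of_add_eq c1]
      split_ifs with hab
      · subst hab
        module
      · module
    simp only [e1, Finset.sum_sub_distrib, Finset.sum_add_distrib]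
    rw [Finset.sum_comm]
    simp only [← Finset.smul_sum, ← map_sum]
    rw [hD]
    have e3 : ∑ a, Y a • e' (D a φ) = (j : P) • e' φ := by
      rw [← map_smul, ← hEu, map_sum]
      simp only [map_smul]
    rw [e3]
    simp only [map_zero, smul_zero, Finset.sum_const_zero, add_zero, Finset.sum_const,
      Finset.card_univ, Fintype.card_fin]
    rw [← Nat.cast_smul_eq_nsmul P]
    module
  have hev : e' v = - ∑ b, Y b • e b (e' (e' φ)) := by
    rw [hv, map_sum, ← Finset.sum_neg_distrib]
    refine Finset.sum_congr rfl fun b _ => ?_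
    rw [map_smul, eq_neg_of_add_eq_zero_right (clL b (e' φ)), smul_neg]
  simp only [clLL, map_neg, smul_neg, Finset.sum_neg_distrib, neg_neg] at hev
  have f1 : ∀ a : Fin n, e a (D a (A • φ + B • v)) =
      A' • (Y a • e a φ) + A • e a (D a φ) + (B' • (Y a • e a v) + B • e a (D a v)) := by
    intro a
    rw [hDadd, hDs, hDs, hA, hB]
    simp only [map_add, map_smul, smul_smul]
    rw [mul_comm A', mul_comm B']
  simp only [f1, Finset.sum_add_distrib, ← Finset.smul_sum]
  rw [hD, hS, hxx, hDadd', hDs', hDs', hL, hLv, hAt, hBt]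
  simp only [smul_zero, add_zero, map_add, map_smul]
  rw [hev]
  have h1' : A' = - Bt := by linear_combination h1
  have h2' : At = (∑ a, Y a ^ 2) * B' + ((n : P) + 2 * (j : P)) * B := by
    linear_combination h2
  rw [h1', h2']
  module

variable {n : ℕ} [AddCommGroup S] [Module ℂ S]

lemma spE_clifford (E : Fin (n + 1) → S →ₗ[ℂ] S)
    (hCl : ∀ a b : Fin (n + 1), E a ∘ₗ E b + E b ∘ₗ E a
      = if a = b then (-2 : ℂ) • (LinearMap.id : S →ₗ[ℂ] S) else 0) (a b : Fin (n + 1))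
    (m : spM (n + 1) S) : spE (E a) (spE (E b) m) + spE (E b) (spE (E a) m) +
      (if a = b then (2 : MvPolynomial (Fin (n + 1)) ℂ) • m else 0) = 0 := by
  induction m using TensorProduct.induction_on with
  | zero => simp
  | tmul q s =>
    have h := LinearMap.congr_fun (hCl a b) s
    simp only [LinearMap.add_apply, LinearMap.comp_apply] at h
    simp only [spE_tmul, ← TensorProduct.tmul_add, h]
    split_ifs
    · rw [two_smul, ← TensorProduct.tmul_add, ← TensorProduct.tmul_add, ← two_smul ℂ s]
      simp
    · simp
  | add x y hx hy =>
    have : (if a = b then (2 : MvPolynomial (Fin (n + 1)) ℂ) • (x + y) else 0) =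
      (if a = b then (2 : MvPolynomial (Fin (n + 1)) ℂ) • x else 0) +
      (if a = b then (2 : MvPolynomial (Fin (n + 1)) ℂ) • y else 0) := by
      split_ifs <;> simp
    rw [this]
    simp only [map_add]
    rw [add_add_add_comm (spE (E a) (spE (E b) x)), add_add_add_comm, hx, hy, add_zero]

end core

section fin
variable {n : ℕ} [AddCommGroup S] [Module ℂ S]

/-- Euler derivation -/
def spEuD (N : ℕ) : Derivation ℂ (MvPolynomial (Fin N) ℂ) (MvPolynomial (Fin N) ℂ) :=
  ∑ a, (X a : MvPolynomial (Fin N) ℂ) • pderiv a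

lemma spEuD_apply (N : ℕ) (p : MvPolynomial (Fin N) ℂ) : spEuD N p = ∑ a, X a * pderiv a p := by
  unfold spEuD
  have : ∀ s : Finset (Fin N), (∑ a ∈ s, (X a : MvPolynomial (Fin N) ℂ) • pderiv (R := ℂ) a) p = ∑ a ∈ s, X a * pderiv a p := by
    intro s
    induction s using Finset.induction_on with
    | empty => simp
    | insert a s ha ih => rw [Finset.sum_insert ha, Finset.sum_insert ha, Derivation.add_apply, ih]; simp
  exact this _

lemma spEuD_X (N : ℕ) (b : Fin N) : spEuD N (X b) = X b := by
  rw [spEuD_apply, Finset.sum_eq_single b]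
  · simp
  · intro a _ hab
    rw [pderiv_X_of_ne hab.symm, mul_zero]
  · simp

def spEu {N : ℕ} (m : spM N S) : spM N S := ∑ a, (X a : MvPolynomial (Fin N) ℂ) • spD a m

lemma spEu_add {N : ℕ} (x y : spM N S) : spEu (x + y) = spEu x + spEu y := by
  simp only [spEu, map_add, smul_add, Finset.sum_add_distrib]

lemma spEu_sum {N : ℕ} {ι : Type*} (s : Finset ι) (f : ι → spM N S) :
    spEu (∑ a ∈ s, f a) = ∑ a ∈ s, spEu (f a) := by
  simp only [spEu, map_sum, Finset.smul_sum]
  rw [Finset.sum_comm]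

lemma spEu_smul {N : ℕ} (p : MvPolynomial (Fin N) ℂ) (m : spM N S) :
    spEu (p • m) = spEuD N p • m + p • spEu m := by
  simp only [spEu, spD_smul, smul_add, Finset.sum_add_distrib, spEuD_apply, Finset.sum_smul,
    Finset.smul_sum, smul_smul]
  simp only [mul_comm]

lemma spEu_E {N : ℕ} (f : S →ₗ[ℂ] S) (m : spM N S) : spEu (spE f m) = spE f (spEu m) := by
  simp only [spEu, spD_spE, map_sum, map_smul]

end fin


end

theorem statement6 (n : ℕ) (hn : 1 ≤ n) [AddCommGroup S] [Module ℂ S]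
    (E : Fin (n + 1) → S →ₗ[ℂ] S)
    (hCl : ∀ a b : Fin (n + 1), E a ∘ₗ E b + E b ∘ₗ E a
      = if a = b then (-2 : ℂ) • (LinearMap.id : S →ₗ[ℂ] S) else 0)
    (j i : ℕ) (hji : j ≤ i)
    (c : (Fin n →₀ ℕ) → S)
    (hfin : (Function.support c).Finite)
    (hhom : IsHomogC j c)
    (hmono : diracc (fun a : Fin n => E (Fin.castSucc a)) c = 0) :
    ∃ F : (Fin (n + 1) →₀ ℕ) → S,
      (Function.support F).Finite
      ∧ IsHomogC i F
      ∧ diracc E F = 0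
      ∧ ∀ x : Fin (n + 1) → ℝ, x ≠ 0 →
          evalc F x
            = (((n : ℂ) + i + j - 1) * ((Real.sqrt (∑ a, x a ^ 2) ^ ((i : ℤ) - j) : ℝ) : ℂ)
                  * gegenbauerZ ((i : ℤ) - j) (((n : ℂ) - 1) / 2 + j)
                    ((x (Fin.last n) / Real.sqrt (∑ a, x a ^ 2) : ℝ) : ℂ)) •
                evalc c (fun a : Fin n => x (Fin.castSucc a))
              + (((n : ℂ) + 2 * j - 1)
                  * ((Real.sqrt (∑ a, x a ^ 2) ^ ((i : ℤ) - j - 1) : ℝ) : ℂ)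
                  * gegenbauerZ ((i : ℤ) - j - 1) (((n : ℂ) + 1) / 2 + j)
                    ((x (Fin.last n) / Real.sqrt (∑ a, x a ^ 2) : ℝ) : ℂ)) •
                ((∑ a : Fin n, ((x (Fin.castSucc a) : ℝ) : ℂ) • E (Fin.castSucc a))
                  (E (Fin.last n) (evalc c (fun a : Fin n => x (Fin.castSucc a))))) := by
  classical
  set P := MvPolynomial (Fin (n + 1)) ℂ with hP
  set lam : ℂ := ((n : ℂ) - 1) / 2 + j with hlam
  set k : ℤ := (i : ℤ) - j with hk
  obtain ⟨φ0, hφ0⟩ : ∃ φ0 : spM n S, ⇑(spCo n S φ0) = c :=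
    ⟨(spCo n S).symm (Finsupp.ofSupportFinite c hfin), by
      rw [LinearEquiv.apply_symm_apply]; rfl⟩
  set φ : spM (n + 1) S := spR φ0 with hφ
  have hD0 : ∑ a : Fin n, spE (E a.castSucc) (spD a φ0) = 0 := by
    apply (spCo n S).injective
    apply DFunLike.coe_injective
    rw [spCo_dirac (fun a : Fin n => E (Fin.castSucc a)), hφ0, hmono]
    simp
  have hD : ∑ a : Fin n, spE (E a.castSucc) (spD a.castSucc φ) = 0 := by
    simp only [hφ, spR_D, ← spR_E, ← spR_sum, hD0, spR_zero]
  have hL : spD (Fin.last n) φ = 0 := spR_D_last φ0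
  have hEu0 := (spCo_homog j φ0).1 (by rw [hφ0]; exact hhom)
  have hEu : ∑ a : Fin n, (X a.castSucc : P) • spD a.castSucc φ = (j : P) • φ := by
    have := congrArg spR hEu0
    rw [spR_sum, spR_smul, map_natCast] at this
    rw [← this]
    refine Finset.sum_congr rfl fun a _ => ?_
    rw [spR_smul, rename_X, hφ, spR_D]
  have hEuT : spEu φ = (j : P) • φ := by
    unfold spEu
    rw [Fin.sum_univ_castSucc, hEu, hL, smul_zero, add_zero]
  set T : P := X (Fin.last n) with hT
  set R : P := ∑ a, X a ^ 2 with hR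
  have dT : ∀ a : Fin n, pderiv a.castSucc T = 0 := fun a =>
    pderiv_X_of_ne (Fin.castSucc_lt_last a).ne'
  have dT' : pderiv (Fin.last n) T = 1 := pderiv_X_self _
  have dR : ∀ a, pderiv a R = 2 * X a := by
    intro a
    rw [hR, map_sum, Finset.sum_eq_single a]
    · rw [Derivation.leibniz_pow]
      simp
    · intro b _ hb
      rw [Derivation.leibniz_pow, pderiv_X_of_ne hb]
      simp
    · simp
  have hRρ : R = (∑ a : Fin n, X a.castSucc ^ 2) + T ^ 2 := by
    rw [hR, Fin.sum_univ_castSucc]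
  have euT : spEuD (n + 1) T = T := spEuD_X _ _
  have euR : spEuD (n + 1) R = 2 * R := by
    rw [spEuD_apply, hR, Finset.mul_sum]
    refine Finset.sum_congr rfl fun a _ => ?_
    rw [← hR, dR]; ring
  have euG : ∀ (μ : ℂ) (q : ℤ), spEuD (n + 1) (gaG T R μ q) = (q : P) * gaG T R μ q := by
    intro μ q
    rw [gaG_D, gaG_I3, euT, euR]
    ring
  set L : P := algebraMap ℂ P lam with hLdef
  have hL1 : algebraMap ℂ P (lam + 1) = L + 1 := by rw [map_add, map_one]
  set A : P := (2 * L + (k : P)) * gaG T R lam k with hA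
  set B : P := (2 * L) * gaG T R (lam + 1) (k - 1) with hB
  have cast1 : (2 * L + (k : P)) = algebraMap ℂ P (2 * lam + k) := by
    rw [map_add, map_mul, map_intCast, map_ofNat]
  have cast2 : (2 * L) = algebraMap ℂ P (2 * lam) := by
    rw [map_mul, map_ofNat]
  have dA : ∀ d : Derivation ℂ P P, d A = (2 * L + (k : P)) * d (gaG T R lam k) := by
    intro d
    rw [hA, cast1, Derivation.leibniz, Derivation.map_algebraMap, smul_zero, add_zero, smul_eq_mul]
  have dB : ∀ d : Derivation ℂ P P, d B = (2 * L) * d (gaG T R (lam + 1) (k - 1)) := by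
    intro d
    rw [hB, cast2, Derivation.leibniz, Derivation.map_algebraMap, smul_zero, add_zero, smul_eq_mul]
  set v : spM (n + 1) S := ∑ b : Fin n, (X b.castSucc : P) •
      spE (E b.castSucc) (spE (E (Fin.last n)) φ) with hv
  have hnj : (n : P) + 2 * (j : P) = 2 * L + 1 := by
    have : (n : ℂ) + 2 * (j : ℂ) = 2 * lam + 1 := by rw [hlam]; ring
    have := congrArg (algebraMap ℂ P) this
    simpa only [map_add, map_mul, map_natCast, map_ofNat, map_one] using this
  refine ⟨⇑(spCo (n + 1) S (A • φ + B • v)), Finsupp.finite_support _, ?_, ?_, ?_⟩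
  · rw [spCo_homog]
    change spEu _ = _
    have hvEu : spEu v = ((j : P) + 1) • v := by
      rw [hv, spEu_sum, Finset.smul_sum]
      refine Finset.sum_congr rfl fun b _ => ?_
      rw [spEu_smul, spEuD_X, spEu_E, spEu_E, hEuT, map_smul, map_smul, smul_smul, smul_smul,
        ← add_smul]
      congr 1
      ring
    have hi : (i : P) = (k : P) + (j : P) := by
      rw [hk]; push_cast; ring
    rw [spEu_add, spEu_smul, spEu_smul, hvEu, hEuT, dA, dB, euG, euG, smul_smul, smul_smul,
      ← add_smul, ← add_smul, smul_add, smul_smul, smul_smul, hi]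
    congr 2
    · rw [hA]; ring
    · rw [hB]; push_cast; ring
  · rw [← spCo_dirac]
    have main := dirac_core (P := P) (M := spM (n + 1) S) (n := n) (C (1/2 : ℂ)) (by
        rw [show (2 : P) = C 2 from rfl, ← C_mul]; norm_num)
      (fun a => spE (E a.castSucc)) (spE (E (Fin.last n)))
      (fun a => spD a.castSucc) (spD (Fin.last n))
      (fun a x y => map_add _ x y) (fun x y => map_add _ x y) (fun a => map_zero _) (map_zero _)
      (fun a => pderiv a.castSucc) (pderiv (Fin.last n))
      (fun a p m => spD_smul _ p m) (fun p m => spD_smul _ p m)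
      (fun a b m => spD_spE _ _ m) (fun a m => spD_spE _ _ m)
      (fun a m => spD_spE _ _ m) (fun m => spD_spE _ _ m)
      (fun a => X a.castSucc)
      (by
        intro a b
        split_ifs with h
        · subst h; exact pderiv_X_self _
        · exact pderiv_X_of_ne (by simpa [eq_comm] using h))
      (fun b => pderiv_X_of_ne (Fin.castSucc_lt_last b).ne)
      (by
        intro a b m
        have := spE_clifford E hCl a.castSucc b.castSucc m
        simpa only [Fin.castSucc_inj] using this)
      (by
        intro a m
        have := spE_clifford E hCl a.castSucc (Fin.last n) m
        rwa [if_neg (Fin.castSucc_lt_last a).ne, add_zero] at this)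
      (by
        intro m
        have := spE_clifford E hCl (Fin.last n) (Fin.last n) m
        rwa [if_pos rfl] at this)
      φ j hD hL hEu A B
      (-(2 * L + (k : P)) * 2 * L * gaG T R (lam + 1) (k - 2))
      (-(2 * L) * 2 * (L + 1) * gaG T R (lam + 1 + 1) (k - 1 - 2))
      ((2 * L + (k : P)) * (L * (2 * gaG T R (lam + 1) (k - 1) - 2 * T * gaG T R (lam + 1) (k - 2))))
      ((2 * L) * ((L + 1) * (2 * gaG T R (lam + 1 + 1) (k - 2) - 2 * T * gaG T R (lam + 1 + 1) (k - 1 - 2))))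
      (by
        intro a
        rw [dA, gaG_D, dT, dR, ← hLdef]; ring)
      (by
        intro a
        rw [dB, gaG_D, dT, dR, hL1]; ring)
      (by
        rw [dA, gaG_D, dT', dR, ← hLdef]; ring)
      (by
        rw [dB, gaG_D, dT', dR, hL1, show k - 1 - 1 = k - 2 by ring]; ring)
      (by
        have h := gaG_I1 T R (lam + 1) (k - 2)
        rw [hL1, show k - 2 - 1 = k - 1 - 2 by ring] at h
        push_cast at h
        linear_combination (-2 * L) * h)
      (by
        have h := gaG_I2 T R (lam + 1) (k - 2)
        rw [hL1, show k - 2 - 1 = k - 1 - 2 by ring, show k - 2 + 1 = k - 1 by ring] at h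
        push_cast at h
        rw [hnj, hB]
        rw [hRρ] at h ⊢
        linear_combination (2 * L) * h)
    have : ∑ a, spE (E a) (spD a (A • φ + B • v)) = 0 := by
      rw [Fin.sum_univ_castSucc]
      exact main
    rw [this]
    simp
  · intro x hx
    set s : ℝ := Real.sqrt (∑ a, x a ^ 2) with hs
    have hpos : 0 < ∑ a, x a ^ 2 := by
      obtain ⟨a, ha⟩ := Function.ne_iff.1 hx
      refine lt_of_lt_of_le (by have : x a ≠ 0 := ha
                                positivity : 0 < x a ^ 2)
        (Finset.single_le_sum (f := fun a => x a ^ 2) (fun b _ => sq_nonneg _) (Finset.mem_univ a))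
    have hs0 : s ≠ 0 := (Real.sqrt_pos.2 hpos).ne'
    have hs2 : (s : ℂ) ^ 2 = ∑ a, (x a : ℂ) ^ 2 := by
      rw [← Complex.ofReal_pow, hs, Real.sq_sqrt hpos.le]
      push_cast; rfl
    have hevφ : spEv x φ = evalc c (fun a : Fin n => x a.castSucc) := by
      rw [hφ, spR_Ev, ← evalc_spCo, hφ0]
    have hG : ∀ (μ : ℂ) (q : ℤ), aeval (fun a => (x a : ℂ)) (gaG T R μ q) =
        ((s ^ q : ℝ) : ℂ) * gegenbauerZ q μ ((x (Fin.last n) / s : ℝ) : ℂ) := by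
      intro μ q
      rw [← gaG_eval s (x (Fin.last n)) hs0, gaG_map, hT, hR, hs2]
      simp only [map_sum, map_pow, aeval_X]
    rw [evalc_spCo, map_add, spEv_smul, spEv_smul, hevφ]
    congr 1
    · congr 1
      rw [hA, cast1, map_mul, AlgHom.commutes, hG, ← mul_assoc]
      congr 2
      rw [hlam, hk]
      simp only [Algebra.algebraMap_self, RingHom.id_apply]
      push_cast
      ring
    · congr 1
      · rw [hB, cast2, map_mul, AlgHom.commutes, hG, ← mul_assoc,
          show lam + 1 = ((n : ℂ) + 1) / 2 + j by rw [hlam]; ring]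
        congr 2
        rw [hlam]
        simp only [Algebra.algebraMap_self, RingHom.id_apply]
        ring
      · rw [hv, map_sum, LinearMap.sum_apply]
        refine Finset.sum_congr rfl fun b _ => ?_
        rw [spEv_smul, aeval_X, spEv_E, spEv_E, hevφ, LinearMap.smul_apply]
end

section
/- Let φ : ℝⁿ → S be a polynomial map that is homogeneous of degree j and monogenic for the ℝⁿ-Dirac operator, let i ≥ j ≥ 0 be integers, let p, q : ℝ → ℂ be polynomials, and define F on ℝ^{n+1}∖{0} by F(x) = |x|^{i−j}·p(z)·φ(x′) + |x|^{i−j−1}·q(z)·x̲′E_{n+1}φ(x′), where z = x_{n+1}/|x|. Then for all x ∈ ℝ^{n+1}∖{0}: Σ_{a=1}^{n+1} E_a (∂F/∂x_a)(x) = |x|^{i−j−2}·[(i−j)p(z) − z p′(z) + (i−j−1)z q(z) + (1−z²)q′(z)]·x̲′φ(x′) + |x|^{i−j−1}·[(i−j)z p(z) + (1−z²)p′(z) − (n+i+j−1)q(z) + (i−j−1)z² q(z) + (1−z²)z q′(z)]·E_{n+1}φ(x′). -/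
/- An `S`-valued polynomial map on `ℝⁿ` is identified with its (finitely supported) family of
coefficients `c : (Fin n →₀ ℕ) → S`, where `c α` is the coefficient of the monomial `x^α`. -/

variable {S : Type*}

section Helpers

theorem aux_evalc_pderivc {n : ℕ} [AddCommGroup S] [Module ℂ S] (k : Fin n)
    (c : (Fin n →₀ ℕ) → S) (hfin : (Function.support c).Finite) (y : Fin n → ℝ) :
    evalc (pderivc k c) y = ∑ α ∈ hfin.toFinset,
      (((α k : ℝ) * ((∏ a ∈ Finset.univ.erase k, y a ^ α a) * y k ^ (α k - 1)) : ℝ) : ℂ) • c α := by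
  set g : (Fin n →₀ ℕ) → S := fun α =>
    (((α k : ℝ) * ((∏ a ∈ Finset.univ.erase k, y a ^ α a) * y k ^ (α k - 1)) : ℝ) : ℂ) • c α with hg
  have h1 : ∑ α ∈ hfin.toFinset, g α = ∑ᶠ α, g α := by
    symm
    apply finsum_eq_sum_of_support_subset
    intro α hα
    simp only [Set.Finite.coe_toFinset, Function.mem_support]
    intro h0
    apply hα
    simp [hg, h0]
  rw [h1]
  have hinj : Function.Injective (fun α : Fin n →₀ ℕ => α + Finsupp.single k 1) :=
    fun a b h => by simpa using h
  have h2 : ∑ᶠ α, g α = ∑ᶠ α ∈ Set.range (fun α : Fin n →₀ ℕ => α + Finsupp.single k 1), g α := by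
    rw [← finsum_mem_univ]
    apply finsum_mem_inter_support_eq
    ext α
    simp only [Set.univ_inter, Function.mem_support, Set.mem_inter_iff, Set.mem_range]
    refine ⟨fun h => ⟨?_, h⟩, fun h => h.2⟩
    have hk : α k ≠ 0 := by
      intro h0
      apply h
      simp [hg, h0]
    refine ⟨α - Finsupp.single k 1, ?_⟩
    apply tsub_add_cancel_of_le
    rw [Finsupp.single_le_iff]
    omega
  rw [h2, finsum_mem_range hinj]
  unfold evalc pderivc
  apply finsum_congr
  intro α
  simp only [hg]
  rw [← Nat.cast_smul_eq_nsmul ℂ, smul_smul]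
  congr 1
  rw [← Finset.prod_erase_mul _ _ (Finset.mem_univ k)]
  have h3 : ∏ a ∈ Finset.univ.erase k, y a ^ (α + Finsupp.single k 1 : Fin n →₀ ℕ) a
      = ∏ a ∈ Finset.univ.erase k, y a ^ α a := by
    apply Finset.prod_congr rfl
    intro a ha
    have : a ≠ k := Finset.ne_of_mem_erase ha
    simp [this.symm]
  rw [h3]
  simp
  ring

theorem aux_evalc_sum {n : ℕ} [AddCommGroup S] [Module ℂ S]
    (c : (Fin n →₀ ℕ) → S) (hfin : (Function.support c).Finite) (y : Fin n → ℝ) :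
    evalc c y = ∑ α ∈ hfin.toFinset, ((∏ a, y a ^ α a : ℝ) : ℂ) • c α := by
  apply finsum_eq_sum_of_support_subset
  intro α hα
  simp only [Set.Finite.coe_toFinset, Function.mem_support]
  intro h0
  apply hα
  simp [h0]

theorem aux_euler {n : ℕ} [AddCommGroup S] [Module ℂ S] (j : ℕ)
    (c : (Fin n →₀ ℕ) → S) (hfin : (Function.support c).Finite) (hhom : IsHomogC j c)
    (y : Fin n → ℝ) :
    ∑ k, ((y k : ℝ) : ℂ) • evalc (pderivc k c) y = (j : ℂ) • evalc c y := by
  simp only [aux_evalc_pderivc _ c hfin, aux_evalc_sum c hfin, Finset.smul_sum, smul_smul]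
  rw [Finset.sum_comm]
  apply Finset.sum_congr rfl
  intro α hα
  rw [← Finset.sum_smul]
  congr 1
  rw [← hhom α (by simpa using hα)]
  push_cast
  rw [Finset.sum_mul]
  apply Finset.sum_congr rfl
  intro k _
  rw [← Finset.prod_erase_mul _ _ (Finset.mem_univ k)]
  rcases Nat.eq_zero_or_pos (α k) with h | h
  · simp [h]
  · obtain ⟨m, hm⟩ := Nat.exists_eq_succ_of_ne_zero h.ne'
    rw [hm]
    simp
    ring

theorem aux_pderivc_fin {n : ℕ} [AddCommGroup S] [Module ℂ S] (k : Fin n)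
    (c : (Fin n →₀ ℕ) → S) (hfin : (Function.support c).Finite) :
    (Function.support (pderivc k c)).Finite := by
  have hinj : Function.Injective (fun α : Fin n →₀ ℕ => α + Finsupp.single k 1) :=
    fun a b h => by simpa using h
  refine (hfin.preimage hinj.injOn).subset ?_
  intro α hα h0
  apply hα
  simp only [pderivc]
  rw [h0, smul_zero]

theorem aux_evalc_map {n : ℕ} [AddCommGroup S] [Module ℂ S] (L : S →ₗ[ℂ] S)
    (c : (Fin n →₀ ℕ) → S) (hfin : (Function.support c).Finite) (y : Fin n → ℝ) :
    L (evalc c y) = evalc (fun α => L (c α)) y := by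
  have hfin' : (Function.support (fun α => L (c α))).Finite := by
    refine hfin.subset ?_
    intro α hα h0
    apply hα
    simp [h0]
  rw [aux_evalc_sum c hfin, map_sum]
  symm
  rw [evalc]
  simp only [map_smul]
  apply finsum_eq_sum_of_support_subset
  intro α hα
  simp only [Set.Finite.coe_toFinset, Function.mem_support]
  intro h0
  apply hα
  simp [h0]

theorem aux_mono {n : ℕ} [AddCommGroup S] [Module ℂ S] (E : Fin n → S →ₗ[ℂ] S)
    (c : (Fin n →₀ ℕ) → S) (hfin : (Function.support c).Finite)
    (hmono : diracc E c = 0) (y : Fin n → ℝ) :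
    ∑ k, E k (evalc (pderivc k c) y) = 0 := by
  have h : ∀ k, E k (evalc (pderivc k c) y)
      = ∑ᶠ α : Fin n →₀ ℕ, ((∏ a, y a ^ α a : ℝ) : ℂ) • E k (pderivc k c α) := by
    intro k
    rw [aux_evalc_map _ _ (aux_pderivc_fin k c hfin)]
    rfl
  simp only [h]
  rw [← finsum_sum_comm]
  · apply finsum_eq_zero_of_forall_eq_zero
    intro α
    rw [← Finset.smul_sum]
    have : ∑ k, E k (pderivc k c α) = 0 := congrFun hmono α
    rw [this, smul_zero]
  · intro k _
    refine (aux_pderivc_fin k c hfin).subset ?_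
    intro α hα h0
    apply hα
    simp [h0]

theorem aux_fderiv_evalc {n : ℕ} [NormedAddCommGroup S] [NormedSpace ℂ S]
    (c : (Fin n →₀ ℕ) → S) (hfin : (Function.support c).Finite) (y : Fin n → ℝ) :
    HasFDerivAt (evalc c)
      (∑ k, (ContinuousLinearMap.proj (R := ℝ) (φ := fun _ : Fin n => ℝ) k).smulRight
        (evalc (pderivc k c) y)) y := by
  have h1 : evalc c = fun y => ∑ α ∈ hfin.toFinset, (∏ a, y a ^ α a : ℝ) • c α := by
    funext y
    rw [aux_evalc_sum c hfin]
    rfl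
  rw [h1]
  have hm : ∀ α : Fin n →₀ ℕ, HasFDerivAt (fun y : Fin n → ℝ => (∏ a, y a ^ α a : ℝ))
      (∑ k, (∏ a ∈ Finset.univ.erase k, y a ^ α a) •
        (((α k : ℝ) * y k ^ (α k - 1)) •
          (ContinuousLinearMap.proj (R := ℝ) (φ := fun _ : Fin n => ℝ) k))) y := by
    intro α
    apply HasFDerivAt.finsetProd
    intro k _
    have := (hasFDerivAt_apply (𝕜 := ℝ) k y).pow (α k)
    simpa using this
  have := HasFDerivAt.fun_sum (u := hfin.toFinset) (fun α _ => (hm α).smul_const (c α))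
  refine this.congr_fderiv ?_
  ext v
  simp only [aux_evalc_pderivc _ c hfin, sum_apply,
    ContinuousLinearMap.smulRight_apply, smul_apply,
    ContinuousLinearMap.proj_apply, Finset.smul_sum, Finset.sum_smul]
  rw [Finset.sum_comm]
  apply Finset.sum_congr rfl
  intro k _
  apply Finset.sum_congr rfl
  intro α _
  rw [Complex.coe_smul, smul_smul (v k)]
  congr 1
  simp only [smul_eq_mul]
  ring

theorem aux_scalar {n : ℕ} (m : ℤ) (P : Polynomial ℂ) (x : Fin (n + 1) → ℝ) (hx : x ≠ 0)
    (r z : ℝ) (hr : r = Real.sqrt (∑ a, x a ^ 2)) (hz : z = x (Fin.last n) / r) :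
    ∃ A' : (Fin (n + 1) → ℝ) →L[ℝ] ℂ,
      HasFDerivAt (fun y : Fin (n + 1) → ℝ => ((Real.sqrt (∑ a, y a ^ 2) ^ m : ℝ) : ℂ)
              * P.eval ((y (Fin.last n) / Real.sqrt (∑ a, y a ^ 2) : ℝ) : ℂ)) A' x ∧
      (∀ a : Fin n, A' (Pi.single (Fin.castSucc a) 1) = (x (Fin.castSucc a) : ℂ) *
        (((r ^ (m - 2) : ℝ) : ℂ) * (m * P.eval (z : ℂ) - z * (Polynomial.derivative P).eval (z : ℂ)))) ∧
      A' (Pi.single (Fin.last n) 1) =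
        ((r ^ (m - 1) : ℝ) : ℂ) * (m * z * P.eval (z : ℂ)
          + (1 - z ^ 2) * (Polynomial.derivative P).eval (z : ℂ)) := by
  have hpos : 0 < ∑ a, x a ^ 2 := by
    obtain ⟨a, ha⟩ := Function.ne_iff.mp hx
    exact Finset.sum_pos' (fun a _ => sq_nonneg _) ⟨a, Finset.mem_univ _, by
      have : x a ≠ 0 := ha
      positivity⟩
  have hr0 : 0 < r := hr ▸ Real.sqrt_pos.mpr hpos
  have hS : HasFDerivAt (fun y : Fin (n + 1) → ℝ => ∑ a, y a ^ 2)
      (∑ a, (2 * x a) • ContinuousLinearMap.proj (R := ℝ) (φ := fun _ : Fin (n+1) => ℝ) a) x := by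
    apply HasFDerivAt.fun_sum
    intro a _
    have := (hasFDerivAt_apply (𝕜 := ℝ) a x).pow 2
    simpa using this
  have hR := hS.sqrt hpos.ne'
  rw [← hr] at hR
  have hRm := (hasDerivAt_zpow m r (Or.inl hr0.ne'))
  rw [hr] at hRm
  have hRm := hRm.comp_hasFDerivAt x hR
  rw [← hr] at hRm
  have hRi := (hasDerivAt_inv hr0.ne')
  rw [hr] at hRi
  have hRi := hRi.comp_hasFDerivAt x hR
  rw [← hr] at hRi
  have hZ := (hasFDerivAt_apply (𝕜 := ℝ) (Fin.last n) x).mul hRi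
  have hP := (P.hasDerivAt (z : ℂ)).comp_ofReal
  have hzz : z = x (Fin.last n) * (Real.sqrt (∑ a, x a ^ 2))⁻¹ := by
    rw [hz, hr]; rfl
  rw [hzz] at hP
  have hPZ := HasFDerivAt.comp (g := fun t : ℝ => P.eval (t : ℂ)) x hP.hasFDerivAt hZ
  rw [← hzz] at hPZ
  have hRmC := (Complex.ofRealCLM.hasFDerivAt).comp x hRm
  have hT := hRmC.mul hPZ
  have hrC : (r : ℂ) ≠ 0 := by exact_mod_cast hr0.ne'
  have hxl : x (Fin.last n) = z * r := by rw [hz]; field_simp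
  have e1 : (r : ℂ) ^ (m - 1) = (r : ℂ) ^ (m - 2) * r := by
    rw [← zpow_add_one₀ hrC]; congr 1; ring
  have e2 : (r : ℂ) ^ m = (r : ℂ) ^ (m - 2) * r * r := by
    rw [← zpow_add_one₀ hrC, ← zpow_add_one₀ hrC]; congr 1; ring
  refine ⟨_, hT, ?_, ?_⟩
  · intro a
    have hne : (Fin.last n) ≠ Fin.castSucc a := (Fin.castSucc_lt_last a).ne'
    simp [← hr, Pi.single_apply, hne]
    simp [← div_eq_mul_inv, hxl, e1, e2]
    field_simp
    ring
  · simp [← hr, Pi.single_apply]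
    simp [← div_eq_mul_inv, hxl, e1, e2]
    field_simp
    ring

theorem aux_comp {n : ℕ} [NormedAddCommGroup S] [NormedSpace ℂ S] (L : S →ₗ[ℂ] S)
    (c : (Fin n →₀ ℕ) → S) (hfin : (Function.support c).Finite) (x : Fin (n + 1) → ℝ) :
    ∃ L' : (Fin (n + 1) → ℝ) →L[ℝ] S,
      HasFDerivAt (fun y : Fin (n + 1) → ℝ => L (evalc c (fun a : Fin n => y (Fin.castSucc a)))) L' x ∧
      (∀ a : Fin n, L' (Pi.single (Fin.castSucc a) 1)
        = L (evalc (pderivc a c) (fun a : Fin n => x (Fin.castSucc a)))) ∧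
      L' (Pi.single (Fin.last n) 1) = 0 := by
  have hfin' : (Function.support (fun α => L (c α))).Finite := by
    refine hfin.subset ?_
    intro α hα h0
    apply hα
    simp [h0]
  simp only [aux_evalc_map L c hfin]
  have hp : ∀ k, L (evalc (pderivc k c) (fun a : Fin n => x (Fin.castSucc a)))
      = evalc (pderivc k (fun α => L (c α))) (fun a : Fin n => x (Fin.castSucc a)) := by
    intro k
    rw [aux_evalc_map L _ (aux_pderivc_fin k c hfin)]
    congr 1
    funext α
    simp only [pderivc, map_nsmul]
  simp only [hp]
  have h1 := aux_fderiv_evalc (fun α => L (c α)) hfin' (fun a : Fin n => x (Fin.castSucc a))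
  have h2 : HasFDerivAt (fun (y : Fin (n + 1) → ℝ) (a : Fin n) => y (Fin.castSucc a))
      (ContinuousLinearMap.pi (fun a : Fin n =>
        ContinuousLinearMap.proj (R := ℝ) (φ := fun _ : Fin (n+1) => ℝ) (Fin.castSucc a))) x := by
    rw [hasFDerivAt_pi]
    intro a
    exact hasFDerivAt_apply (𝕜 := ℝ) (Fin.castSucc a) x
  refine ⟨_, HasFDerivAt.comp (g := evalc (fun α => L (c α))) x h1 h2, ?_, ?_⟩
  · intro a
    simp [Pi.single_apply]
  · simp [Fin.castSucc_ne_last]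

theorem aux_alg {n : ℕ} [AddCommGroup S] [Module ℂ S] (E : Fin (n + 1) → S →ₗ[ℂ] S)
    (hCl : ∀ a b : Fin (n + 1), E a ∘ₗ E b + E b ∘ₗ E a
      = if a = b then (-2 : ℂ) • (LinearMap.id : S →ₗ[ℂ] S) else 0) (t : Fin n → ℂ)
    (X : S →ₗ[ℂ] S) (hX : X = ∑ a : Fin n, t a • E (Fin.castSucc a)) :
    (∀ a v, E a (E a v) = -v) ∧
    (∀ v, E (Fin.last n) (X v) = - X (E (Fin.last n) v)) ∧
    (∀ a v, E (Fin.castSucc a) (X v) = - X (E (Fin.castSucc a) v) - (2 * t a) • v) ∧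
    (∀ v, X (X v) = -((∑ a, t a ^ 2) • v)) := by
  have h0 : ∀ a b v, E a (E b v) + E b (E a v) = if a = b then (-2 : ℂ) • v else 0 := by
    intro a b v
    have := congrArg (fun f : S →ₗ[ℂ] S => f v) (hCl a b)
    simp only [LinearMap.add_apply, LinearMap.comp_apply] at this
    rw [this]
    split_ifs <;> simp
  have hXv : ∀ v, X v = ∑ a, t a • E (Fin.castSucc a) v := by
    intro v
    simp [hX]
  have h1 : ∀ a v, E a (E a v) = -v := by
    intro a v
    have h := h0 a a v
    rw [if_pos rfl, ← two_smul ℂ (E a (E a v)), neg_smul, ← smul_neg] at h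
    exact smul_right_injective S (two_ne_zero (α := ℂ)) h
  have h3 : ∀ a v, E (Fin.castSucc a) (X v) = - X (E (Fin.castSucc a) v) - (2 * t a) • v := by
    intro a v
    have : E (Fin.castSucc a) (X v) + X (E (Fin.castSucc a) v) = - ((2 * t a) • v) := by
      rw [hXv, hXv, map_sum, ← Finset.sum_add_distrib]
      simp only [map_smul, ← smul_add, h0]
      simp [smul_smul, mul_comm]
    rw [eq_sub_of_add_eq this]
    abel
  refine ⟨h1, ?_, h3, ?_⟩
  · intro v
    have : E (Fin.last n) (X v) + X (E (Fin.last n) v) = 0 := by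
      rw [hXv, hXv, map_sum, ← Finset.sum_add_distrib]
      apply Finset.sum_eq_zero
      intro a _
      rw [map_smul, ← smul_add, h0, if_neg (Fin.castSucc_lt_last a).ne', smul_zero]
    exact eq_neg_of_add_eq_zero_left this
  · intro v
    have h : X (X v) = - X (X v) - (2 : ℂ) • (∑ a, t a ^ 2) • v := by
      conv_lhs => rw [hXv]
      simp only [h3, smul_sub, smul_neg]
      rw [Finset.sum_sub_distrib, Finset.sum_neg_distrib]
      congr 1
      · rw [hXv v, map_sum]
        simp
      · rw [Finset.sum_smul, Finset.smul_sum]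
        apply Finset.sum_congr rfl
        intro a _
        rw [smul_smul, smul_smul]
        congr 1
        ring
    apply smul_right_injective S (two_ne_zero (α := ℂ))
    simp only
    rw [two_smul]
    nth_rw 1 [h]
    rw [smul_neg]
    abel

end Helpers

theorem statement7 (n : ℕ) (hn : 1 ≤ n) [NormedAddCommGroup S] [NormedSpace ℂ S]
    (E : Fin (n + 1) → S →ₗ[ℂ] S)
    (hCl : ∀ a b : Fin (n + 1), E a ∘ₗ E b + E b ∘ₗ E a
      = if a = b then (-2 : ℂ) • (LinearMap.id : S →ₗ[ℂ] S) else 0)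
    (j i : ℕ) (hji : j ≤ i)
    (c : (Fin n →₀ ℕ) → S)
    (hfin : (Function.support c).Finite)
    (hhom : IsHomogC j c)
    (hmono : diracc (fun a : Fin n => E (Fin.castSucc a)) c = 0)
    (p q : Polynomial ℂ)
    (F : (Fin (n + 1) → ℝ) → S)
    (hF : ∀ x : Fin (n + 1) → ℝ, x ≠ 0 →
      F x = (((Real.sqrt (∑ a, x a ^ 2) ^ ((i : ℤ) - j) : ℝ) : ℂ)
              * p.eval ((x (Fin.last n) / Real.sqrt (∑ a, x a ^ 2) : ℝ) : ℂ)) •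
            evalc c (fun a : Fin n => x (Fin.castSucc a))
          + (((Real.sqrt (∑ a, x a ^ 2) ^ ((i : ℤ) - j - 1) : ℝ) : ℂ)
              * q.eval ((x (Fin.last n) / Real.sqrt (∑ a, x a ^ 2) : ℝ) : ℂ)) •
            ((∑ a : Fin n, ((x (Fin.castSucc a) : ℝ) : ℂ) • E (Fin.castSucc a))
              (E (Fin.last n) (evalc c (fun a : Fin n => x (Fin.castSucc a)))))) :
    ∀ x : Fin (n + 1) → ℝ, x ≠ 0 →
      ∑ a : Fin (n + 1), E a (fderiv ℝ F x (Pi.single a 1))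
        = (((Real.sqrt (∑ a, x a ^ 2) ^ ((i : ℤ) - j - 2) : ℝ) : ℂ)
              * (((i : ℂ) - j) * p.eval ((x (Fin.last n) / Real.sqrt (∑ a, x a ^ 2) : ℝ) : ℂ)
                - ((x (Fin.last n) / Real.sqrt (∑ a, x a ^ 2) : ℝ) : ℂ)
                    * (Polynomial.derivative p).eval
                      ((x (Fin.last n) / Real.sqrt (∑ a, x a ^ 2) : ℝ) : ℂ)
                + ((i : ℂ) - j - 1) * ((x (Fin.last n) / Real.sqrt (∑ a, x a ^ 2) : ℝ) : ℂ)
                    * q.eval ((x (Fin.last n) / Real.sqrt (∑ a, x a ^ 2) : ℝ) : ℂ)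
                + (1 - ((x (Fin.last n) / Real.sqrt (∑ a, x a ^ 2) : ℝ) : ℂ) ^ 2)
                    * (Polynomial.derivative q).eval
                      ((x (Fin.last n) / Real.sqrt (∑ a, x a ^ 2) : ℝ) : ℂ))) •
            ((∑ a : Fin n, ((x (Fin.castSucc a) : ℝ) : ℂ) • E (Fin.castSucc a))
              (evalc c (fun a : Fin n => x (Fin.castSucc a))))
          + (((Real.sqrt (∑ a, x a ^ 2) ^ ((i : ℤ) - j - 1) : ℝ) : ℂ)
              * (((i : ℂ) - j) * ((x (Fin.last n) / Real.sqrt (∑ a, x a ^ 2) : ℝ) : ℂ)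
                    * p.eval ((x (Fin.last n) / Real.sqrt (∑ a, x a ^ 2) : ℝ) : ℂ)
                + (1 - ((x (Fin.last n) / Real.sqrt (∑ a, x a ^ 2) : ℝ) : ℂ) ^ 2)
                    * (Polynomial.derivative p).eval
                      ((x (Fin.last n) / Real.sqrt (∑ a, x a ^ 2) : ℝ) : ℂ)
                - ((n : ℂ) + i + j - 1)
                    * q.eval ((x (Fin.last n) / Real.sqrt (∑ a, x a ^ 2) : ℝ) : ℂ)
                + ((i : ℂ) - j - 1) * ((x (Fin.last n) / Real.sqrt (∑ a, x a ^ 2) : ℝ) : ℂ) ^ 2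
                    * q.eval ((x (Fin.last n) / Real.sqrt (∑ a, x a ^ 2) : ℝ) : ℂ)
                + (1 - ((x (Fin.last n) / Real.sqrt (∑ a, x a ^ 2) : ℝ) : ℂ) ^ 2)
                    * ((x (Fin.last n) / Real.sqrt (∑ a, x a ^ 2) : ℝ) : ℂ)
                    * (Polynomial.derivative q).eval
                      ((x (Fin.last n) / Real.sqrt (∑ a, x a ^ 2) : ℝ) : ℂ))) •
            (E (Fin.last n) (evalc c (fun a : Fin n => x (Fin.castSucc a)))) := by
  intro x hx
  set φ := evalc c (fun a : Fin n => x (Fin.castSucc a)) with hφ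
  set r := Real.sqrt (∑ a, x a ^ 2) with hr
  set z : ℝ := x (Fin.last n) / r with hz
  set X : S →ₗ[ℂ] S := ∑ a : Fin n, ((x (Fin.castSucc a) : ℝ) : ℂ) • E (Fin.castSucc a) with hX
  set φd : Fin n → S := fun a => evalc (pderivc a c) (fun a : Fin n => x (Fin.castSucc a)) with hφd
  have hpos : 0 < ∑ a, x a ^ 2 := by
    obtain ⟨a, ha⟩ := Function.ne_iff.mp hx
    exact Finset.sum_pos' (fun a _ => sq_nonneg _) ⟨a, Finset.mem_univ _, by
      have : x a ≠ 0 := ha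
      positivity⟩
  have hr0 : 0 < r := Real.sqrt_pos.mpr hpos
  have hrC : (r : ℂ) ≠ 0 := by exact_mod_cast hr0.ne'
  have hsq : (∑ a : Fin n, ((x (Fin.castSucc a) : ℝ) : ℂ) ^ 2) = r ^ 2 * (1 - z ^ 2) := by
    have h1 : r ^ 2 = ∑ a, x a ^ 2 := Real.sq_sqrt hpos.le
    have h2 : x (Fin.last n) = z * r := by rw [hz]; field_simp
    rw [Fin.sum_univ_castSucc, h2] at h1
    have h3 : (∑ a : Fin n, x (Fin.castSucc a) ^ 2) = r ^ 2 * (1 - z ^ 2) := by linarith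
    exact_mod_cast h3
  have heul : ∑ k, ((x (Fin.castSucc k) : ℝ) : ℂ) • φd k = (j : ℂ) • φ :=
    aux_euler j c hfin hhom (fun a : Fin n => x (Fin.castSucc a))
  have hmon : ∑ k : Fin n, E (Fin.castSucc k) (φd k) = 0 :=
    aux_mono _ c hfin hmono (fun a : Fin n => x (Fin.castSucc a))
  obtain ⟨a1, a2, a3, a4⟩ := aux_alg E hCl (fun a => ((x (Fin.castSucc a) : ℝ) : ℂ)) X hX
  obtain ⟨A', hA, hA1, hA2⟩ := aux_scalar ((i : ℤ) - j) p x hx r z hr hz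
  obtain ⟨B', hB, hB1, hB2⟩ := aux_scalar ((i : ℤ) - j - 1) q x hx r z hr hz
  obtain ⟨P', hP, hP1, hP2⟩ := aux_comp LinearMap.id c hfin x
  choose Q' hQ hQ1 hQ2 using fun b : Fin n =>
    aux_comp (E (Fin.castSucc b) ∘ₗ E (Fin.last n)) c hfin x
  have hco : ∀ b : Fin n, HasFDerivAt (fun y : Fin (n + 1) → ℝ => y (Fin.castSucc b))
      (ContinuousLinearMap.proj (R := ℝ) (φ := fun _ : Fin (n+1) => ℝ) (Fin.castSucc b)) x :=
    fun b => hasFDerivAt_apply (𝕜 := ℝ) (Fin.castSucc b) x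
  have hXd := HasFDerivAt.fun_sum (u := Finset.univ) (fun b _ => (hco b).smul (hQ b))
  have hTot := (hA.smul hP).add (hB.smul hXd)
  have hFd := hTot.congr_of_eventuallyEq (f₁ := F) (by
    filter_upwards [isOpen_ne.mem_nhds hx] with y hy
    rw [hF y hy]
    simp)
  simp only [LinearMap.comp_apply, LinearMap.id_coe, id_eq] at hP1 hQ1
  have hsing : ∀ b a : Fin n, (Pi.single (Fin.castSucc a) (1 : ℝ) : Fin (n + 1) → ℝ) (Fin.castSucc b)
      = if b = a then 1 else 0 := by
    intro b a
    simp [Pi.single_apply]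
  have hsing2 : ∀ b : Fin n, (Pi.single (Fin.last n) (1 : ℝ) : Fin (n + 1) → ℝ) (Fin.castSucc b)
      = 0 := by
    intro b
    simp [Fin.castSucc_ne_last]
  have hXv : ∀ v, X v = ∑ a : Fin n, x (Fin.castSucc a) • E (Fin.castSucc a) v := by
    intro v
    simp [hX]
  set e := E (Fin.last n) with he
  have hd1 : ∀ a : Fin n, fderiv ℝ F x (Pi.single (Fin.castSucc a) 1)
      = A' (Pi.single (Fin.castSucc a) 1) • φ
        + (((r ^ ((i : ℤ) - j) : ℝ) : ℂ) * p.eval (z : ℂ)) • φd a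
        + B' (Pi.single (Fin.castSucc a) 1) • X (e φ)
        + (((r ^ ((i : ℤ) - j - 1) : ℝ) : ℂ) * q.eval (z : ℂ)) •
          (E (Fin.castSucc a) (e φ) + X (e (φd a))) := by
    intro a
    rw [hFd.fderiv]
    simp [hP1, hQ1, hsing, Finset.sum_add_distrib, ← hXv, ← hφ, ← hr, ← hz, hφd]
    module
  have hd2 : fderiv ℝ F x (Pi.single (Fin.last n) 1)
      = A' (Pi.single (Fin.last n) 1) • φ + B' (Pi.single (Fin.last n) 1) • X (e φ) := by
    rw [hFd.fderiv]
    simp [hP2, hQ2, ← hXv, ← hφ]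
  have hXc : ∀ v, ∑ a : Fin n, ((x (Fin.castSucc a) : ℝ) : ℂ) • E (Fin.castSucc a) v = X v := by
    intro v
    simp [hX]
  have t1 : ∑ a : Fin n, E (Fin.castSucc a) (E (Fin.castSucc a) (e φ)) = -((n : ℂ) • e φ) := by
    simp [a1, Nat.cast_smul_eq_nsmul]
  have t2 : ∑ a : Fin n, E (Fin.castSucc a) (X (e (φd a))) = -((2 * j : ℂ) • e φ) := by
    have h1 : ∀ a : Fin n, E (Fin.castSucc a) (X (e (φd a)))
        = X (e (E (Fin.castSucc a) (φd a))) - (2 : ℂ) • e (((x (Fin.castSucc a) : ℝ) : ℂ) • φd a) := by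
      intro a
      have h2 : E (Fin.castSucc a) (e (φd a)) = - e (E (Fin.castSucc a) (φd a)) := by
        have := congrArg (fun f : S →ₗ[ℂ] S => f (φd a)) (hCl (Fin.castSucc a) (Fin.last n))
        rw [if_neg (Fin.castSucc_lt_last a).ne] at this
        exact eq_neg_of_add_eq_zero_left this
      rw [a3, h2, map_neg, neg_neg, map_smul, smul_smul]
    simp only [h1]
    rw [Finset.sum_sub_distrib, ← map_sum, ← map_sum, hmon, ← Finset.smul_sum, ← map_sum, heul]
    simp [smul_smul]
  have t3 : e (X (e φ)) = X φ := by
    rw [a2, a1, map_neg, neg_neg]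
  have t4 : X (X (e φ)) = -(((r : ℂ) ^ 2 * (1 - z ^ 2)) • e φ) := by
    rw [a4, hsq]
  have t5 : ∀ cA A cB B : ℂ, ∑ a : Fin n, E (Fin.castSucc a)
      ((((x (Fin.castSucc a) : ℝ) : ℂ) * cA) • φ + A • φd a
        + (((x (Fin.castSucc a) : ℝ) : ℂ) * cB) • X (e φ)
        + B • (E (Fin.castSucc a) (e φ) + X (e (φd a))))
      = cA • X φ - (cB * ((r : ℂ) ^ 2 * (1 - z ^ 2)) + B * (n + 2 * j)) • e φ := by
    intro cA A cB B
    have h1 : ∀ a : Fin n, E (Fin.castSucc a)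
      ((((x (Fin.castSucc a) : ℝ) : ℂ) * cA) • φ + A • φd a
        + (((x (Fin.castSucc a) : ℝ) : ℂ) * cB) • X (e φ)
        + B • (E (Fin.castSucc a) (e φ) + X (e (φd a))))
      = cA • (((x (Fin.castSucc a) : ℝ) : ℂ) • E (Fin.castSucc a) φ)
        + A • E (Fin.castSucc a) (φd a)
        + cB • (((x (Fin.castSucc a) : ℝ) : ℂ) • E (Fin.castSucc a) (X (e φ)))
        + B • (E (Fin.castSucc a) (E (Fin.castSucc a) (e φ)) + E (Fin.castSucc a) (X (e (φd a)))) := by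
      intro a
      simp only [map_add, map_smul]
      module
    simp only [h1]
    simp only [Finset.sum_add_distrib, ← Finset.smul_sum]
    rw [hXc, hXc, hmon, t1, t2, t4]
    module
  rw [Fin.sum_univ_castSucc, hd2]
  simp only [hd1, hA1, hB1, hA2, hB2, t5]
  rw [← he, map_add, map_smul, map_smul, t3]
  have e1 : (r : ℂ) ^ ((i : ℤ) - j - 1) = (r : ℂ) ^ ((i : ℤ) - j - 1 - 2) * r * r := by
    rw [← zpow_add_one₀ hrC, ← zpow_add_one₀ hrC]; congr 1; ring
  have e2 : (r : ℂ) ^ ((i : ℤ) - j - 2) = (r : ℂ) ^ ((i : ℤ) - j - 1 - 2) * r := by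
    rw [← zpow_add_one₀ hrC]; congr 1; ring
  have e3 : (r : ℂ) ^ ((i : ℤ) - j - 1 - 1) = (r : ℂ) ^ ((i : ℤ) - j - 1 - 2) * r := by
    rw [← zpow_add_one₀ hrC]; congr 1; ring
  push_cast
  rw [e1, e2, e3]
  match_scalars <;> ring
end

section
/- Let n be a positive even integer and λ, ν ∈ ℂ with (λ,ν) ∉ L̂. Then for each sign ε ∈ {+1,−1} the complex vector space V^ε(λ,ν) is one-dimensional. -/
/-- Extension of `s : ℕ×ℕ → ℂ` to integer indices, with the convention that `s(i,j) = 0`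
whenever `i < 0`, `j < 0` or `j > i`. -/
noncomputable def extS (s : ℕ × ℕ → ℂ) : ℤ → ℤ → ℂ :=
  fun i j => if 0 ≤ i ∧ 0 ≤ j ∧ j ≤ i then s (i.toNat, j.toNat) else 0

lemma extS_add (a b : ℕ × ℕ → ℂ) (i j : ℤ) :
    extS (a + b) i j = extS a i j + extS b i j := by
  unfold extS; split <;> simp

lemma extS_smul (r : ℂ) (a : ℕ × ℕ → ℂ) (i j : ℤ) :
    extS (r • a) i j = r * extS a i j := by
  unfold extS; split <;> simp

/-- The space `V^ε(λ,ν)` of functions `s : ℕ×ℕ → ℂ`, vanishing for `j > i`, satisfying the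
three relations (R1), (R2), (R3) for all integers `i ≥ j ≥ 0` (with the convention that
`s(i,j) = 0` whenever `i < 0`, `j < 0` or `j > i`).  Here `ρ = n/2` and `ρ_H = (n−1)/2`. -/
noncomputable def Vsp (n : ℕ) (eps lam nu : ℂ) : Submodule ℂ (ℕ × ℕ → ℂ) where
  carrier := {s | (∀ p : ℕ × ℕ, p.1 < p.2 → s p = 0)
    ∧ (∀ i j : ℕ, j ≤ i →
        ((n : ℂ) + 2 * i - 1) * ((n : ℂ) + 2 * i + 1)
            * (nu + ((n : ℂ) - 1) / 2 + 1 / 2 + j) * s (i, j)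
          = ((n : ℂ) + 2 * i - 1) * ((n : ℂ) + 2 * j - 1)
              * (lam + (n : ℂ) / 2 + 1 / 2 + i) * extS s ((i : ℤ) + 1) ((j : ℤ) + 1)
            + eps * (-1 : ℂ) ^ (i - j + 1) * 2 * ((n : ℂ) + 2 * j - 1)
              * Complex.I * lam * extS s (i : ℤ) ((j : ℤ) + 1)
            - ((n : ℂ) + 2 * i + 1) * ((n : ℂ) + 2 * j - 1)
              * (lam - (n : ℂ) / 2 + 1 / 2 - i) * extS s ((i : ℤ) - 1) ((j : ℤ) + 1))
    ∧ (∀ i j : ℕ, j ≤ i →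
        (((n : ℂ) + 2 * i - 1) * ((n : ℂ) + 2 * i + 1) * nu
            - eps * (-1 : ℂ) ^ (i - j) * ((n : ℂ) + 2 * i) * ((n : ℂ) + 2 * j - 1) * lam)
            * s (i, j)
          = -(((i : ℂ) - j + 1)) * ((n : ℂ) + 2 * i - 1) * Complex.I
              * (lam + (n : ℂ) / 2 + 1 / 2 + i) * extS s ((i : ℤ) + 1) (j : ℤ)
            + ((n : ℂ) + 2 * i + 1) * ((n : ℂ) + i + j - 1) * Complex.I
              * (lam - (n : ℂ) / 2 + 1 / 2 - i) * extS s ((i : ℤ) - 1) (j : ℤ))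
    ∧ (∀ i j : ℕ, 1 ≤ j → j ≤ i →
        ((n : ℂ) + 2 * i - 1) * ((n : ℂ) + 2 * i + 1) * ((n : ℂ) + 2 * j - 3)
            * (nu - ((n : ℂ) - 1) / 2 + 1 / 2 - j) * s (i, j)
          = -(((i : ℂ) - j + 1)) * (((i : ℂ) - j + 2)) * ((n : ℂ) + 2 * i - 1)
              * (lam + (n : ℂ) / 2 + 1 / 2 + i) * extS s ((i : ℤ) + 1) ((j : ℤ) - 1)
            + eps * (-1 : ℂ) ^ (i - j + 1) * 2 * (((i : ℂ) - j + 1)) * ((n : ℂ) + i + j - 1)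
              * Complex.I * lam * extS s (i : ℤ) ((j : ℤ) - 1)
            + ((n : ℂ) + 2 * i + 1) * ((n : ℂ) + i + j - 2) * ((n : ℂ) + i + j - 1)
              * (lam - (n : ℂ) / 2 + 1 / 2 - i) * extS s ((i : ℤ) - 1) ((j : ℤ) - 1))}
  add_mem' := by
    rintro a b ⟨ha0, ha1, ha2, ha3⟩ ⟨hb0, hb1, hb2, hb3⟩
    refine ⟨fun p hp => by simp [Pi.add_apply, ha0 p hp, hb0 p hp], ?_, ?_, ?_⟩
    · intro i j hij
      simp only [Pi.add_apply, extS_add]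
      linear_combination ha1 i j hij + hb1 i j hij
    · intro i j hij
      simp only [Pi.add_apply, extS_add]
      linear_combination ha2 i j hij + hb2 i j hij
    · intro i j h1 hij
      simp only [Pi.add_apply, extS_add]
      linear_combination ha3 i j h1 hij + hb3 i j h1 hij
  zero_mem' := by
    refine ⟨fun p _ => rfl, ?_, ?_, ?_⟩ <;>
      · intro i j
        intros
        simp [extS]
  smul_mem' := by
    rintro r a ⟨ha0, ha1, ha2, ha3⟩
    refine ⟨fun p hp => by simp [Pi.smul_apply, ha0 p hp], ?_, ?_, ?_⟩
    · intro i j hij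
      simp only [Pi.smul_apply, smul_eq_mul, extS_smul]
      linear_combination r * ha1 i j hij
    · intro i j hij
      simp only [Pi.smul_apply, smul_eq_mul, extS_smul]
      linear_combination r * ha2 i j hij
    · intro i j h1 hij
      simp only [Pi.smul_apply, smul_eq_mul, extS_smul]
      linear_combination r * ha3 i j h1 hij

/-- The set `L̂ = {(λ,ν) : λ = -ρ-1/2-k, ν = -ρ_H-1/2-ℓ, k ≥ ℓ ≥ 0}`, where `ρ = n/2` and
`ρ_H = (n-1)/2`. -/
def Lhat (n : ℕ) : Set (ℂ × ℂ) :=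
  {p | ∃ k l : ℕ, l ≤ k ∧ p.1 = -((n : ℂ) / 2) - 1 / 2 - k ∧
    p.2 = -(((n : ℂ) - 1) / 2) - 1 / 2 - l}

set_option linter.unusedSimpArgs false
open Complex

/-- The sign `(-1)^(i-j)`. -/
noncomputable def sgz (i j : ℤ) : ℂ := ((-1 : ℂ)) ^ (i - j)

noncomputable def Tp (n _e l : ℂ) (j i : ℤ) : ℂ :=
  - (i - j + 1) * I * (l + n / 2 + 1 / 2 + i) / (n + 2 * i + 1)
noncomputable def Tq (n e l : ℂ) (j i : ℤ) : ℂ :=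
  e * sgz i j * (n + 2 * i) * (n + 2 * j - 1) * l / ((n + 2 * i - 1) * (n + 2 * i + 1))
noncomputable def Tr (n _e l : ℂ) (j i : ℤ) : ℂ :=
  (n + i + j - 1) * I * (l - n / 2 + 1 / 2 - i) / (n + 2 * i - 1)

noncomputable def Kp (n _e l : ℂ) (j i : ℤ) : ℂ :=
  (n + 2 * j - 1) * (l + n / 2 + 1 / 2 + i) / (n + 2 * i + 1)
noncomputable def Kq (n e l : ℂ) (j i : ℤ) : ℂ :=
  - (n + 2 * j - 1) * (e * sgz i j) * 2 * I * l / ((n + 2 * i - 1) * (n + 2 * i + 1))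
noncomputable def Kr (n _e l : ℂ) (j i : ℤ) : ℂ :=
  - (n + 2 * j - 1) * (l - n / 2 + 1 / 2 - i) / (n + 2 * i - 1)

noncomputable def Lp (n _e l : ℂ) (j i : ℤ) : ℂ :=
  - (i - j + 1) * (i - j + 2) * (l + n / 2 + 1 / 2 + i) / (n + 2 * i + 1)
noncomputable def Lq (n e l : ℂ) (j i : ℤ) : ℂ :=
  - (e * sgz i j) * 2 * (i - j + 1) * (n + i + j - 1) * I * l
    / ((n + 2 * i - 1) * (n + 2 * i + 1))
noncomputable def Lr (n _e l : ℂ) (j i : ℤ) : ℂ :=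
  (n + i + j - 2) * (n + i + j - 1) * (l - n / 2 + 1 / 2 - i) / (n + 2 * i - 1)

/-- Tridiagonal operator of (R2). -/
noncomputable def Tz (n e l : ℂ) (j : ℤ) (f : ℤ → ℂ) (i : ℤ) : ℂ :=
  Tp n e l j i * f (i + 1) + Tq n e l j i * f i + Tr n e l j i * f (i - 1)
/-- Tridiagonal operator of (R1). -/
noncomputable def Kz (n e l : ℂ) (j : ℤ) (f : ℤ → ℂ) (i : ℤ) : ℂ :=
  Kp n e l j i * f (i + 1) + Kq n e l j i * f i + Kr n e l j i * f (i - 1)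
/-- Tridiagonal operator of (R3). -/
noncomputable def Lz (n e l : ℂ) (j : ℤ) (f : ℤ → ℂ) (i : ℤ) : ℂ :=
  Lp n e l j i * f (i + 1) + Lq n e l j i * f i + Lr n e l j i * f (i - 1)

lemma sgz_cases (i j : ℤ) : sgz i j = 1 ∨ sgz i j = -1 := by
  unfold sgz
  rcases Int.even_or_odd (i - j) with h | h
  · left; exact h.neg_one_zpow
  · right; exact h.neg_one_zpow

lemma sgz_i1 (i j : ℤ) : sgz (i + 1) j = - sgz i j := by
  unfold sgz
  rw [show i + 1 - j = (i - j) + 1 by ring, zpow_add_one₀ (by norm_num)]; ring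
lemma sgz_i2 (i j : ℤ) : sgz (i - 1) j = - sgz i j := by
  have := sgz_i1 (i - 1) j
  rw [sub_add_cancel] at this; rw [this]; ring
lemma sgz_j1 (i j : ℤ) : sgz i (j + 1) = - sgz i j := by
  rw [← sgz_i2]; unfold sgz; congr 1; ring
lemma sgz_j2 (i j : ℤ) : sgz i (j - 1) = - sgz i j := by
  rw [← sgz_i1]; unfold sgz; congr 1; ring


set_option maxHeartbeats 2000000 in
lemma TK_coef (n e l : ℂ) (he : e = 1 ∨ e = -1) (hA : ∀ i : ℤ, n + 2 * i - 1 ≠ 0) (i j : ℤ) :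
    (Tp n e l j i * Kp n e l j (i + 1)
      = Kp n e l j i * Tp n e l (j + 1) (i + 1))
    ∧ (Tp n e l j i * Kq n e l j (i + 1) + Tq n e l j i * Kp n e l j i
      = Kp n e l j i * Tq n e l (j + 1) (i + 1) + Kq n e l j i * Tp n e l (j + 1) i)
    ∧ (Tp n e l j i * Kr n e l j (i + 1) + Tq n e l j i * Kq n e l j i + Tr n e l j i * Kp n e l j (i - 1)
      = Kp n e l j i * Tr n e l (j + 1) (i + 1) + Kq n e l j i * Tq n e l (j + 1) i + Kr n e l j i * Tp n e l (j + 1) (i - 1))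
    ∧ (Tq n e l j i * Kr n e l j i + Tr n e l j i * Kq n e l j (i - 1)
      = Kq n e l j i * Tr n e l (j + 1) i + Kr n e l j i * Tq n e l (j + 1) (i - 1))
    ∧ (Tr n e l j i * Kr n e l j (i - 1)
      = Kr n e l j i * Tr n e l (j + 1) (i - 1)) := by
  have h1 := hA i
  have h2 := hA (i + 1)
  have h3 := hA (i - 1)
  have h4 := hA (i + 2)
  have k : e * sgz i j = 1 ∨ e * sgz i j = -1 := by
    rcases sgz_cases i j with h | h <;> rcases he with h' | h' <;> rw [h, h'] <;> norm_num
  obtain ⟨z, hz⟩ : ∃ z, n = z - 2 * i := ⟨n + 2 * i, by ring⟩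
  subst hz
  have h1' : z - 1 ≠ 0 := by convert h1 using 1; ring
  have h2' : z + 1 ≠ 0 := by convert h2 using 1; push_cast; ring
  have h3' : z - 3 ≠ 0 := by convert h3 using 1; push_cast; ring
  have h4' : z + 3 ≠ 0 := by convert h4 using 1; push_cast; ring
  simp only [Tp, Tq, Tr, Kp, Kq, Kr, Lp, Lq, Lr, sgz_i1, sgz_i2, sgz_j1, sgz_j2,
    add_sub_cancel_right, sub_add_cancel, mul_neg, neg_neg]
  generalize e * sgz i j = w at *
  clear h1 h2 h3 h4 hA
  push_cast
  generalize (i:ℂ) = x at *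
  generalize (j:ℂ) = y at *
  simp only [show z - 2 * x + 2 * x - 1 = z - 1 by ring, show z - 2 * x + 2 * x + 1 = z + 1 by ring,
    show z - 2 * x + 2 * (x + 1) - 1 = z + 1 by ring,
    show z - 2 * x + 2 * (x + 1) + 1 = z + 3 by ring,
    show z - 2 * x + 2 * (x - 1) - 1 = z - 3 by ring,
    show z - 2 * x + 2 * (x - 1) + 1 = z - 1 by ring]
  refine ⟨?_, ?_, ?_, ?_, ?_⟩ <;> rcases k with rfl | rfl <;>
  · field_simp
    try simp only [I_sq]
    ring

lemma TK (n e l : ℂ) (he : e = 1 ∨ e = -1) (hA : ∀ i : ℤ, n + 2 * i - 1 ≠ 0) (i j : ℤ) (f : ℤ → ℂ) :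
    Tz n e l j (Kz n e l j f) i = Kz n e l j (Tz n e l (j + 1) f) i := by
  obtain ⟨h2, h1, h0, h3, h4⟩ := TK_coef n e l he hA i j
  simp only [Tz, Kz, Lz, add_sub_cancel_right, sub_add_cancel]
  linear_combination f (i + 1 + 1) * h2 + f (i + 1) * h1 + f i * h0 + f (i - 1) * h3
    + f (i - 1 - 1) * h4

set_option maxHeartbeats 2000000 in
lemma TL_coef (n e l : ℂ) (he : e = 1 ∨ e = -1) (hA : ∀ i : ℤ, n + 2 * i - 1 ≠ 0) (i j : ℤ) :
    (Tp n e l j i * Lp n e l j (i + 1)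
      = Lp n e l j i * Tp n e l (j - 1) (i + 1))
    ∧ (Tp n e l j i * Lq n e l j (i + 1) + Tq n e l j i * Lp n e l j i
      = Lp n e l j i * Tq n e l (j - 1) (i + 1) + Lq n e l j i * Tp n e l (j - 1) i)
    ∧ (Tp n e l j i * Lr n e l j (i + 1) + Tq n e l j i * Lq n e l j i + Tr n e l j i * Lp n e l j (i - 1)
      = Lp n e l j i * Tr n e l (j - 1) (i + 1) + Lq n e l j i * Tq n e l (j - 1) i + Lr n e l j i * Tp n e l (j - 1) (i - 1))
    ∧ (Tq n e l j i * Lr n e l j i + Tr n e l j i * Lq n e l j (i - 1)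
      = Lq n e l j i * Tr n e l (j - 1) i + Lr n e l j i * Tq n e l (j - 1) (i - 1))
    ∧ (Tr n e l j i * Lr n e l j (i - 1)
      = Lr n e l j i * Tr n e l (j - 1) (i - 1)) := by
  have h1 := hA i
  have h2 := hA (i + 1)
  have h3 := hA (i - 1)
  have h4 := hA (i + 2)
  have k : e * sgz i j = 1 ∨ e * sgz i j = -1 := by
    rcases sgz_cases i j with h | h <;> rcases he with h' | h' <;> rw [h, h'] <;> norm_num
  obtain ⟨z, hz⟩ : ∃ z, n = z - 2 * i := ⟨n + 2 * i, by ring⟩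
  subst hz
  have h1' : z - 1 ≠ 0 := by convert h1 using 1; ring
  have h2' : z + 1 ≠ 0 := by convert h2 using 1; push_cast; ring
  have h3' : z - 3 ≠ 0 := by convert h3 using 1; push_cast; ring
  have h4' : z + 3 ≠ 0 := by convert h4 using 1; push_cast; ring
  simp only [Tp, Tq, Tr, Kp, Kq, Kr, Lp, Lq, Lr, sgz_i1, sgz_i2, sgz_j1, sgz_j2,
    add_sub_cancel_right, sub_add_cancel, mul_neg, neg_neg]
  generalize e * sgz i j = w at *
  clear h1 h2 h3 h4 hA
  push_cast
  generalize (i:ℂ) = x at *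
  generalize (j:ℂ) = y at *
  simp only [show z - 2 * x + 2 * x - 1 = z - 1 by ring, show z - 2 * x + 2 * x + 1 = z + 1 by ring,
    show z - 2 * x + 2 * (x + 1) - 1 = z + 1 by ring,
    show z - 2 * x + 2 * (x + 1) + 1 = z + 3 by ring,
    show z - 2 * x + 2 * (x - 1) - 1 = z - 3 by ring,
    show z - 2 * x + 2 * (x - 1) + 1 = z - 1 by ring]
  refine ⟨?_, ?_, ?_, ?_, ?_⟩ <;> rcases k with rfl | rfl <;>
  · field_simp
    try simp only [I_sq]
    ring

lemma TL (n e l : ℂ) (he : e = 1 ∨ e = -1) (hA : ∀ i : ℤ, n + 2 * i - 1 ≠ 0) (i j : ℤ) (f : ℤ → ℂ) :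
    Tz n e l j (Lz n e l j f) i = Lz n e l j (Tz n e l (j - 1) f) i := by
  obtain ⟨h2, h1, h0, h3, h4⟩ := TL_coef n e l he hA i j
  simp only [Tz, Kz, Lz, add_sub_cancel_right, sub_add_cancel]
  linear_combination f (i + 1 + 1) * h2 + f (i + 1) * h1 + f i * h0 + f (i - 1) * h3
    + f (i - 1 - 1) * h4

set_option maxHeartbeats 2000000 in
lemma LK_coef (n e l : ℂ) (he : e = 1 ∨ e = -1) (hA : ∀ i : ℤ, n + 2 * i - 1 ≠ 0) (i j : ℤ) :
    (Lp n e l j i * Kp n e l (j - 1) (i + 1)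
      = (n + 2 * j - 3) * (Tp n e l j i * Tp n e l j (i + 1)))
    ∧ (Lp n e l j i * Kq n e l (j - 1) (i + 1) + Lq n e l j i * Kp n e l (j - 1) i
      = (n + 2 * j - 3) * (Tp n e l j i * Tq n e l j (i + 1) + Tq n e l j i * Tp n e l j i))
    ∧ (Lp n e l j i * Kr n e l (j - 1) (i + 1) + Lq n e l j i * Kq n e l (j - 1) i + Lr n e l j i * Kp n e l (j - 1) (i - 1)
      = (n + 2 * j - 3) * (Tp n e l j i * Tr n e l j (i + 1) + Tq n e l j i * Tq n e l j i + Tr n e l j i * Tp n e l j (i - 1) - (n / 2 + j - 1) ^ 2))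
    ∧ (Lq n e l j i * Kr n e l (j - 1) i + Lr n e l j i * Kq n e l (j - 1) (i - 1)
      = (n + 2 * j - 3) * (Tq n e l j i * Tr n e l j i + Tr n e l j i * Tq n e l j (i - 1)))
    ∧ (Lr n e l j i * Kr n e l (j - 1) (i - 1)
      = (n + 2 * j - 3) * (Tr n e l j i * Tr n e l j (i - 1))) := by
  have h1 := hA i
  have h2 := hA (i + 1)
  have h3 := hA (i - 1)
  have h4 := hA (i + 2)
  have k : e * sgz i j = 1 ∨ e * sgz i j = -1 := by
    rcases sgz_cases i j with h | h <;> rcases he with h' | h' <;> rw [h, h'] <;> norm_num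
  obtain ⟨z, hz⟩ : ∃ z, n = z - 2 * i := ⟨n + 2 * i, by ring⟩
  subst hz
  have h1' : z - 1 ≠ 0 := by convert h1 using 1; ring
  have h2' : z + 1 ≠ 0 := by convert h2 using 1; push_cast; ring
  have h3' : z - 3 ≠ 0 := by convert h3 using 1; push_cast; ring
  have h4' : z + 3 ≠ 0 := by convert h4 using 1; push_cast; ring
  simp only [Tp, Tq, Tr, Kp, Kq, Kr, Lp, Lq, Lr, sgz_i1, sgz_i2, sgz_j1, sgz_j2,
    add_sub_cancel_right, sub_add_cancel, mul_neg, neg_neg]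
  generalize e * sgz i j = w at *
  clear h1 h2 h3 h4 hA
  push_cast
  generalize (i:ℂ) = x at *
  generalize (j:ℂ) = y at *
  simp only [show z - 2 * x + 2 * x - 1 = z - 1 by ring, show z - 2 * x + 2 * x + 1 = z + 1 by ring,
    show z - 2 * x + 2 * (x + 1) - 1 = z + 1 by ring,
    show z - 2 * x + 2 * (x + 1) + 1 = z + 3 by ring,
    show z - 2 * x + 2 * (x - 1) - 1 = z - 3 by ring,
    show z - 2 * x + 2 * (x - 1) + 1 = z - 1 by ring]
  refine ⟨?_, ?_, ?_, ?_, ?_⟩ <;> rcases k with rfl | rfl <;>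
  · field_simp
    try simp only [I_sq]
    ring

lemma LK (n e l : ℂ) (he : e = 1 ∨ e = -1) (hA : ∀ i : ℤ, n + 2 * i - 1 ≠ 0) (i j : ℤ) (f : ℤ → ℂ) :
    Lz n e l j (Kz n e l (j - 1) f) i
      = (n + 2 * j - 3) * (Tz n e l j (Tz n e l j f) i - (n / 2 + j - 1) ^ 2 * f i) := by
  obtain ⟨h2, h1, h0, h3, h4⟩ := LK_coef n e l he hA i j
  simp only [Tz, Kz, Lz, add_sub_cancel_right, sub_add_cancel]
  linear_combination f (i + 1 + 1) * h2 + f (i + 1) * h1 + f i * h0 + f (i - 1) * h3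
    + f (i - 1 - 1) * h4

lemma Tp_ne (n e l : ℂ) (hA : ∀ i : ℤ, n + 2 * i - 1 ≠ 0) (j i : ℤ) (hij : j ≤ i)
    (ha : l + n / 2 + 1 / 2 + i ≠ 0) : Tp n e l j i ≠ 0 := by
  have h1 : n + 2 * i + 1 ≠ 0 := by convert hA (i + 1) using 1; push_cast; ring
  have h2 : ((i : ℂ) - j + 1) ≠ 0 := by
    have : i - j + 1 ≠ 0 := by omega
    exact_mod_cast this
  unfold Tp
  exact div_ne_zero (mul_ne_zero (mul_ne_zero (neg_ne_zero.mpr h2) I_ne_zero) ha) h1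

/-- A row killed by `T - ν` is determined by its first entry. -/
lemma row_unique (n e l nu : ℂ) (hA : ∀ i : ℤ, n + 2 * i - 1 ≠ 0) (j μ : ℤ) (hj : j ≤ μ)
    (ha : ∀ i : ℤ, μ ≤ i → l + n / 2 + 1 / 2 + i ≠ 0) (g : ℤ → ℂ)
    (hT : ∀ i : ℤ, μ ≤ i → Tz n e l j g i = nu * g i) (h0 : ∀ i : ℤ, i ≤ μ → g i = 0) (i : ℤ) :
    g i = 0 := by
  have key : ∀ k : ℕ, ∀ i : ℤ, i ≤ μ + k → g i = 0 := by
    intro k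
    induction k with
    | zero => intro i hi; exact h0 i (by simpa using hi)
    | succ k ih =>
      intro i hi
      by_cases h : i ≤ μ + k
      · exact ih i h
      have hi' : i = μ + k + 1 := by push_cast at hi; omega
      have h1 := hT (μ + k) (by omega)
      rw [Tz, ih (μ + k) le_rfl, ih (μ + k - 1) (by omega), ← hi'] at h1
      have hp : Tp n e l j (μ + k) ≠ 0 := Tp_ne n e l hA j _ (by omega) (ha _ (by omega))
      have h2 : Tp n e l j (μ + k) * g i = 0 := by linear_combination h1
      exact (mul_eq_zero.mp h2).resolve_left hp
  exact key (i - μ).toNat i (by omega)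

/-- Existence of a row with first entry one. -/
lemma row_exists (n e l nu : ℂ) (hA : ∀ i : ℤ, n + 2 * i - 1 ≠ 0) (j μ : ℤ) (hj : j ≤ μ)
    (ha : ∀ i : ℤ, μ ≤ i → l + n / 2 + 1 / 2 + i ≠ 0) (hz : Tp n e l j (μ - 1) = 0) :
    ∃ g : ℤ → ℂ, (∀ i, i < μ → g i = 0) ∧ g μ = 1 ∧ ∀ i, Tz n e l j g i = nu * g i := by
  let h : ℕ → ℂ × ℂ := fun k => Nat.rec (motive := fun _ => ℂ × ℂ) (0, 1)
    (fun k p => (p.2, ((nu - Tq n e l j (μ + k)) * p.2 - Tr n e l j (μ + k) * p.1)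
      / Tp n e l j (μ + k))) k
  have h0 : h 0 = (0, 1) := rfl
  have hs : ∀ k : ℕ, h (k + 1) = ((h k).2, ((nu - Tq n e l j (μ + k)) * (h k).2
      - Tr n e l j (μ + k) * (h k).1) / Tp n e l j (μ + k)) := fun k => rfl
  let g : ℤ → ℂ := fun i => if i < μ then 0 else (h (i - μ).toNat).2
  have g1 : ∀ i, i < μ → g i = 0 := fun i hi => by simp only [g]; rw [if_pos hi]
  have g2 : ∀ k : ℕ, g (μ + k) = (h k).2 := fun k => by
    simp only [g]; rw [if_neg (by omega)]; congr 3; omega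
  have g3 : ∀ k : ℕ, g (μ + k - 1) = (h k).1 := fun k => by
    cases k with
    | zero => rw [h0, g1 _ (by push_cast; omega)]
    | succ k =>
      rw [hs, ← g2]; congr 1; push_cast; ring
  refine ⟨g, g1, ?_, ?_⟩
  · have := g2 0
    rw [h0] at this; simpa using this
  · intro i
    by_cases h1 : i < μ - 1
    · rw [Tz, g1 _ (by omega), g1 i (by omega), g1 (i - 1) (by omega)]; ring
    by_cases h2 : i = μ - 1
    · rw [Tz, h2, hz, g1 (μ - 1) (by omega), g1 (μ - 1 - 1) (by omega)]; ring
    obtain ⟨k, rfl⟩ : ∃ k : ℕ, i = μ + k := ⟨(i - μ).toNat, by omega⟩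
    have h4 : g (μ + k + 1) = (h (k + 1)).2 := by
      have := g2 (k + 1)
      push_cast at this
      rw [← add_assoc] at this; exact this
    rw [Tz, h4, hs, g2, g3]
    have hp : Tp n e l j (μ + k) ≠ 0 := Tp_ne n e l hA j _ (by omega) (ha _ (by omega))
    simp only
    rw [mul_div_cancel₀ _ hp]; ring

/-- A scalar sequence with forward recursion above `m` and backward recursion below `m`. -/
lemma seq_exists (m : ℕ) (p q : ℕ → ℂ) : ∃ x : ℕ → ℂ, x m = 1 ∧ (∀ j, m ≤ j → x (j + 1) = p j * x j)
    ∧ ∀ j, j < m → x j = q j * x (j + 1) := by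
  refine ⟨fun j => (∏ t ∈ Finset.Ico m j, p t) * ∏ t ∈ Finset.Ico j m, q t, by simp, ?_, ?_⟩
  · intro j hj
    simp only
    rw [Finset.prod_Ico_succ_top hj, Finset.Ico_eq_empty_of_le hj,
      Finset.Ico_eq_empty_of_le (show m ≤ j + 1 by omega)]
    simp [mul_comm]
  · intro j hj
    simp only
    rw [Finset.prod_eq_prod_Ico_succ_bot hj, Finset.Ico_eq_empty_of_le hj.le,
      Finset.Ico_eq_empty_of_le (show j + 1 ≤ m by omega)]
    simp

/-- Base case of (R3) on the diagonal, when `ν = -n/2-j`. -/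
lemma base_alg (z e l E0 E1 E2 : ℂ) (he : e = 1 ∨ e = -1) (h1 : z - 1 ≠ 0) (h2 : z + 1 ≠ 0)
    (h3 : z + 3 ≠ 0) (ha : l + z / 2 + 1 / 2 ≠ 0)
    (r1 : -I * (l + z / 2 + 1 / 2) / (z + 1) * E1
      + e * z * (z - 1) * l / ((z - 1) * (z + 1)) * E0 = -z / 2 * E0)
    (r2 : -2 * I * (l + z / 2 + 3 / 2) / (z + 3) * E2
      - e * (z + 2) * (z - 1) * l / ((z + 1) * (z + 3)) * E1
      + z * I * (l - z / 2 - 1 / 2) / (z + 1) * E0 = -z / 2 * E1) :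
    -2 * (l + z / 2 + 3 / 2) / (z + 3) * E2
      - e * 2 * (z + 1) * I * l / ((z + 1) * (z + 3)) * E1
      + z * (z + 1) * (l - z / 2 - 1 / 2) / (z + 1) * E0 = 0 := by
  obtain ⟨F, rfl⟩ : ∃ F, E1 = I * F := ⟨-I * E1, by linear_combination E1 * I_sq⟩
  have r1' : (l + z / 2 + 1 / 2) / (z + 1) * F
      + e * z * (z - 1) * l / ((z - 1) * (z + 1)) * E0 = -z / 2 * E0 := by
    linear_combination r1 + (l + z / 2 + 1 / 2) / (z + 1) * F * I_sq
  have r2' : -2 * (l + z / 2 + 3 / 2) / (z + 3) * E2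
      - e * (z + 2) * (z - 1) * l / ((z + 1) * (z + 3)) * F
      + z * (l - z / 2 - 1 / 2) / (z + 1) * E0 = -z / 2 * F := by
    apply mul_left_cancel₀ I_ne_zero
    linear_combination r2
  have r3 : -2 * (l + z / 2 + 3 / 2) / (z + 3) * E2
      + e * 2 * (z + 1) * l / ((z + 1) * (z + 3)) * F
      + z * (z + 1) * (l - z / 2 - 1 / 2) / (z + 1) * E0 = 0 := by
    apply (mul_eq_zero.mp _).resolve_left ha
    have key : (l + z / 2 + 1 / 2) * (-2 * (l + z / 2 + 3 / 2) / (z + 3) * E2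
      + e * 2 * (z + 1) * l / ((z + 1) * (z + 3)) * F
      + z * (z + 1) * (l - z / 2 - 1 / 2) / (z + 1) * E0)
      = (l + z / 2 + 1 / 2) * ((-2 * (l + z / 2 + 3 / 2) / (z + 3) * E2
      - e * (z + 2) * (z - 1) * l / ((z + 1) * (z + 3)) * F
      + z * (l - z / 2 - 1 / 2) / (z + 1) * E0) - (-z / 2 * F))
      + z * (2 * e * l - (z + 1)) / 2 * (((l + z / 2 + 1 / 2) / (z + 1) * F
      + e * z * (z - 1) * l / ((z - 1) * (z + 1)) * E0) - (-z / 2 * E0)) := by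
      rcases he with rfl | rfl <;> (field_simp; ring)
    rw [key, r1', r2']; ring
  linear_combination r3 - e * 2 * (z + 1) * l / ((z + 1) * (z + 3)) * F * I_sq

lemma Tp_zero (n e l : ℂ) (m j : ℕ) (hm : m = 0 ∨ l + n / 2 + 1 / 2 + ((m : ℂ) - 1) = 0) :
    Tp n e l j (max (j : ℤ) m - 1) = 0 := by
  unfold Tp
  rcases le_total (m : ℤ) j with h | h
  · rw [max_eq_left h]; push_cast; ring
  · rw [max_eq_right h]
    rcases hm with h0 | h0
    · have : (m : ℤ) = j := by omega
      rw [this]; push_cast; ring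
    · push_cast; rw [h0]; simp

lemma Kp_zero (n e l : ℂ) (m : ℕ) (j : ℤ) (h0 : l + n / 2 + 1 / 2 + ((m : ℂ) - 1) = 0) :
    Kp n e l j (m - 1) = 0 := by
  unfold Kp; push_cast; rw [h0]; simp

lemma Lp_zero (n e l : ℂ) (m : ℕ) (j : ℤ) (h0 : l + n / 2 + 1 / 2 + ((m : ℂ) - 1) = 0) :
    Lp n e l j (m - 1) = 0 := by
  unfold Lp; push_cast; rw [h0]; simp

lemma Kp_ne (n e l : ℂ) (hA : ∀ i : ℤ, n + 2 * i - 1 ≠ 0) (j i : ℤ)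
    (ha : l + n / 2 + 1 / 2 + i ≠ 0) : Kp n e l j i ≠ 0 := by
  have h1 : n + 2 * i + 1 ≠ 0 := by convert hA (i + 1) using 1; push_cast; ring
  unfold Kp
  exact div_ne_zero (mul_ne_zero (hA j) ha) h1

/-- The operator of (R1) maps the row space below the support to zero. -/
lemma Kz_low (n e l : ℂ) (m j : ℕ) (hm : m = 0 ∨ l + n / 2 + 1 / 2 + ((m : ℂ) - 1) = 0)
    (f : ℤ → ℂ) (hf : ∀ i : ℤ, i < max ((j + 1 : ℕ) : ℤ) m → f i = 0) (i : ℤ)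
    (hi : i < max (j : ℤ) m) : Kz n e l j f i = 0 := by
  rw [Kz, hf i (by push_cast; omega), hf (i - 1) (by push_cast; omega)]
  by_cases h : i + 1 < max ((j + 1 : ℕ) : ℤ) m
  · rw [hf _ h]; ring
  · have h1 : i = m - 1 := by push_cast at h; omega
    have h2 : m ≠ 0 := by rintro rfl; push_cast at h; omega
    rw [h1, Kp_zero n e l m j (hm.resolve_left h2)]; ring

/-- The operator of (R3) maps the row space below the support to zero. -/
lemma Lz_low (n e l : ℂ) (m j : ℕ) (hm : m = 0 ∨ l + n / 2 + 1 / 2 + ((m : ℂ) - 1) = 0)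
    (f : ℤ → ℂ) (hf : ∀ i : ℤ, i < max (j : ℤ) m → f i = 0) (i : ℤ)
    (hi : i < max ((j + 1 : ℕ) : ℤ) m) : Lz n e l ((j : ℤ) + 1) f i = 0 := by
  push_cast at hi
  rw [Lz, hf (i - 1) (by omega)]
  by_cases h : i + 1 < max (j : ℤ) m
  · rw [hf _ h, hf i (by omega)]; ring
  by_cases hjm : j + 1 ≤ m
  · have h1 : i = m - 1 := by omega
    have h2 : m ≠ 0 := by omega
    rw [h1, Lp_zero n e l m _ (hm.resolve_left h2), hf (m - 1) (by omega)]; ring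
  · have h1 : i = j ∨ i = j - 1 := by omega
    rcases h1 with rfl | rfl
    · simp [Lp, Lq]
    · rw [hf (j - 1) (by omega)]
      have : Lp n e l ((j : ℤ) + 1) (j - 1) = 0 := by unfold Lp; push_cast; ring
      rw [this]; ring

lemma family (n e l nu : ℂ) (he : e = 1 ∨ e = -1) (hA : ∀ i : ℤ, n + 2 * i - 1 ≠ 0) (m : ℕ)
    (hm : m = 0 ∨ l + n / 2 + 1 / 2 + ((m : ℂ) - 1) = 0)
    (ha : ∀ i : ℤ, (m : ℤ) ≤ i → l + n / 2 + 1 / 2 + i ≠ 0)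
    (hc : ∀ j : ℕ, j < m → nu + n / 2 + j ≠ 0) :
    ∃ E : ℕ → ℤ → ℂ, (∀ (j : ℕ) (i : ℤ), i < max (j : ℤ) m → E j i = 0) ∧ E m m = 1
      ∧ (∀ (j : ℕ) (i : ℤ), Tz n e l j (E j) i = nu * E j i)
      ∧ (∀ (j : ℕ) (i : ℤ), (nu + n / 2 + j) * E j i = Kz n e l j (E (j + 1)) i)
      ∧ (∀ (j : ℕ) (i : ℤ), (n + 2 * (j + 1) - 3) * (nu - n / 2 + 1 - (j + 1)) * E (j + 1) i
          = Lz n e l ((j : ℤ) + 1) (E j) i) := by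
  have hrow : ∀ j : ℕ, ∃ g : ℤ → ℂ, (∀ i, i < max (j : ℤ) m → g i = 0) ∧ g (max (j : ℤ) m) = 1
      ∧ ∀ i, Tz n e l j g i = nu * g i := fun j =>
    row_exists n e l nu hA j (max (j : ℤ) m) (le_max_left _ _)
      (fun i hi => ha i (le_trans (le_max_right _ _) hi)) (Tp_zero n e l m j hm)
  choose φ φ0 φ1 φT using hrow
  obtain ⟨x, x0, x1, x2⟩ := seq_exists m (fun j => (nu + n / 2 + j) / Kp n e l j j)
    (fun j => Kz n e l j (φ (j + 1)) m / (nu + n / 2 + j))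
  obtain ⟨E, hE⟩ : ∃ E : ℕ → ℤ → ℂ, ∀ j i, E j i = x j * φ j i := ⟨fun j i => x j * φ j i, fun _ _ => rfl⟩
  have E0 : ∀ (j : ℕ) (i : ℤ), i < max (j : ℤ) m → E j i = 0 := fun j i h => by
    rw [hE, φ0 j i h, mul_zero]
  have ET : ∀ (j : ℕ) (i : ℤ), Tz n e l j (E j) i = nu * E j i := fun j i => by
    have := φT j i
    simp only [Tz, hE] at this ⊢
    linear_combination x j * this
  have ET' : ∀ (j : ℕ), Tz n e l j (E j) = fun i => nu * E j i := fun j => funext (ET j)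
  have EK : ∀ (j : ℕ) (i : ℤ), (nu + n / 2 + j) * E j i = Kz n e l j (E (j + 1)) i := by
    intro j i
    have hlow := Kz_low n e l m j hm (E (j + 1)) (E0 (j + 1))
    have := row_unique n e l nu hA j (max (j : ℤ) m) (le_max_left _ _)
      (fun i hi => ha i (le_trans (le_max_right _ _) hi))
      (fun i => (nu + n / 2 + j) * E j i - Kz n e l j (E (j + 1)) i) ?_ ?_ i
    · exact sub_eq_zero.mp this
    · intro i _
      have h1 := TK n e l he hA i j (E (j + 1))
      have h2 := ET' (j + 1)
      push_cast at h2
      rw [h2] at h1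
      have h3 := ET j i
      have h4 : Kz n e l j (fun i => nu * E (j + 1) i) i = nu * Kz n e l j (E (j + 1)) i := by
        simp only [Kz]; ring
      rw [h4] at h1
      generalize Kz n e l j (E (j + 1)) = k at *
      simp only [Tz] at *
      linear_combination (nu + n / 2 + j) * h3 - h1
    · intro i hi
      rcases hi.lt_or_eq with h | h
      · rw [E0 j i h, hlow i h]; ring
      · subst h
        rcases le_or_gt m j with h | h
        · rw [max_eq_left (by exact_mod_cast h : (m : ℤ) ≤ j), Kz, E0 (j + 1) j (by push_cast; omega),
            E0 (j + 1) (j - 1) (by push_cast; omega), hE, hE, x1 j h]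
          have a1 := φ1 j
          have a2 := φ1 (j + 1)
          rw [max_eq_left (by exact_mod_cast h : (m : ℤ) ≤ j)] at a1
          rw [max_eq_left (by push_cast; omega)] at a2
          push_cast at a2
          rw [a1, a2]
          have := Kp_ne n e l hA j j (ha j (by exact_mod_cast h))
          field_simp
          ring
        · rw [max_eq_right (by omega), hE, x2 j h]
          have a1 := φ1 j
          rw [max_eq_right (by omega)] at a1
          rw [a1]
          have := hc j h
          have h4 : Kz n e l j (E (j + 1)) m = x (j + 1) * Kz n e l j (φ (j + 1)) m := by
            simp only [Kz, hE]; ring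
          rw [h4]
          generalize nu + n / 2 + (j : ℂ) = c at this ⊢
          field_simp
          ring
  refine ⟨E, E0, ?_, ET, EK, ?_⟩
  · rw [hE, x0]
    have := φ1 m
    rw [max_self] at this; rw [this, one_mul]
  · intro j i
    by_cases hcj : nu + n / 2 + j = 0
    · have hjm : m ≤ j := by
        by_contra h
        exact hc j (by omega) hcj
      have hlow := Lz_low n e l m j hm (E j) (E0 j)
      have hrow0 : ∀ i, E (j + 1) i = 0 := by
        have hx : x (j + 1) = 0 := by rw [x1 j hjm, hcj]; simp
        intro i; rw [hE, hx, zero_mul]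
      rw [hrow0, mul_zero]
      symm
      refine row_unique n e l nu hA ((j : ℤ) + 1) ((j : ℤ) + 1) le_rfl
        (fun i hi => ha i (by omega)) _ ?_ ?_ i
      · intro i _
        have h1 := TL n e l he hA i ((j : ℤ) + 1) (E j)
        rw [add_sub_cancel_right, ET' j] at h1
        rw [h1]; simp only [Lz]; ring
      · intro i hi
        rcases hi.lt_or_eq with h | h
        · exact hlow i (by push_cast; omega)
        · subst h
          have r1 := ET j j
          have r2 := ET j (j + 1)
          have d1 := hA j
          have d2 := hA (j + 1)
          have d3 := hA (j + 2)
          have d4 := ha j (by exact_mod_cast hjm)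
          have s1 : sgz j j = 1 := by simp [sgz]
          rw [Tz, E0 j (j - 1) (by omega)] at r1
          rw [Tz, add_sub_cancel_right] at r2
          rw [Lz, add_sub_cancel_right]
          simp only [Tp, Tq, Tr, Lp, Lq, Lr, sgz_i1, sgz_j1, s1] at *
          generalize E j ((j : ℤ) + 1 + 1) = E2 at *
          generalize E j ((j : ℤ) + 1) = E1 at *
          generalize E j (j : ℤ) = F0 at *
          push_cast at *
          generalize (j : ℂ) = y at *
          obtain ⟨z, rfl⟩ : ∃ z, n = z - 2 * y := ⟨n + 2 * y, by ring⟩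
          have hnu : nu = - z / 2 := by linear_combination hcj
          subst hnu
          have := base_alg z e l F0 E1 E2 he (by convert d1 using 1; ring) (by convert d2 using 1; ring)
            (by convert d3 using 1; ring) (by convert d4 using 1; ring)
            (by convert r1 using 1; ring_nf) (by convert r2 using 1; ring_nf)
          convert this using 1
          ring_nf
    · apply mul_left_cancel₀ hcj
      have h1 := LK n e l he hA i ((j : ℤ) + 1) (E (j + 1))
      have h2 := ET' (j + 1)
      push_cast at h2
      have h3 := ET (j + 1) i
      push_cast at h3
      have h4 : Kz n e l j (E (j + 1)) = fun i => (nu + n / 2 + j) * E j i :=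
        funext fun i => (EK j i).symm
      rw [add_sub_cancel_right, h4, h2] at h1
      push_cast at h1
      generalize (j : ℤ) + 1 = J at *
      simp only [Lz, Tz] at *
      linear_combination (-1 : ℂ) * h1 - (n + 2 * (j + 1) - 3) * nu * h3

lemma sgz_nat (i j : ℕ) (h : j ≤ i) : sgz i j = (-1 : ℂ) ^ (i - j) := by
  unfold sgz
  rw [← Nat.cast_sub h, zpow_natCast]

lemma iff_of_diff (a b a' b' d : ℂ) (hd : d ≠ 0) (h : a - b = d * (a' - b')) : a = b ↔ a' = b' := by
  rw [← sub_eq_zero, h, mul_eq_zero, ← sub_eq_zero (a := a')]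
  simp [hd]

/-- Normalised form of the relations defining `Vsp`. -/
lemma mem_Vsp (N : ℕ) (e l nu : ℂ) (hA : ∀ i : ℤ, (N : ℂ) + 2 * i - 1 ≠ 0) (s : ℕ × ℕ → ℂ) :
    s ∈ Vsp N e l nu ↔ (∀ p : ℕ × ℕ, p.1 < p.2 → s p = 0)
    ∧ (∀ i j : ℕ, j ≤ i → (nu + N / 2 + j) * s (i, j) = Kz N e l j (fun i => extS s i (j + 1)) i)
    ∧ (∀ i j : ℕ, j ≤ i → nu * s (i, j) = Tz N e l j (fun i => extS s i j) i)
    ∧ (∀ i j : ℕ, 1 ≤ j → j ≤ i → ((N : ℂ) + 2 * j - 3) * (nu - N / 2 + 1 - j) * s (i, j)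
        = Lz N e l j (fun i => extS s i (j - 1)) i) := by
  have hd : ∀ i : ℕ, ((N : ℂ) + 2 * i - 1) ≠ 0 ∧ ((N : ℂ) + 2 * i + 1) ≠ 0 := fun i =>
    ⟨by convert hA i using 1; push_cast; ring, by convert hA (i + 1) using 1; push_cast; ring⟩
  refine and_congr Iff.rfl (and_congr ?_ (and_congr ?_ ?_))
  · refine forall_congr' fun i => forall_congr' fun j => forall_congr' fun hij => ?_
    obtain ⟨h1, h2⟩ := hd i
    refine iff_of_diff _ _ _ _ _ (mul_ne_zero h1 h2) ?_
    simp only [Kz, Kp, Kq, Kr, sgz_nat i j hij, pow_succ]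
    push_cast
    field_simp
    ring
  · refine forall_congr' fun i => forall_congr' fun j => forall_congr' fun hij => ?_
    obtain ⟨h1, h2⟩ := hd i
    refine iff_of_diff _ _ _ _ _ (mul_ne_zero h1 h2) ?_
    have hs : s (i, j) = extS s i j := by simp [extS, hij]
    simp only [Tz, Tp, Tq, Tr, sgz_nat i j hij, ← hs]
    push_cast
    field_simp
    ring
  · refine forall_congr' fun i => forall_congr' fun j => forall_congr' fun h1j =>
      forall_congr' fun hij => ?_
    obtain ⟨h1, h2⟩ := hd i
    refine iff_of_diff _ _ _ _ _ (mul_ne_zero h1 h2) ?_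
    simp only [Lz, Lp, Lq, Lr, sgz_nat i j hij, pow_succ]
    push_cast
    field_simp
    ring

lemma extS_zero_of (s : ℕ × ℕ → ℂ) (i j : ℤ) (h : i < j) : extS s i j = 0 := by
  unfold extS; rw [if_neg (by omega)]

lemma extS_nat (s : ℕ × ℕ → ℂ) (i j : ℕ) (h : j ≤ i) : extS s i j = s (i, j) := by
  simp [extS, h]

/-- An element of `Vsp` vanishing at `(m,m)` is zero. -/
lemma Vsp_unique (N : ℕ) (e l nu : ℂ) (hA : ∀ i : ℤ, (N : ℂ) + 2 * i - 1 ≠ 0) (m : ℕ)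
    (hm : m = 0 ∨ l + (N : ℂ) / 2 + 1 / 2 + ((m : ℂ) - 1) = 0)
    (ha : ∀ i : ℤ, (m : ℤ) ≤ i → l + (N : ℂ) / 2 + 1 / 2 + i ≠ 0)
    (hc : ∀ j : ℕ, j < m → nu + (N : ℂ) / 2 + j ≠ 0) (s : ℕ × ℕ → ℂ)
    (hs : s ∈ Vsp N e l nu) (h0 : s (m, m) = 0) : s = 0 := by
  obtain ⟨hz, hK, hT, -⟩ := (mem_Vsp N e l nu hA s).mp hs
  -- vanishing for i < m
  have low : ∀ t j : ℕ, j + t = m → ∀ i : ℤ, i < m → extS s i j = 0 := by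
    intro t
    induction t with
    | zero => intro j hj i hi; exact extS_zero_of s i j (by omega)
    | succ t ih =>
      intro j hj i hi
      by_cases hij : i < j
      · exact extS_zero_of s i j hij
      obtain ⟨k, rfl⟩ : ∃ k : ℕ, i = k := ⟨i.toNat, by omega⟩
      have hjk : j ≤ k := by omega
      have ih' := ih (j + 1) (by omega)
      push_cast at ih'
      have h1 := hK k j hjk
      rw [Kz, ih' k hi, ih' (k - 1) (by omega)] at h1
      rw [extS_nat s k j hjk]
      have h2 : Kp N e l j k * extS s (k + 1) (j + 1) = 0 := by
        by_cases hk : (k : ℤ) + 1 < m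
        · rw [ih' _ hk, mul_zero]
        · have hk' : (k : ℤ) = m - 1 := by omega
          rw [hk', Kp_zero N e l m j (hm.resolve_left (by omega)), zero_mul]
      have h3 : (nu + N / 2 + j) * s (k, j) = 0 := by rw [h1]; linear_combination h2
      exact (mul_eq_zero.mp h3).resolve_left (hc j (by omega))
  have low' : ∀ (j : ℕ) (i : ℤ), i < max (j : ℤ) m → extS s i j = 0 := by
    intro j i hi
    by_cases hj : j ≤ m
    · exact low (m - j) j (by omega) i (by omega)
    · exact extS_zero_of s i j (by omega)
  have row : ∀ j : ℕ, extS s (max (j : ℤ) m) j = 0 → ∀ i, extS s i j = 0 := by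
    intro j h i
    refine row_unique N e l nu hA j (max (j : ℤ) m) (le_max_left _ _)
      (fun i hi => ha i (le_trans (le_max_right _ _) hi)) (fun i => extS s i j) ?_ ?_ i
    · intro i hi
      obtain ⟨k, rfl⟩ : ∃ k : ℕ, i = k := ⟨i.toNat, by omega⟩
      have h1 := hT k j (by omega)
      rw [extS_nat s k j (by omega), h1]
    · intro i hi
      rcases hi.lt_or_eq with h' | h'
      · exact low' j i h'
      · rw [h']; exact h
  have up : ∀ t : ℕ, ∀ i, extS s i ((m + t : ℕ) : ℤ) = 0 := by
    intro t
    induction t with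
    | zero =>
      apply row; rw [max_eq_left (by simp), extS_nat _ _ _ (by simp)]; simpa using h0
    | succ t ih =>
      apply row
      rw [max_eq_left (by push_cast; omega)]
      have h1 := hK (m + t) (m + t) le_rfl
      rw [← extS_nat s (m + t) (m + t) le_rfl, ih, Kz, extS_zero_of s ((m + t : ℕ) : ℤ) _ (by omega),
        extS_zero_of s (((m + t : ℕ) : ℤ) - 1) _ (by omega)] at h1
      have h2 := Kp_ne N e l hA ((m + t : ℕ) : ℤ) ((m + t : ℕ) : ℤ) (ha _ (by push_cast; omega))
      have h3 : Kp N e l ((m + t : ℕ) : ℤ) ((m + t : ℕ) : ℤ)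
          * extS s (((m + t : ℕ) : ℤ) + 1) (((m + t : ℕ) : ℤ) + 1) = 0 := by linear_combination -h1
      have h4 := (mul_eq_zero.mp h3).resolve_left h2
      exact_mod_cast h4
  have down : ∀ t j : ℕ, j + t = m → ∀ i, extS s i j = 0 := by
    intro t
    induction t with
    | zero => intro j hj; have := up 0; rw [← hj] at this; simpa using this
    | succ t ih =>
      intro j hj
      apply row
      rw [max_eq_right (by omega)]
      have h1 := hK m j (by omega)
      have ih' := ih (j + 1) (by omega)
      push_cast at ih'
      rw [Kz, ih', ih', ih'] at h1
      have h3 : (nu + N / 2 + j) * s (m, j) = 0 := by rw [h1]; ring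
      rw [extS_nat _ _ _ (by omega)]
      exact (mul_eq_zero.mp h3).resolve_left (hc j (by omega))
  funext p
  obtain ⟨i, j⟩ := p
  rcases lt_or_ge i j with h | h
  · exact hz (i, j) h
  · rw [← extS_nat s i j h]
    rcases le_total j m with h' | h'
    · exact down (m - j) j (by omega) i
    · have := up (j - m) i
      rwa [Nat.add_sub_cancel' h'] at this

/-- Existence of an element of `Vsp` with value one at `(m,m)`. -/
lemma Vsp_exists (N : ℕ) (e l nu : ℂ) (he : e = 1 ∨ e = -1)
    (hA : ∀ i : ℤ, (N : ℂ) + 2 * i - 1 ≠ 0) (m : ℕ)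
    (hm : m = 0 ∨ l + (N : ℂ) / 2 + 1 / 2 + ((m : ℂ) - 1) = 0)
    (ha : ∀ i : ℤ, (m : ℤ) ≤ i → l + (N : ℂ) / 2 + 1 / 2 + i ≠ 0)
    (hc : ∀ j : ℕ, j < m → nu + (N : ℂ) / 2 + j ≠ 0) :
    ∃ s ∈ Vsp N e l nu, s (m, m) = 1 := by
  obtain ⟨E, E0, E1, ET, EK, EL⟩ := family N e l nu he hA m hm ha hc
  have hext : ∀ (j : ℕ) (i : ℤ), extS (fun p => E p.2 p.1) i j = E j i := by
    intro j i
    unfold extS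
    split_ifs with h
    · simp [h.1]
    · rw [E0 j i (by omega)]
  refine ⟨fun p => E p.2 p.1, (mem_Vsp N e l nu hA _).mpr ⟨?_, ?_, ?_, ?_⟩, E1⟩
  · intro p hp; exact E0 _ _ (by omega)
  · intro i j hij
    have : (fun i : ℤ => extS (fun p => E p.2 p.1) i ((j : ℤ) + 1)) = E (j + 1) := by
      funext i; rw [← hext]; push_cast; rfl
    rw [this]; exact EK j i
  · intro i j hij
    have : (fun i : ℤ => extS (fun p => E p.2 p.1) i (j : ℤ)) = E j := by
      funext i; rw [← hext]
    rw [this, ET]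
  · intro i j h1 hij
    obtain ⟨k, rfl⟩ : ∃ k, j = k + 1 := ⟨j - 1, by omega⟩
    have : (fun i : ℤ => extS (fun p => E p.2 p.1) i (((k + 1 : ℕ) : ℤ) - 1)) = E k := by
      funext i; rw [← hext]; push_cast; rw [add_sub_cancel_right]
    rw [this]
    have := EL k i
    push_cast
    exact this

theorem statement11 (n : ℕ) (hn : 0 < n) (hne : Even n) (lam nu : ℂ)
    (hL : (lam, nu) ∉ Lhat n) :
    ∀ eps : ℂ, (eps = 1 ∨ eps = -1) → Module.rank ℂ ↥(Vsp n eps lam nu) = 1 := by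
  intro eps he
  have hA : ∀ i : ℤ, (n : ℂ) + 2 * i - 1 ≠ 0 := by
    intro i h
    obtain ⟨r, rfl⟩ := hne
    have h' : (((r + r : ℕ) : ℤ) + 2 * i - 1 : ℤ) = 0 := by exact_mod_cast h
    push_cast at h'
    omega
  obtain ⟨m, hm, ha, hc⟩ : ∃ m : ℕ, (m = 0 ∨ lam + (n : ℂ) / 2 + 1 / 2 + ((m : ℂ) - 1) = 0)
      ∧ (∀ i : ℤ, (m : ℤ) ≤ i → lam + (n : ℂ) / 2 + 1 / 2 + i ≠ 0)
      ∧ ∀ j : ℕ, j < m → nu + (n : ℂ) / 2 + j ≠ 0 := by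
    by_cases hk : ∃ k : ℕ, lam + (n : ℂ) / 2 + 1 / 2 + k = 0
    · obtain ⟨k, hk⟩ := hk
      refine ⟨k + 1, Or.inr ?_, ?_, ?_⟩
      · push_cast; linear_combination hk
      · intro i hi h
        have h1 : (i : ℂ) = ((k : ℤ) : ℂ) := by push_cast; linear_combination h - hk
        have h2 : i = k := by exact_mod_cast h1
        push_cast at hi
        omega
      · intro j hj h
        apply hL
        refine ⟨k, j, by omega, ?_, ?_⟩
        · simp only; linear_combination hk
        · simp only; linear_combination h
    · refine ⟨0, Or.inl rfl, ?_, fun j hj => absurd hj (by omega)⟩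
      intro i hi h
      apply hk
      obtain ⟨k, rfl⟩ : ∃ k : ℕ, i = k := ⟨i.toNat, by simp at hi; omega⟩
      exact ⟨k, by exact_mod_cast h⟩
  obtain ⟨s, hs, hs1⟩ := Vsp_exists n eps lam nu he hA m hm ha hc
  rw [rank_eq_one_iff]
  refine ⟨⟨s, hs⟩, ?_, ?_⟩
  · intro h
    have h1 : s = 0 := congrArg Subtype.val h
    rw [h1] at hs1
    simp at hs1
  · rintro ⟨t, ht⟩
    refine ⟨t (m, m), Subtype.ext ?_⟩
    have hmem : t (m, m) • s - t ∈ Vsp n eps lam nu :=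
      Submodule.sub_mem _ (Submodule.smul_mem _ _ hs) ht
    have := Vsp_unique n eps lam nu hA m hm ha hc _ hmem (by simp [hs1])
    exact sub_eq_zero.mp this
end

section
/- Let n be a positive even integer, let k ≥ ℓ ≥ 0 be integers with k−ℓ even, and set λ = −ρ−1/2−k, ν = −ρ_H−1/2−ℓ. Then every s ∈ V^{−1}(λ,ν) satisfies s(i,j) = 0 whenever i ≤ k or j > ℓ, and the space V^{−1}(λ,ν) is one-dimensional. -/
namespace S12

noncomputable def sg (m : ℤ) : ℂ := if Even m then 1 else -1

lemma sg_cases (m : ℤ) : sg m = 1 ∨ sg m = -1 := by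
  unfold sg; split <;> simp

lemma sg_add_one (m : ℤ) : sg (m + 1) = - sg m := by
  unfold sg
  by_cases h : Even m <;> simp [h]

lemma sg_sub_one (m : ℤ) : sg (m - 1) = - sg m := by
  have := sg_add_one (m - 1)
  rw [sub_add_cancel] at this
  rw [this]; ring

lemma sg_natpow (i j : ℕ) (h : j ≤ i) : (-1 : ℂ) ^ (i - j) = sg ((i : ℤ) - j) := by
  unfold sg
  have e : (i : ℤ) - j = ((i - j : ℕ) : ℤ) := by omega
  rw [e]
  by_cases h : Even (i - j)
  · rw [if_pos (by exact_mod_cast h)]; exact h.neg_one_pow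
  · rw [if_neg (by exact_mod_cast h)]; exact (Nat.not_even_iff_odd.mp h).neg_one_pow

/-- rationalised form of the relations -/
structure Rel (n k l : ℕ) (T : ℤ → ℤ → ℂ) : Prop where
  supp : ∀ i j : ℤ, ¬ (0 ≤ j ∧ j ≤ i) → T i j = 0
  r1 : ∀ i j : ℤ, 0 ≤ j → j ≤ i →
    ((n : ℂ) + 2 * i - 1) * (n + 2 * i + 1) * (j - l) * T i j
      = (n + 2 * j - 1) * ((n + 2 * i - 1) * (i - k) * T (i + 1) (j + 1)
        - sg (i - j) * (n + 1 + 2 * k) * T i (j + 1)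
        - (n + 2 * i + 1) * (n + k + i) * T (i - 1) (j + 1))
  r2 : ∀ i j : ℤ, 0 ≤ j → j ≤ i →
    (-(((n : ℂ) + 2 * i - 1) * (n + 2 * i + 1) * (n + 2 * l) / 2)
      - sg (i - j) * (n + 2 * i) * (n + 2 * j - 1) * (n + 1 + 2 * k) / 2) * T i j
      = (i - j + 1) * (n + 2 * i - 1) * (i - k) * T (i + 1) j
        - (n + 2 * i + 1) * (n + i + j - 1) * (n + k + i) * T (i - 1) j
  r3 : ∀ i j : ℤ, 1 ≤ j → j ≤ i →
    -(((n : ℂ) + 2 * i - 1) * (n + 2 * i + 1) * (n + 2 * j - 3) * (n + l + j - 1)) * T i j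
      = (i - j + 1) * (i - j + 2) * (n + 2 * i - 1) * (i - k) * T (i + 1) (j - 1)
        + sg (i - j) * (i - j + 1) * (n + i + j - 1) * (n + 1 + 2 * k) * T i (j - 1)
        - (n + 2 * i + 1) * (n + i + j - 2) * (n + i + j - 1) * (n + k + i) * T (i - 1) (j - 1)

noncomputable abbrev VV (n k l : ℕ) : Submodule ℂ (ℕ × ℕ → ℂ) :=
  Vsp n (-1) (-((n : ℂ) / 2) - 1 / 2 - k) (-(((n : ℂ) - 1) / 2) - 1 / 2 - l)

lemma extS_nat (s : ℕ × ℕ → ℂ) (h : ∀ p : ℕ × ℕ, p.1 < p.2 → s p = 0) (i j : ℕ) :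
    extS s (i : ℤ) (j : ℤ) = s (i, j) := by
  unfold extS
  split
  · simp
  · rw [h]; simp; omega

lemma toRel {n k l : ℕ} {s : ℕ × ℕ → ℂ} (hs : s ∈ VV n k l) :
    Rel n k l (fun i j => Complex.I ^ (j - i) * extS s i j) := by
  obtain ⟨h0, h1, h2, h3⟩ := hs
  have I2 : Complex.I * Complex.I = -1 := Complex.I_mul_I
  have hI := Complex.I_ne_zero
  refine ⟨?_, ?_, ?_, ?_⟩
  · intro i j h
    have : extS s i j = 0 := by
      unfold extS; rw [if_neg]; omega
    simp [this]
  · intro i j hj hij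
    lift j to ℕ using hj
    lift i to ℕ using by omega
    have h := h1 i j (by omega)
    rw [pow_succ, sg_natpow i j (by omega)] at h
    rw [← extS_nat s h0] at h
    have e1 : ((j : ℤ) + 1) - (i + 1) = j - i := by ring
    have e2 : ((j : ℤ) + 1) - i = (j - i) + 1 := by ring
    have e3 : ((j : ℤ) + 1) - (i - 1) = (j - i) + 1 + 1 := by ring
    simp only [e1, e2, e3, zpow_add₀ hI, zpow_one]
    push_cast
    linear_combination Complex.I ^ ((j : ℤ) - i) * h + ((n : ℂ) + 2 * j - 1) * (n + 2 * i + 1) * (n + k + i) * Complex.I ^ ((j : ℤ) - i) * extS s (i - 1) (j + 1) * I2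
  · intro i j hj hij
    lift j to ℕ using hj
    lift i to ℕ using by omega
    have h := h2 i j (by omega)
    rw [sg_natpow i j (by omega)] at h
    rw [← extS_nat s h0] at h
    have e1 : (j : ℤ) - (i + 1) = j - i - 1 := by ring
    have e3 : (j : ℤ) - (i - 1) = (j - i) + 1 := by ring
    have e4 : Complex.I ^ ((j : ℤ) - i - 1) = - Complex.I ^ ((j : ℤ) - i) * Complex.I := by
      rw [zpow_sub_one₀ hI, Complex.inv_I]; ring
    simp only [e1, e3, e4, zpow_add₀ hI, zpow_one]
    push_cast
    linear_combination Complex.I ^ ((j : ℤ) - i) * h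
  · intro i j hj1 hij
    have hj : 0 ≤ j := by omega
    lift j to ℕ using hj
    lift i to ℕ using by omega
    have h := h3 i j (by omega) (by omega)
    rw [pow_succ, sg_natpow i j (by omega)] at h
    rw [← extS_nat s h0] at h
    have e1 : ((j : ℤ) - 1) - (i + 1) = j - i - 1 - 1 := by ring
    have e2 : ((j : ℤ) - 1) - i = (j - i) - 1 := by ring
    have e3 : ((j : ℤ) - 1) - (i - 1) = (j - i) := by ring
    simp only [e1, e2, e3, zpow_sub_one₀ hI, Complex.inv_I]
    push_cast
    linear_combination Complex.I ^ ((j : ℤ) - i) * h - ((i : ℂ) - j + 1) * (i - j + 2) * (n + 2 * i - 1) * (i - k) * Complex.I ^ ((j : ℤ) - i) * extS s (i + 1) (j - 1) * I2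

lemma ofRel {n k l : ℕ} {T : ℤ → ℤ → ℂ} (hT : Rel n k l T) :
    (fun p : ℕ × ℕ => Complex.I ^ ((p.1 : ℤ) - p.2) * T p.1 p.2) ∈ VV n k l := by
  have I2 : Complex.I * Complex.I = -1 := Complex.I_mul_I
  have hI := Complex.I_ne_zero
  set s : ℕ × ℕ → ℂ := (fun p : ℕ × ℕ => Complex.I ^ ((p.1 : ℤ) - p.2) * T p.1 p.2) with hs
  have hE : ∀ i j : ℤ, extS s i j = Complex.I ^ (i - j) * T i j := by
    intro i j
    unfold extS
    split
    · rename_i h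
      simp only [hs]
      rw [Int.toNat_of_nonneg h.1, Int.toNat_of_nonneg h.2.1]
    · rename_i h
      rw [hT.supp i j (by omega)]; simp
  refine ⟨?_, ?_, ?_, ?_⟩
  · intro p hp
    simp only [hs]
    rw [hT.supp _ _ (by omega)]; simp
  · intro i j hij
    have h := hT.r1 i j (by omega) (by omega)
    rw [pow_succ, sg_natpow i j hij]
    simp only [hE]
    simp only [hs]
    have e1 : (i : ℤ) + 1 - (j + 1) = i - j := by ring
    have e2 : (i : ℤ) - (j + 1) = (i - j) - 1 := by ring
    have e3 : (i : ℤ) - 1 - (j + 1) = (i - j) - 1 - 1 := by ring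
    simp only [e1, e2, e3, zpow_sub_one₀ hI, Complex.inv_I]
    push_cast at h ⊢
    linear_combination Complex.I ^ ((i : ℤ) - j) * h + (-sg (i - j) * (n + 2 * j - 1) * (n + 1 + 2 * k) * T i (j + 1) - ((n : ℂ) + 2 * j - 1) * (n + 2 * i + 1) * (n + k + i) * T (i - 1) (j + 1)) * Complex.I ^ ((i : ℤ) - j) * I2
  · intro i j hij
    have h := hT.r2 i j (by omega) (by omega)
    rw [sg_natpow i j hij]
    simp only [hE]
    simp only [hs]
    have e1 : (i : ℤ) + 1 - j = i - j + 1 := by ring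
    have e3 : (i : ℤ) - 1 - j = (i - j) - 1 := by ring
    simp only [e1, e3, zpow_sub_one₀ hI, Complex.inv_I, zpow_add₀ hI, zpow_one]
    push_cast at h ⊢
    linear_combination Complex.I ^ ((i : ℤ) - j) * h + (((i : ℂ) - j + 1) * (n + 2 * i - 1) * (i - k) * T (i + 1) j
      - (n + 2 * i + 1) * (n + i + j - 1) * (n + k + i) * T (i - 1) j) * Complex.I ^ ((i : ℤ) - j) * I2
  · intro i j hj hij
    have h := hT.r3 i j (by omega) (by omega)
    rw [pow_succ, sg_natpow i j hij]
    simp only [hE]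
    simp only [hs]
    have e1 : (i : ℤ) + 1 - (j - 1) = i - j + 1 + 1 := by ring
    have e2 : (i : ℤ) - (j - 1) = (i - j) + 1 := by ring
    have e3 : (i : ℤ) - 1 - (j - 1) = (i - j) := by ring
    simp only [e1, e2, e3, zpow_add₀ hI, zpow_one]
    push_cast at h ⊢
    linear_combination Complex.I ^ ((i : ℤ) - j) * h + (((i : ℂ) - j + 1) * (i - j + 2) * (n + 2 * i - 1) * (i - k) * T (i + 1) (j - 1)
      + sg (i - j) * (i - j + 1) * (n + i + j - 1) * (n + 1 + 2 * k) * T i (j - 1))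
        * Complex.I ^ ((i : ℤ) - j) * I2

end S12

namespace S12

lemma nzc {z : ℂ} (m : ℤ) (hm : m ≠ 0) (h : z = m) : z ≠ 0 := by
  rw [h]; exact_mod_cast hm

lemma zero_of_mul {c t : ℂ} (hc : c ≠ 0) (h : c * t = 0) : t = 0 :=
  (mul_eq_zero.mp h).resolve_left hc

lemma nz_a {n : ℕ} (hne : Even n) (i : ℤ) (c : ℤ) (hc : Odd c) : (n : ℂ) + 2 * i + c ≠ 0 := by
  apply nzc ((n : ℤ) + 2 * i + c)
  · obtain ⟨r, rfl⟩ := hne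
    obtain ⟨q, rfl⟩ := hc
    push_cast
    omega
  · push_cast; ring

lemma nz_m1 {n : ℕ} (hne : Even n) (i : ℤ) : (n : ℂ) + 2 * i - 1 ≠ 0 := by
  have := nz_a hne i (-1) (by decide)
  push_cast at this
  rwa [← sub_eq_add_neg] at this

lemma nz_p1 {n : ℕ} (hne : Even n) (i : ℤ) : (n : ℂ) + 2 * i + 1 ≠ 0 := by
  have := nz_a hne i 1 (by decide)
  push_cast at this
  exact this

lemma nz_m3 {n : ℕ} (hne : Even n) (i : ℤ) : (n : ℂ) + 2 * i - 3 ≠ 0 := by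
  have := nz_a hne i (-3) (by decide)
  push_cast at this
  rwa [← sub_eq_add_neg] at this

lemma nz_p3 {n : ℕ} (hne : Even n) (i : ℤ) : (n : ℂ) + 2 * i + 3 ≠ 0 := by
  have := nz_a hne i 3 (by decide)
  push_cast at this
  exact this

lemma up {n k l : ℕ} {T : ℤ → ℤ → ℂ} (hT : Rel n k l T) (hne : Even n) (i j : ℤ)
    (hj : 0 ≤ j) (hij : j ≤ i) (hik : i ≠ k) (h0 : T i j = 0) (h1 : T (i - 1) j = 0) :
    T (i + 1) j = 0 := by
  have h := hT.r2 i j hj hij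
  rw [h0, h1] at h
  have e1 : (i : ℂ) - j + 1 ≠ 0 := nzc (i - j + 1) (by omega) (by push_cast; ring)
  have e2 : (i : ℂ) - k ≠ 0 := nzc (i - k) (by omega) (by push_cast; ring)
  refine zero_of_mul (mul_ne_zero (mul_ne_zero e1 (nz_m1 hne i)) e2) ?_
  linear_combination -h

lemma colUp {n k l : ℕ} {T : ℤ → ℤ → ℂ} (hT : Rel n k l T) (hne : Even n) (r j : ℤ)
    (hj : 0 ≤ j) (hrj : j ≤ r) (h0 : T r j = 0) (h1 : T (r - 1) j = 0) (m : ℕ)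
    (hm : ∀ i : ℤ, r ≤ i → i < r + m → i ≠ k) :
    T (r + m) j = 0 ∧ T (r + m - 1) j = 0 := by
  induction m with
  | zero => simpa using ⟨h0, h1⟩
  | succ m ih =>
    have ih := ih (fun i a b => hm i a (by push_cast; omega))
    have := up hT hne (r + m) j hj (by omega) (hm _ (by omega) (by push_cast; omega)) ih.1 ih.2
    have e1 : r + ((m + 1 : ℕ) : ℤ) = r + m + 1 := by push_cast; ring
    have e2 : r + ((m + 1 : ℕ) : ℤ) - 1 = r + m := by push_cast; ring
    rw [e1]
    exact ⟨this, by rw [add_sub_cancel_right]; exact ih.1⟩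

/-- T i j is determined by column j-1 -/
lemma right {n k l : ℕ} {T : ℤ → ℤ → ℂ} (hT : Rel n k l T) (hn : 0 < n) (hne : Even n) (i j : ℤ)
    (hj : 1 ≤ j) (hij : j ≤ i) (h0 : i ≠ k → T (i + 1) (j - 1) = 0) (h1 : T i (j - 1) = 0)
    (h2 : T (i - 1) (j - 1) = 0) : T i j = 0 := by
  have h := hT.r3 i j hj hij
  have e2 : (n : ℂ) + l + j - 1 ≠ 0 := nzc (n + l + j - 1) (by omega) (by push_cast; ring)
  refine zero_of_mul (neg_ne_zero.mpr (mul_ne_zero (mul_ne_zero (mul_ne_zero (nz_m1 hne i)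
    (nz_p1 hne i)) (nz_m3 hne j)) e2)) ?_
  rw [h, h1, h2]
  by_cases hik : i = k
  · subst hik; push_cast; ring
  · rw [h0 hik]; ring

/-- two-term recurrence on column l -/
lemma twoTerm {n k l : ℕ} {T : ℤ → ℤ → ℂ} (hT : Rel n k l T) (hn : 0 < n) (hne : Even n)
    (hc : ∀ i : ℤ, i ≤ k → T i (l + 1) = 0) (i : ℤ) (hli : l ≤ i) (hik : i ≤ k) :
    ((i : ℂ) - l) * (-(n + 2 * i - 1) - sg (i - l) * (n + 1 + 2 * k)) * T i l
      = 2 * (n + i + l - 1) * (n + k + i) * T (i - 1) l := by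
  rcases eq_or_lt_of_le hli with h | h
  · subst h
    rw [hT.supp (l - 1) l (by omega)]; push_cast; ring
  have h2 := hT.r2 i l (by omega) hli
  have h3 := hT.r3 i (l + 1) (by omega) (by omega)
  rw [hc i hik] at h3
  have e : i - ((l : ℤ) + 1) = i - l - 1 := by ring
  rw [e, sg_sub_one, add_sub_cancel_right] at h3
  push_cast at h2 h3
  have nl : (n : ℂ) + 2 * l ≠ 0 := nzc (n + 2 * l) (by omega) (by push_cast; ring)
  have := mul_ne_zero nl (nz_p1 hne i)
  refine mul_left_cancel₀ this ?_
  linear_combination 2 * ((i : ℂ) - l) * h2 - 2 * h3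

lemma van1 {n k l : ℕ} {T : ℤ → ℤ → ℂ} (hT : Rel n k l T) (hn : 0 < n) (hne : Even n)
    (hlk : l ≤ k) (hkl : Even (k - l)) (i j : ℤ) (hik : i ≤ k) : T i j = 0 := by
  have s1 : ∀ i : ℤ, i ≤ k → T i (l + 1) = 0 := by
    intro i hi
    by_cases hil : i < l + 1
    · exact hT.supp _ _ (by omega)
    have h := hT.r1 l l (by omega) le_rfl
    rw [hT.supp (l : ℤ) (l + 1) (by omega), hT.supp ((l : ℤ) - 1) (l + 1) (by omega)] at h
    have t0 : T ((l : ℤ) + 1) (l + 1) = 0 := by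
      have e2 : ((l : ℤ) : ℂ) - k ≠ 0 := nzc (l - k) (by omega) (by push_cast; ring)
      refine zero_of_mul (mul_ne_zero (mul_ne_zero (nz_m1 hne l) (nz_m1 hne l)) e2) ?_
      push_cast at h ⊢
      linear_combination -h
    have := (colUp hT hne (l + 1) (l + 1) (by omega) le_rfl t0 (hT.supp _ _ (by omega))
      (i - (l + 1)).toNat (by intro a b c; omega)).1
    rwa [Int.toNat_of_nonneg (by omega), add_sub_cancel] at this
  have tt := twoTerm hT hn hne s1
  have sk : sg ((k : ℤ) - l) = 1 := by
    unfold sg; rw [if_pos]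
    have : (k : ℤ) - l = ((k - l : ℕ) : ℤ) := by omega
    rw [this]; exact_mod_cast hkl
  have s2 : T k l = 0 := by
    have h2 := hT.r2 k l (by omega) (by omega)
    have h3 := tt k (by omega) le_rfl
    rw [sk] at h2 h3
    push_cast at h2 h3
    have e1 : 2 * ((n : ℂ) + 2 * k) * (k - l) + (n + 2 * k - 1) * (n + 2 * l)
        + (n + 2 * k) * (n + 2 * l - 1) ≠ 0 := by
      obtain ⟨d, rfl⟩ := Nat.exists_eq_add_of_le hlk
      obtain ⟨n, rfl⟩ := Nat.exists_eq_add_of_lt hn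
      refine nzc (2 * ((n : ℤ) + 1 + 2 * (l + d)) * d + (n + 2 * (l + d)) * (n + 1 + 2 * l)
        + (n + 1 + 2 * (l + d)) * (n + 2 * l)) ?_ (by push_cast; ring)
      have : n ≠ 0 := by rintro rfl; simp at hne
      positivity
    have e2 : ((n : ℂ) + 2 * k + 1) ≠ 0 := nz_p1 hne k
    refine zero_of_mul (mul_ne_zero e1 e2) ?_
    linear_combination -2 * h2 - (n + 2 * k + 1) * h3
  have s3 : ∀ m : ℕ, m ≤ k - l → T (k - m) l = 0 := by
    intro m
    induction m with
    | zero => intro _; simpa using s2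
    | succ m ih =>
      intro hm
      have ih := ih (by omega)
      have h := tt (k - m) (by omega) (by omega)
      rw [ih] at h
      have e : (k : ℤ) - ((m + 1 : ℕ) : ℤ) = k - m - 1 := by push_cast; ring
      rw [e]
      have e1 : (n : ℂ) + ((k : ℤ) - (m : ℤ) : ℤ) + l - 1 ≠ 0 :=
        nzc (n + (k - m) + l - 1) (by omega) (by push_cast; ring)
      have e2 : (n : ℂ) + k + ((k : ℤ) - (m : ℤ) : ℤ) ≠ 0 :=
        nzc (n + k + (k - m)) (by omega) (by push_cast; ring)
      refine zero_of_mul (mul_ne_zero (mul_ne_zero two_ne_zero e1) e2) ?_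
      linear_combination -h
  have s4 : T l l = 0 := by
    have := s3 (k - l) le_rfl
    have e : (k : ℤ) - ((k - l : ℕ) : ℤ) = l := by omega
    rwa [e] at this
  have s5 : ∀ m : ℕ, m ≤ l → T ((l : ℤ) - m) (l - m) = 0 := by
    intro m
    induction m with
    | zero => intro _; simpa using s4
    | succ m ih =>
      intro hm
      have ih := ih (by omega)
      have e : (l : ℤ) - ((m + 1 : ℕ) : ℤ) = l - m - 1 := by push_cast; ring
      rw [e]
      have h := hT.r1 (l - m - 1) (l - m - 1) (by omega) le_rfl
      rw [sub_add_cancel, ih, hT.supp ((l : ℤ) - m - 1) (l - m) (by omega),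
        hT.supp ((l : ℤ) - m - 1 - 1) (l - m) (by omega)] at h
      have e1 : (((l : ℤ) - m - 1 : ℤ) : ℂ) - l ≠ 0 :=
        nzc (l - m - 1 - l) (by omega) (by push_cast; ring)
      refine zero_of_mul (mul_ne_zero (mul_ne_zero (nz_m1 hne (l - m - 1)) (nz_p1 hne (l - m - 1))) e1) ?_
      rw [h]; ring
  have s6 : T 0 0 = 0 := by simpa using s5 l le_rfl
  have s7 : ∀ j : ℕ, ∀ i : ℤ, i ≤ k → T i j = 0 := by
    intro j
    induction j with
    | zero =>
      intro i hi
      by_cases h : i < 0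
      · exact hT.supp _ _ (by omega)
      have := (colUp hT hne 0 0 le_rfl le_rfl s6 (hT.supp _ _ (by omega))
        i.toNat (by intro a b c; omega)).1
      rwa [Int.toNat_of_nonneg (by omega), zero_add] at this
    | succ j ih =>
      intro i hi
      by_cases h : i < j + 1
      · exact hT.supp _ _ (by push_cast; omega)
      push_cast
      apply right hT hn hne i (j + 1) (by omega) (by omega)
      · intro hh; rw [add_sub_cancel_right]; exact ih _ (by omega)
      · rw [add_sub_cancel_right]; exact ih _ (by omega)
      · rw [add_sub_cancel_right]; exact ih _ (by omega)
  by_cases hj : j < 0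
  · exact hT.supp _ _ (by omega)
  · have := s7 j.toNat i hik
    rwa [Int.toNat_of_nonneg (by omega)] at this

lemma colsRight {n k l : ℕ} {T : ℤ → ℤ → ℂ} (hT : Rel n k l T) (hn : 0 < n) (hne : Even n)
    (j : ℤ) (hj : 0 ≤ j) (h : ∀ i, T i j = 0) (m : ℕ) : ∀ i, T i (j + m) = 0 := by
  induction m with
  | zero => simpa using h
  | succ m ih =>
    intro i
    by_cases hi : i < j + m + 1
    · exact hT.supp _ _ (by push_cast; omega)
    have e : j + ((m + 1 : ℕ) : ℤ) = j + m + 1 := by push_cast; ring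
    rw [e]
    apply right hT hn hne i (j + m + 1) (by omega) (by omega)
    · intro _; rw [add_sub_cancel_right]; exact ih _
    · rw [add_sub_cancel_right]; exact ih _
    · rw [add_sub_cancel_right]; exact ih _

/-- a column vanishes if it does so in rows up to k+1 -/
lemma colAll {n k l : ℕ} {T : ℤ → ℤ → ℂ} (hT : Rel n k l T) (hne : Even n)
    (j : ℤ) (hj : 0 ≤ j) (hjk : j ≤ k + 1) (h : ∀ i : ℤ, i ≤ k → T i j = 0)
    (hb : T (k + 1) j = 0) (i : ℤ) : T i j = 0 := by
  by_cases hi : i ≤ k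
  · exact h i hi
  have := (colUp hT hne (k + 1) j hj hjk hb (by rw [add_sub_cancel_right]; exact h _ le_rfl)
    (i - (k + 1)).toNat (by intro a b c; omega)).1
  rwa [Int.toNat_of_nonneg (by omega), add_sub_cancel] at this

lemma van2 {n k l : ℕ} {T : ℤ → ℤ → ℂ} (hT : Rel n k l T) (hn : 0 < n) (hne : Even n)
    (hlk : l ≤ k) (hkl : Even (k - l)) (i j : ℤ) (hj : l < j) : T i j = 0 := by
  have v1 := van1 hT hn hne hlk hkl
  have sk : sg ((k : ℤ) - l) = 1 := by
    unfold sg; rw [if_pos]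
    have : (k : ℤ) - l = ((k - l : ℕ) : ℤ) := by omega
    rw [this]; exact_mod_cast hkl
  have t0 : T ((k : ℤ) + 1) (l + 1) = 0 := by
    have h1 := hT.r1 (k + 1) l (by omega) (by omega)
    have h2 := hT.r2 (k + 1) (l + 1) (by omega) (by omega)
    rw [add_sub_cancel_right, v1 k _ le_rfl] at h1 h2
    have e1 : (k : ℤ) + 1 - l = k - l + 1 := by ring
    have e2 : (k : ℤ) + 1 - (l + 1) = k - l := by ring
    rw [e1, sg_add_one, sk] at h1
    rw [e2, sk] at h2
    push_cast at h1 h2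
    have a1 := nz_p1 hne k
    have a2 := nz_m1 hne l
    push_cast at a1 a2
    have a3 : ((n : ℂ) + 2 * k + 3) * (n + 2 * l) + (n + 2 * k + 2) * (n + 2 * l + 1)
      - 2 * (k + 1 - l) ≠ 0 := by
      obtain ⟨d, rfl⟩ := Nat.exists_eq_add_of_le hlk
      obtain ⟨n, rfl⟩ := Nat.exists_eq_add_of_lt hn
      refine nzc (((n : ℤ) + 1 + 2 * (l + d) + 3) * (n + 1 + 2 * l)
        + (n + 1 + 2 * l + 2) * (n + 1 + 2 * l + 1) + 2 * d * (n + 1 + 2 * l) - 2) ?_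
          (by push_cast; ring)
      have : 0 ≤ ((n : ℤ) + 1 + 2 * (l + d) + 3) * (n + 2 * l)
        + (n + 1 + 2 * l + 2) * (n + 1 + 2 * l + 1) + 2 * d * (n + 1 + 2 * l) := by positivity
      intro h
      nlinarith
    refine zero_of_mul (mul_ne_zero (mul_ne_zero a1 a2) a3) ?_
    linear_combination (-2) * ((n : ℂ) + 2 * l - 1) * h2 + 2 * ((k : ℂ) + 1 - l) * h1
  have := colsRight hT hn hne (l + 1) (by omega)
    (colAll hT hne (l + 1) (by omega) (by omega) (fun i hi => v1 i _ hi) t0) (j - (l + 1)).toNat i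
  rwa [Int.toNat_of_nonneg (by omega), add_sub_cancel] at this

lemma van3 {n k l : ℕ} {T : ℤ → ℤ → ℂ} (hT : Rel n k l T) (hn : 0 < n) (hne : Even n)
    (hlk : l ≤ k) (hkl : Even (k - l)) (h : T (k + 1) 0 = 0) (i j : ℤ) : T i j = 0 := by
  have v1 := van1 hT hn hne hlk hkl
  by_cases hj : j < 0
  · exact hT.supp _ _ (by omega)
  have := colsRight hT hn hne 0 le_rfl
    (colAll hT hne 0 le_rfl (by omega) (fun i hi => v1 i _ hi) h) j.toNat i
  rwa [Int.toNat_of_nonneg (by omega), zero_add] at this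

end S12

namespace S12

/-- relation (R2) for a single column -/
def C2 (n k l : ℕ) (f : ℤ → ℂ) (j : ℤ) : Prop := ∀ i : ℤ,
    (-(((n : ℂ) + 2 * i - 1) * (n + 2 * i + 1) * (n + 2 * l) / 2)
      - sg (i - j) * (n + 2 * i) * (n + 2 * j - 1) * (n + 1 + 2 * k) / 2) * f i
      = (i - j + 1) * (n + 2 * i - 1) * (i - k) * f (i + 1)
        - (n + 2 * i + 1) * (n + i + j - 1) * (n + k + i) * f (i - 1)

/-- relation (R1), `f` column `j+1`, `g` column `j` -/
def C1 (n k l : ℕ) (f g : ℤ → ℂ) (j : ℤ) : Prop := ∀ i : ℤ,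
    ((n : ℂ) + 2 * i - 1) * (n + 2 * i + 1) * (j - l) * g i
      = (n + 2 * j - 1) * ((n + 2 * i - 1) * (i - k) * f (i + 1)
        - sg (i - j) * (n + 1 + 2 * k) * f i
        - (n + 2 * i + 1) * (n + k + i) * f (i - 1))

/-- relation (R3), `f` column `j+1`, `g` column `j` -/
def C3 (n k l : ℕ) (f g : ℤ → ℂ) (j : ℤ) : Prop := ∀ i : ℤ,
    -(((n : ℂ) + 2 * i - 1) * (n + 2 * i + 1) * (n + 2 * j - 1) * (n + l + j)) * f i
      = (i - j) * (i - j + 1) * (n + 2 * i - 1) * (i - k) * g (i + 1)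
        - sg (i - j) * (i - j) * (n + i + j) * (n + 1 + 2 * k) * g i
        - (n + 2 * i + 1) * (n + i + j - 1) * (n + i + j) * (n + k + i) * g (i - 1)

lemma stepAlg2 (a b K L s f2 f1 f0 g1 g0 p2 p1 p0 : ℂ) (hs : s = 1 ∨ s = -1)
    (n1 : a - 3 ≠ 0) (n2 : a - 1 ≠ 0) (n3 : a + 1 ≠ 0)
    (n4 : a + 3 ≠ 0) (n5 : (b + 1 - L) / 2 ≠ 0)
    (h1 : (a + 1) * (a + 3) * ((b + 1 - L) / 2) * p2 = b *
      ((a + 1) * ((a - K + 3) / 2) * f2 + s * K * f1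
        - (a + 3) * ((a + K + 1) / 2) * f0))
    (h0 : (a - 1) * (a + 1) * ((b + 1 - L) / 2) * p1 = b *
      ((a - 1) * ((a - K + 1) / 2) * f1 - s * K * f0
        - (a + 1) * ((a + K - 1) / 2) * g0))
    (hm : (a - 3) * (a - 1) * ((b + 1 - L) / 2) * p0 = b *
      ((a - 3) * ((a - K - 1) / 2) * f0 + s * K * g0
        - (a - 1) * ((a + K - 3) / 2) * g1))
    (q1 : (-((a + 1) * (a + 3) * L / 2)
      - s * (a + 2) * (b + 2) * K / 2) * f1
      = ((a - b + 1) / 2) * (a + 1) * ((a - K + 3) / 2) * f2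
        - (a + 3) * ((a + b + 3) / 2) * ((a + K + 1) / 2) * f0)
    (q0 : (-((a - 1) * (a + 1) * L / 2)
      + s * a * (b + 2) * K / 2) * f0
      = ((a - b - 1) / 2) * (a - 1) * ((a - K + 1) / 2) * f1
        - (a + 1) * ((a + b + 1) / 2) * ((a + K - 1) / 2) * g0)
    (qm : (-((a - 3) * (a - 1) * L / 2)
      - s * (a - 2) * (b + 2) * K / 2) * g0
      = ((a - b - 3) / 2) * (a - 3) * ((a - K - 1) / 2) * f0
        - (a - 1) * ((a + b - 1) / 2) * ((a + K - 3) / 2) * g1) :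
    (-((a - 1) * (a + 1) * L / 2)
      - s * a * b * K / 2) * p1
      = ((a - b + 1) / 2) * (a - 1) * ((a - K + 1) / 2) * p2
        - (a + 1) * ((a + b - 1) / 2) * ((a + K - 1) / 2) * p0 := by
  refine mul_left_cancel₀ (mul_ne_zero (mul_ne_zero (mul_ne_zero (mul_ne_zero n1 n2) n3) n4) n5) ?_
  rcases hs with rfl | rfl
  · linear_combination
      (-((a - 1) * (a + 1) * L / 2)
        - 1 * a * b * K / 2)
          * (a - 3) * (a + 3) * h0
      - ((a - b + 1) / 2) * (a - 1) * ((a - K + 1) / 2) * (a - 3) * (a - 1) * h1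
      + (a + 1) * ((a + b - 1) / 2) * ((a + K - 1) / 2) * (a + 1) * (a + 3) * hm
      - (a + 1) ^ 2 * ((a + K - 1) / 2) * b * (a + 3) * qm
      - K * b * (a - 3) * (a + 3) * q0
      + (a - 1) ^ 2 * ((a - K + 1) / 2) * b * (a - 3) * q1
  · linear_combination
      (-((a - 1) * (a + 1) * L / 2)
        + 1 * a * b * K / 2)
          * (a - 3) * (a + 3) * h0
      - ((a - b + 1) / 2) * (a - 1) * ((a - K + 1) / 2) * (a - 3) * (a - 1) * h1
      + (a + 1) * ((a + b - 1) / 2) * ((a + K - 1) / 2) * (a + 1) * (a + 3) * hm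
      - (a + 1) ^ 2 * ((a + K - 1) / 2) * b * (a + 3) * qm
      + K * b * (a - 3) * (a + 3) * q0
      + (a - 1) ^ 2 * ((a - K + 1) / 2) * b * (a - 3) * q1

lemma stepAlg3 (a b K L s f2 f1 f0 g1 g0 p2 p1 p0 : ℂ) (hs : s = 1 ∨ s = -1)
    (n1 : a - 3 ≠ 0) (n2 : a - 1 ≠ 0) (n3 : a + 1 ≠ 0)
    (n4 : a + 3 ≠ 0) (n5 : (b + 1 - L) / 2 ≠ 0)
    (h1 : (a + 1) * (a + 3) * ((b + 1 - L) / 2) * p2 = b *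
      ((a + 1) * ((a - K + 3) / 2) * f2 + s * K * f1
        - (a + 3) * ((a + K + 1) / 2) * f0))
    (h0 : (a - 1) * (a + 1) * ((b + 1 - L) / 2) * p1 = b *
      ((a - 1) * ((a - K + 1) / 2) * f1 - s * K * f0
        - (a + 1) * ((a + K - 1) / 2) * g0))
    (hm : (a - 3) * (a - 1) * ((b + 1 - L) / 2) * p0 = b *
      ((a - 3) * ((a - K - 1) / 2) * f0 + s * K * g0
        - (a - 1) * ((a + K - 3) / 2) * g1))
    (q1 : (-((a + 1) * (a + 3) * L / 2)
      - s * (a + 2) * (b + 2) * K / 2) * f1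
      = ((a - b + 1) / 2) * (a + 1) * ((a - K + 3) / 2) * f2
        - (a + 3) * ((a + b + 3) / 2) * ((a + K + 1) / 2) * f0)
    (q0 : (-((a - 1) * (a + 1) * L / 2)
      + s * a * (b + 2) * K / 2) * f0
      = ((a - b - 1) / 2) * (a - 1) * ((a - K + 1) / 2) * f1
        - (a + 1) * ((a + b + 1) / 2) * ((a + K - 1) / 2) * g0)
    (qm : (-((a - 3) * (a - 1) * L / 2)
      - s * (a - 2) * (b + 2) * K / 2) * g0
      = ((a - b - 3) / 2) * (a - 3) * ((a - K - 1) / 2) * f0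
        - (a - 1) * ((a + b - 1) / 2) * ((a + K - 3) / 2) * g1) :
    -((a - 1) * (a + 1) * b * ((b + 1 + L) / 2)) * f0
      = ((a - b - 1) / 2) * ((a - b + 1) / 2) * (a - 1) * ((a - K + 1) / 2) * p2
        - s * ((a - b - 1) / 2) * ((a + b + 1) / 2) * K * p1
        - (a + 1) * ((a + b - 1) / 2) * ((a + b + 1) / 2) * ((a + K - 1) / 2) * p0 := by
  refine mul_left_cancel₀ (mul_ne_zero (mul_ne_zero (mul_ne_zero (mul_ne_zero n1 n2) n3) n4) n5) ?_
  rcases hs with rfl | rfl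
  · linear_combination
      ((a - b - 1) / 2) * ((a + b + 1) / 2) * K * (a - 3) * (a + 3) * h0
      - ((a - b - 1) / 2) * ((a - b + 1) / 2) * (a - 1) * ((a - K + 1) / 2) * (a - 3) * (a - 1) * h1
      + (a + 1) * ((a + b - 1) / 2) * ((a + b + 1) / 2) * ((a + K - 1) / 2)
          * (a + 1) * (a + 3) * hm
      - ((a + b + 1) / 2) * (a + 1) ^ 2 * ((a + K - 1) / 2) * b * (a + 3) * qm
      + b * (-L / 2 * (a - 1) * (a + 1)
          - K / 2 * a * (b + 2))
          * (a - 3) * (a + 3) * q0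
      + ((a - b - 1) / 2) * (a - 1) ^ 2 * ((a - K + 1) / 2) * b * (a - 3) * q1
  · linear_combination
      -((a - b - 1) / 2) * ((a + b + 1) / 2) * K * (a - 3) * (a + 3) * h0
      - ((a - b - 1) / 2) * ((a - b + 1) / 2) * (a - 1) * ((a - K + 1) / 2) * (a - 3) * (a - 1) * h1
      + (a + 1) * ((a + b - 1) / 2) * ((a + b + 1) / 2) * ((a + K - 1) / 2)
          * (a + 1) * (a + 3) * hm
      - ((a + b + 1) / 2) * (a + 1) ^ 2 * ((a + K - 1) / 2) * b * (a + 3) * qm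
      + b * (-L / 2 * (a - 1) * (a + 1)
          + K / 2 * a * (b + 2))
          * (a - 3) * (a + 3) * q0
      + ((a - b - 1) / 2) * (a - 1) ^ 2 * ((a - K + 1) / 2) * b * (a - 3) * q1

lemma step {n k l : ℕ} (hne : Even n) (f g : ℤ → ℂ) (j : ℤ) (hjl : j ≠ l)
    (hf : C2 n k l f (j + 1)) (hg : C1 n k l f g j) : C2 n k l g j ∧ C3 n k l f g j := by
  have n5 : (j : ℂ) - l ≠ 0 := nzc (j - l) (by omega) (by push_cast; ring)
  have key : ∀ i : ℤ, _ := fun i => And.intro (And.intro (hg (i + 1)) (And.intro (hg i) (hg (i - 1))))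
    (And.intro (hf (i + 1)) (And.intro (hf i) (hf (i - 1))))
  have a1 : ∀ i : ℤ, sg (i + 1 - j) = - sg (i - j) := fun i => by
    rw [← sg_add_one]; congr 1; ring
  have a2 : ∀ i : ℤ, sg (i - 1 - j) = - sg (i - j) := fun i => by
    rw [← sg_sub_one]; congr 1; ring
  have a3 : ∀ i : ℤ, sg (i + 1 - (j + 1)) = sg (i - j) := fun i => by
    congr 1; ring
  have a4 : ∀ i : ℤ, sg (i - 1 - (j + 1)) = sg (i - j) := fun i => by
    rw [show i - 1 - (j + 1) = i - j - 1 - 1 by ring, sg_sub_one, sg_sub_one]; ring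
  have a5 : ∀ i : ℤ, sg (i - (j + 1)) = - sg (i - j) := fun i => by
    rw [← sg_sub_one]; congr 1; ring
  constructor
  all_goals
    intro i
    obtain ⟨⟨h1, h0, hm⟩, q1, q0, qm⟩ := key i
    rw [a1, add_sub_cancel_right] at h1
    rw [a2, sub_add_cancel] at hm
    rw [a3, add_sub_cancel_right] at q1
    rw [a4, sub_add_cancel] at qm
    rw [a5] at q0
    push_cast at h1 h0 hm q1 q0 qm
  · have z := stepAlg2 (n + 2 * i) (n + 2 * j - 1) (n + 1 + 2 * k) (n + 2 * l) (sg (i - j)) (f (i + 1 + 1)) (f (i + 1)) (f i) (f (i - 1 - 1))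
      (f (i - 1)) (g (i + 1)) (g i) (g (i - 1)) (sg_cases _) (nz_m3 hne i) (nz_m1 hne i)
      (nz_p1 hne i) (nz_p3 hne i) (fun hc => n5 (by linear_combination hc))
      (by linear_combination h1) (by linear_combination h0) (by linear_combination hm)
      (by linear_combination q1) (by linear_combination q0) (by linear_combination qm)
    linear_combination z
  · have z := stepAlg3 (n + 2 * i) (n + 2 * j - 1) (n + 1 + 2 * k) (n + 2 * l) (sg (i - j)) (f (i + 1 + 1)) (f (i + 1)) (f i) (f (i - 1 - 1))
      (f (i - 1)) (g (i + 1)) (g i) (g (i - 1)) (sg_cases _) (nz_m3 hne i) (nz_m1 hne i)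
      (nz_p1 hne i) (nz_p3 hne i) (fun hc => n5 (by linear_combination hc))
      (by linear_combination h1) (by linear_combination h0) (by linear_combination hm)
      (by linear_combination q1) (by linear_combination q0) (by linear_combination qm)
    linear_combination z

noncomputable def v (n k l : ℕ) : ℕ → ℂ
  | 0 => 1
  | m + 1 => (if Even m then -((n : ℂ) + (k + m + 2) + l - 1) / ((k + m + 2) - l)
      else ((n : ℂ) + (k + m + 2) + l - 1) * (n + k + (k + m + 2))
        / (((k + m + 2) - l) * (k + 1 - (k + m + 2)))) * v n k l m

noncomputable def u (n k l : ℕ) (i : ℤ) : ℂ :=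
  if i ≤ k then 0 else v n k l (i - k - 1).toNat

lemma u_zero (n k l : ℕ) (i : ℤ) (h : i ≤ k) : u n k l i = 0 := if_pos h

lemma u_succ (n k l : ℕ) (m : ℕ) : u n k l (k + m + 1) = v n k l m := by
  unfold u; rw [if_neg (by omega)]; congr 1; omega

lemma u_rec (n k l : ℕ) (hlk : l ≤ k) (hkl : Even (k - l)) (i : ℤ) :
    (Even (i - l) → ((i : ℂ) - l) * u n k l i = -(n + i + l - 1) * u n k l (i - 1)) ∧
    (¬ Even (i - l) → ((i : ℂ) - l) * (k + 1 - i) * u n k l i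
      = (n + i + l - 1) * (n + k + i) * u n k l (i - 1)) := by
  by_cases h1 : i ≤ k
  · rw [u_zero _ _ _ i h1, u_zero _ _ _ (i - 1) (by omega)]; simp
  by_cases h2 : i = k + 1
  · subst h2
    rw [u_zero _ _ _ ((k : ℤ) + 1 - 1) (by omega)]
    constructor
    · intro h
      exfalso
      obtain ⟨a, ha⟩ := hkl
      obtain ⟨b, hb⟩ := h
      omega
    · intro _; push_cast; ring
  obtain ⟨m, rfl⟩ : ∃ m : ℕ, i = k + m + 2 := ⟨(i - k - 2).toNat, by omega⟩
  have e1 : (k : ℤ) + m + 2 = k + ((m + 1 : ℕ) : ℤ) + 1 := by push_cast; ring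
  have e2 : (k : ℤ) + m + 2 - 1 = k + m + 1 := by ring
  have hp : Even ((k : ℤ) + m + 2 - l) ↔ Even m := by
    obtain ⟨a, ha⟩ := hkl
    constructor
    · rintro ⟨b, hb⟩
      rw [Nat.even_iff]; omega
    · rintro ⟨b, hb⟩
      rw [Int.even_iff]; omega
  have n1 : (k : ℂ) + m + 2 - l ≠ 0 := nzc (k + m + 2 - l) (by omega) (by push_cast; ring)
  have n2 : (k : ℂ) + 1 - (k + m + 2) ≠ 0 := nzc (k + 1 - (k + m + 2)) (by omega) (by push_cast; ring)
  have ev : u n k l (k + m + 2) = v n k l (m + 1) := by rw [e1, u_succ]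
  rw [hp, e2, u_succ, ev]
  constructor
  · intro h
    rw [v, if_pos h]
    push_cast
    field_simp
  · intro h
    rw [v, if_neg h]
    push_cast
    field_simp

lemma u_C2 (n k l : ℕ) (hlk : l ≤ k) (hkl : Even (k - l)) : C2 n k l (u n k l) l := by
  intro i
  have r0 := u_rec n k l hlk hkl i
  have r1 := u_rec n k l hlk hkl (i + 1)
  rw [add_sub_cancel_right] at r1
  have ep : Even (i + 1 - l) ↔ ¬ Even (i - l) := by
    rw [show i + 1 - (l : ℤ) = i - l + 1 by ring, Int.even_add_one]
  by_cases h : Even (i - (l : ℤ))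
  · have e := r0.1 h
    have o := r1.2 (by rw [ep]; simpa using h)
    rw [sg, if_pos h]
    push_cast at e o ⊢
    linear_combination ((n : ℂ) + 2 * i - 1) * o + (n + 2 * i + 1) * (n + k + i) * e
  · have o := r0.2 h
    have e := r1.1 (by rw [ep]; simpa using h)
    rw [sg, if_neg h]
    push_cast at e o ⊢
    linear_combination -((n : ℂ) + 2 * i - 1) * (i - k) * e - (n + 2 * i + 1) * o

lemma u_C3 (n k l : ℕ) (hlk : l ≤ k) (hkl : Even (k - l)) :
    C3 n k l (fun _ => 0) (u n k l) l := by
  intro i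
  have r0 := u_rec n k l hlk hkl i
  have r1 := u_rec n k l hlk hkl (i + 1)
  rw [add_sub_cancel_right] at r1
  have ep : Even (i + 1 - l) ↔ ¬ Even (i - l) := by
    rw [show i + 1 - (l : ℤ) = i - l + 1 by ring, Int.even_add_one]
  by_cases h : Even (i - (l : ℤ))
  · have e := r0.1 h
    have o := r1.2 (by rw [ep]; simpa using h)
    rw [sg, if_pos h]
    push_cast at e o ⊢
    linear_combination ((i : ℂ) - l) * (n + 2 * i - 1) * o
      + (n + 2 * i + 1) * (n + i + l) * (n + k + i) * e
  · have o := r0.2 h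
    have e := r1.1 (by rw [ep]; simpa using h)
    rw [sg, if_neg h]
    push_cast at e o ⊢
    linear_combination -((i : ℂ) - l) * (n + 2 * i - 1) * (i - k) * e
      - (n + 2 * i + 1) * (n + i + l) * o

noncomputable def col (n k l : ℕ) : ℕ → ℤ → ℂ
  | 0 => u n k l
  | d + 1 => fun i => (n + 2 * ((l - (d + 1) : ℤ) : ℂ) - 1) * ((n + 2 * i - 1) * (i - k) * col n k l d (i + 1)
        - sg (i - (l - (d + 1))) * (n + 1 + 2 * k) * col n k l d i
        - (n + 2 * i + 1) * (n + k + i) * col n k l d (i - 1))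
      / ((n + 2 * i - 1) * (n + 2 * i + 1) * (((l - (d + 1) : ℤ) : ℂ) - l))

lemma col_C1 {n : ℕ} (k l : ℕ) (hne : Even n) (d : ℕ) :
    C1 n k l (col n k l d) (col n k l (d + 1)) (l - (d + 1)) := by
  intro i
  have n5 : (((l - (d + 1) : ℤ) : ℂ) - l) ≠ 0 := nzc (l - (d + 1) - l) (by omega) (by push_cast; ring)
  rw [col]
  exact mul_div_cancel₀ _ (mul_ne_zero (mul_ne_zero (nz_m1 hne i) (nz_p1 hne i)) n5)

lemma col_C2 {n : ℕ} (k l : ℕ) (hne : Even n) (hlk : l ≤ k) (hkl : Even (k - l)) (d : ℕ) :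
    C2 n k l (col n k l d) (l - d) := by
  induction d with
  | zero => simpa [col] using u_C2 n k l hlk hkl
  | succ d ih =>
    have := (step hne (col n k l d) (col n k l (d + 1)) (l - (d + 1)) (by omega)
      (by rw [show (l : ℤ) - (d + 1) + 1 = l - d by ring]; exact ih) (col_C1 k l hne d)).1
    exact_mod_cast this

lemma col_C3 {n : ℕ} (k l : ℕ) (hne : Even n) (hlk : l ≤ k) (hkl : Even (k - l)) (d : ℕ) :
    C3 n k l (col n k l d) (col n k l (d + 1)) (l - (d + 1)) :=
  (step hne (col n k l d) (col n k l (d + 1)) (l - (d + 1)) (by omega)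
      (by rw [show (l : ℤ) - (d + 1) + 1 = l - d by ring]; exact col_C2 k l hne hlk hkl d)
      (col_C1 k l hne d)).2

lemma col_zero (n k l d : ℕ) : ∀ i : ℤ, i ≤ k → col n k l d i = 0 := by
  induction d with
  | zero => exact u_zero n k l
  | succ d ih =>
    intro i hi
    rw [col]
    beta_reduce
    rw [ih i hi, ih (i - 1) (by omega)]
    by_cases h : i = k
    · subst h; simp
    · rw [ih (i + 1) (by omega)]; simp

noncomputable def TT (n k l : ℕ) (i j : ℤ) : ℂ :=
  if 0 ≤ j ∧ j ≤ l then col n k l (l - j).toNat i else 0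

lemma TT_col (n k l d : ℕ) (hd : d ≤ l) (i : ℤ) : TT n k l i (l - d) = col n k l d i := by
  unfold TT; rw [if_pos (by omega)]; congr 1; omega

lemma TT_big (n k l : ℕ) (i j : ℤ) (hj : l < j) : TT n k l i j = 0 := by
  unfold TT; rw [if_neg (by omega)]

lemma TT_rel {n k l : ℕ} (hne : Even n) (hlk : l ≤ k) (hkl : Even (k - l)) :
    Rel n k l (TT n k l) := by
  refine ⟨?_, ?_, ?_, ?_⟩
  · intro i j h
    unfold TT
    split
    · exact col_zero _ _ _ _ _ (by omega)
    · rfl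
  · intro i j hj hij
    rcases lt_trichotomy j l with h | h | h
    · obtain ⟨d, rfl⟩ : ∃ d : ℕ, j = l - (d + 1) := ⟨(l - j - 1).toNat, by omega⟩
      have e : (l : ℤ) - (d + 1) + 1 = l - d := by ring
      have eb : ∀ i, TT n k l i (l - (d + 1)) = col n k l (d + 1) i := fun i => by
        have := TT_col n k l (d + 1) (by omega) i
        push_cast at this
        exact this
      rw [e, eb, TT_col _ _ _ _ (by omega), TT_col _ _ _ _ (by omega), TT_col _ _ _ _ (by omega)]
      exact col_C1 k l hne d i
    · subst h
      rw [TT_big _ _ _ _ (l + 1) (by omega), TT_big _ _ _ _ (l + 1) (by omega),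
        TT_big _ _ _ _ (l + 1) (by omega)]
      push_cast; ring
    · rw [TT_big _ _ _ _ (j + 1) (by omega), TT_big _ _ _ _ (j + 1) (by omega),
        TT_big _ _ _ _ (j + 1) (by omega), TT_big _ _ _ _ j h]
      ring
  · intro i j hj hij
    rcases le_or_gt j l with h | h
    · obtain ⟨d, rfl⟩ : ∃ d : ℕ, j = l - d := ⟨(l - j).toNat, by omega⟩
      rw [TT_col _ _ _ _ (by omega), TT_col _ _ _ _ (by omega), TT_col _ _ _ _ (by omega)]
      exact col_C2 k l hne hlk hkl d i
    · rw [TT_big _ _ _ _ j h, TT_big _ _ _ _ j h, TT_big _ _ _ _ j h]; ring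
  · intro i j hj hij
    obtain ⟨j, rfl⟩ : ∃ jb, j = jb + 1 := ⟨j - 1, by ring⟩
    have es : sg (i - (j + 1)) = - sg (i - j) := by
      rw [← sg_sub_one]; congr 1; ring
    rw [add_sub_cancel_right, es]
    rcases lt_trichotomy j l with h | h | h
    · obtain ⟨d, rfl⟩ : ∃ d : ℕ, j = l - (d + 1) := ⟨(l - j - 1).toNat, by omega⟩
      have e : (l : ℤ) - (d + 1) + 1 = l - d := by ring
      have eb : ∀ i, TT n k l i (l - (d + 1)) = col n k l (d + 1) i := fun i => by
        have := TT_col n k l (d + 1) (by omega) i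
        push_cast at this
        exact this
      have ec : TT n k l i (l - (d + 1) + 1) = col n k l d i := by
        rw [e, TT_col _ _ _ _ (by omega)]
      rw [ec, eb, eb, eb]
      have := col_C3 k l hne hlk hkl d i
      push_cast at this ⊢
      linear_combination this
    · subst h
      have eb : ∀ i, TT n k l i l = u n k l i := fun i => by
        have := TT_col n k l 0 (by omega) i
        simpa [col] using this
      rw [TT_big _ _ _ _ (l + 1) (by omega), eb, eb, eb]
      have := u_C3 n k l hlk hkl i
      push_cast at this ⊢
      linear_combination this
    · rw [TT_big _ _ _ _ (j + 1) (by omega), TT_big _ _ _ _ j h, TT_big _ _ _ _ j h,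
        TT_big _ _ _ _ j h]
      ring

lemma vanish {n k l : ℕ} (hn : 0 < n) (hne : Even n) (hlk : l ≤ k) (hkl : Even (k - l))
    (s : ℕ × ℕ → ℂ) (hs : s ∈ VV n k l) (h : s (k + 1, 0) = 0) : s = 0 := by
  have R := toRel hs
  have e := extS_nat s hs.1
  funext p
  have := van3 R hn hne hlk hkl (by
    have := e (k + 1) 0
    push_cast at this
    rw [this, h, mul_zero]) p.1 p.2
  rw [e] at this
  exact zero_of_mul (zpow_ne_zero _ Complex.I_ne_zero) this

end S12

theorem statement12 (n : ℕ) (hn : 0 < n) (hne : Even n) (k l : ℕ) (hlk : l ≤ k)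
    (hkl : Even (k - l)) :
    (∀ s ∈ Vsp n (-1) (-((n : ℂ) / 2) - 1 / 2 - k) (-(((n : ℂ) - 1) / 2) - 1 / 2 - l),
      ∀ i j : ℕ, (i ≤ k ∨ l < j) → s (i, j) = 0)
    ∧ Module.rank ℂ
        ↥(Vsp n (-1) (-((n : ℂ) / 2) - 1 / 2 - k) (-(((n : ℂ) - 1) / 2) - 1 / 2 - l)) = 1 := by
  have hV : ∀ s ∈ S12.VV n k l, _ := fun s hs => S12.vanish hn hne hlk hkl s hs
  constructor
  · intro s hs i j hij
    have R := S12.toRel hs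
    have e := S12.extS_nat s hs.1
    refine S12.zero_of_mul (zpow_ne_zero ((j : ℤ) - i) Complex.I_ne_zero) ?_
    rw [← e]
    rcases hij with h | h
    · exact S12.van1 R hn hne hlk hkl i j (by omega)
    · exact S12.van2 R hn hne hlk hkl i j (by omega)
  · rw [Module.rank_eq_one_iff_finrank_eq_one]
    have hw := S12.ofRel (S12.TT_rel hne hlk hkl)
    set w : ℕ × ℕ → ℂ := fun p => Complex.I ^ ((p.1 : ℤ) - p.2) * S12.TT n k l p.1 p.2 with hwd
    have hw0 : w ≠ 0 := by
      intro h
      have h1 : w (k + 1, l) = 0 := by rw [h]; rfl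
      have h2 := S12.zero_of_mul (zpow_ne_zero _ Complex.I_ne_zero) h1
      have h3 := S12.TT_col n k l 0 (by omega) (k + 1)
      have h4 := S12.u_succ n k l 0
      simp only [S12.col, S12.v, Nat.cast_zero, sub_zero, add_zero] at h3 h4
      push_cast at h2
      rw [h3, h4] at h2
      exact one_ne_zero h2
    have hwk : w (k + 1, 0) ≠ 0 := fun h => hw0 (hV w hw h)
    refine (finrank_eq_one_iff_of_nonzero' (⟨w, hw⟩ : S12.VV n k l)
      (fun h => hw0 (congrArg Subtype.val h))).mpr ?_
    rintro ⟨s, hs⟩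
    refine ⟨s (k + 1, 0) / w (k + 1, 0), ?_⟩
    have hm : (s (k + 1, 0) / w (k + 1, 0)) • w - s ∈ S12.VV n k l :=
      Submodule.sub_mem _ (Submodule.smul_mem _ _ hw) hs
    have := hV _ hm (by
      simp only [Pi.sub_apply, Pi.smul_apply, smul_eq_mul]
      rw [div_mul_cancel₀ _ hwk, sub_self])
    exact Subtype.ext (sub_eq_zero.mp this)
end
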